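/- Stretched-exponential interior growth bound in Hölder domains (estimate (3.2) in the proof of Lemma 3.2): Let α∈(1/2,1) and K>0. There exists a constant C₁>0 depending only on n, λ, Λ, α and K such that the following holds. Assume [g]_{C^{α,α/(1+α)}} ≤ K, and let u be a positive solution of u_t = Lu in 𝒞₁ with u(Ē)=1. Then for every (x,t) ∈ 𝒞_{2/3}, u(x,t) ≤ exp(C₁·h_Γ(x,t)^{1−1/α}), where h_Γ(x,t)=x_n−g(x',t). -/

import Mathlib

noncomputable section
open scoped BigOperators
open Classical

abbrev Spc (m : ℕ) := EuclideanSpace ℝ (Fin (m + 1))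
abbrev Spc' (m : ℕ) := EuclideanSpace ℝ (Fin m)

/-- The horizontal coordinates `x' ∈ ℝ^{n-1}` of a point `x ∈ ℝⁿ`. -/
def xprime {m : ℕ} (x : Spc m) : Spc' m :=
  (WithLp.equiv 2 _).symm fun i => x i.castSucc

/-- The last (vertical) coordinate `x_n` of a point `x ∈ ℝⁿ`. -/
def xlast {m : ℕ} (x : Spc m) : ℝ := x (Fin.last m)

/-- Build a point of `ℝⁿ` from `x' ∈ ℝ^{n-1}` and the vertical coordinate. -/
def mkPt {m : ℕ} (x' : Spc' m) (xn : ℝ) : Spc m :=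
  (WithLp.equiv 2 _).symm fun i => if h : i = Fin.last m then xn else x' (i.castPred h)

/-- The `i`-th standard basis vector. -/
def eVec (m : ℕ) (i : Fin (m + 1)) : Spc m := EuclideanSpace.single i 1

/-- The entry `∂²u/∂xᵢ∂xⱼ` of the spatial Hessian of `u(x,t)` at `p = (x,t)`. -/
def sHess {m : ℕ} (u : Spc m × ℝ → ℝ) (p : Spc m × ℝ) (i j : Fin (m + 1)) : ℝ :=
  fderiv ℝ (fun y => fderiv ℝ (fun z => u (z, p.2)) y (eVec m j)) p.1 (eVec m i)

/-- The operator `Lu = tr(A(x) D²ₓu)` at the point `p = (x,t)`. -/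
def Lop {m : ℕ} (A : Spc m → Matrix (Fin (m + 1)) (Fin (m + 1)) ℝ)
    (u : Spc m × ℝ → ℝ) (p : Spc m × ℝ) : ℝ :=
  ∑ i, ∑ j, A p.1 i j * sHess u p j i

/-- Uniform ellipticity with symmetric coefficients: `λ|ξ|² ≤ ξ·A(x)ξ ≤ Λ|ξ|²`. -/
def IsElliptic {m : ℕ} (lam Lam : ℝ)
    (A : Spc m → Matrix (Fin (m + 1)) (Fin (m + 1)) ℝ) : Prop :=
  (∀ x, (A x).IsSymm) ∧
  ∀ (x ξ : Spc m),
    lam * ‖ξ‖ ^ 2 ≤ ∑ i, ∑ j, ξ i * A x i j * ξ j ∧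
      ∑ i, ∑ j, ξ i * A x i j * ξ j ≤ Lam * ‖ξ‖ ^ 2

/-- `u` is (pointwise) a solution of `u_t = Lu` on `Ω`: twice continuously
differentiable in `x`, differentiable in `t`, with `∂ₜu = tr(A(x)D²ₓu)`. -/
def SolvesL {m : ℕ} (A : Spc m → Matrix (Fin (m + 1)) (Fin (m + 1)) ℝ)
    (u : Spc m × ℝ → ℝ) (Ω : Set (Spc m × ℝ)) : Prop :=
  ∀ p ∈ Ω, ContDiffAt ℝ 2 (fun y => u (y, p.2)) p.1 ∧
    HasDerivAt (fun s => u (p.1, s)) (Lop A u p) p.2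

/-- `u` is a pointwise subsolution: `u_t ≤ Lu` on `Ω`. -/
def SubSolvesL {m : ℕ} (A : Spc m → Matrix (Fin (m + 1)) (Fin (m + 1)) ℝ)
    (u : Spc m × ℝ → ℝ) (Ω : Set (Spc m × ℝ)) : Prop :=
  ∀ p ∈ Ω, ContDiffAt ℝ 2 (fun y => u (y, p.2)) p.1 ∧
    DifferentiableAt ℝ (fun s => u (p.1, s)) p.2 ∧
    deriv (fun s => u (p.1, s)) p.2 ≤ Lop A u p

/-- `u` solves the heat equation `∂ₜu = Δu` on `Ω`. -/
def SolvesHeat {m : ℕ} (u : Spc m × ℝ → ℝ) (Ω : Set (Spc m × ℝ)) : Prop :=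
  ∀ p ∈ Ω, ContDiffAt ℝ 2 (fun y => u (y, p.2)) p.1 ∧
    HasDerivAt (fun s => u (p.1, s)) (∑ i, sHess u p i i) p.2

/-- The graph `Γ = {x_n = g(x',t)}`. -/
def graphSet {m : ℕ} (g : Spc' m → ℝ → ℝ) : Set (Spc m × ℝ) :=
  {p | xlast p.1 = g (xprime p.1) p.2}

/-- The cylinder `𝒞_r` of size `r` on top of the graph of `g`. -/
def Cyl {m : ℕ} (g : Spc' m → ℝ → ℝ) (r : ℝ) : Set (Spc m × ℝ) :=
  {p | ‖xprime p.1‖ < r ∧ -r ^ 2 < p.2 ∧ p.2 < r ^ 2 ∧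
    g (xprime p.1) p.2 < xlast p.1 ∧ xlast p.1 < g (xprime p.1) p.2 + r}

/-- The point `Ē = ((0', g(0',1/2) + 1/2), 1/2)`. -/
def Ebar {m : ℕ} (g : Spc' m → ℝ → ℝ) : Spc m × ℝ := (mkPt 0 (g 0 (1 / 2) + 1 / 2), 1 / 2)

/-- The point `E̲ = ((0', g(0',−1/2) + 1/2), −1/2)`. -/
def Eund {m : ℕ} (g : Spc' m → ℝ → ℝ) : Spc m × ℝ := (mkPt 0 (g 0 (-(1 / 2)) + 1 / 2), -(1 / 2))

/-- `u` vanishes continuously on `Γ`: `u(Q) → 0` as `Q → P` within `Ω`,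
for every `P ∈ Γ` in the closure of `Ω`. -/
def VanishesOn {m : ℕ} (u : Spc m × ℝ → ℝ) (Ω Γ : Set (Spc m × ℝ)) : Prop :=
  ∀ P ∈ Γ ∩ closure Ω, Filter.Tendsto u (nhdsWithin P Ω) (nhds 0)

/-- `[g]_{C^{α,β}} ≤ K`. -/
def HolderSemi {m : ℕ} (α β K : ℝ) (g : Spc' m → ℝ → ℝ) : Prop :=
  ∀ x' y' t s, |g x' t - g y' s| ≤ K * (‖x' - y'‖ ^ α + |t - s| ^ β)

/-- The backward-in-time cylinder `𝒞_r^−` (Lipschitz setting, parabolic scaling). -/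
def CylB {m : ℕ} (g : Spc' m → ℝ → ℝ) (r : ℝ) : Set (Spc m × ℝ) :=
  {p | (∀ i : Fin m, -r < xprime p.1 i ∧ xprime p.1 i < r) ∧ -r ^ 2 < p.2 ∧ p.2 ≤ 0 ∧
    g (xprime p.1) p.2 < xlast p.1 ∧ xlast p.1 < g (xprime p.1) p.2 + r}

/-- The set `𝒜_r` of points of `𝒞_r^−` at height at least `δr` above `Γ`. -/
def ASet {m : ℕ} (g : Spc' m → ℝ → ℝ) (δ r : ℝ) : Set (Spc m × ℝ) :=
  {p ∈ CylB g r | g (xprime p.1) p.2 + δ * r ≤ xlast p.1}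

/-- The backward-in-time cylinder `𝒞_r^−` (Hölder setting, time interval `(−r,0]`). -/
def CylBH {m : ℕ} (g : Spc' m → ℝ → ℝ) (r : ℝ) : Set (Spc m × ℝ) :=
  {p | (∀ i : Fin m, -r < xprime p.1 i ∧ xprime p.1 i < r) ∧ -r < p.2 ∧ p.2 ≤ 0 ∧
    g (xprime p.1) p.2 < xlast p.1 ∧ xlast p.1 < g (xprime p.1) p.2 + r}

/-- The set `𝒜_r` of points of the Hölder cylinder `𝒞_r^−` at height at least `r^β` above `Γ`. -/
def ASetH {m : ℕ} (g : Spc' m → ℝ → ℝ) (β r : ℝ) : Set (Spc m × ℝ) :=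
  {p ∈ CylBH g r | g (xprime p.1) p.2 + r ^ β ≤ xlast p.1}

/-- The height `h_Γ(x,t) = x_n − g(x',t)` above the graph. -/
def hGamma {m : ℕ} (g : Spc' m → ℝ → ℝ) (p : Spc m × ℝ) : ℝ :=
  xlast p.1 - g (xprime p.1) p.2

abbrev Euc (n : ℕ) := EuclideanSpace ℝ (Fin n)
abbrev Bil (n : ℕ) := Euc n →L[ℝ] Euc n →L[ℝ] ℝ

/-- The Hessian of `f` at `x` as a bilinear form. -/
def hess {n : ℕ} (f : Euc n → ℝ) (x : Euc n) : Bil n := fderiv ℝ (fderiv ℝ f) x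

/-- The trace of a bilinear form. -/
def trc {n : ℕ} (H : Bil n) : ℝ :=
  ∑ i, H (EuclideanSpace.single i 1) (EuclideanSpace.single i 1)

/-- Symmetric positive semidefinite bilinear forms. -/
def PSD {n : ℕ} (H : Bil n) : Prop := (∀ v w, H v w = H w v) ∧ ∀ v, 0 ≤ H v v

/-- Linear functionals `H ↦ tr(AH)` with `lam ≤ A ≤ Lam`, described by their action on
positive semidefinite forms. -/
def EllF {n : ℕ} (lam Lam : ℝ) (l : Bil n →ₗ[ℝ] ℝ) : Prop :=
  ∀ H, PSD H → lam * trc H ≤ l H ∧ l H ≤ Lam * trc H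

/-- `u` is a pointwise supersolution at `(x,t)` of some uniformly parabolic equation. -/
def SuperAt {n : ℕ} (lam Lam : ℝ) (u : Euc n → ℝ → ℝ) (x : Euc n) (t : ℝ) : Prop :=
  ContDiffAt ℝ 2 (fun y => u y t) x ∧ ∃ d, HasDerivAt (u x) d t ∧
    ∃ l : Bil n →ₗ[ℝ] ℝ, EllF lam Lam l ∧ l (hess (fun y => u y t) x) ≤ d

/-- `u` is a pointwise solution at `(x,t)` of some uniformly parabolic equation. -/
def SolAt {n : ℕ} (lam Lam : ℝ) (u : Euc n → ℝ → ℝ) (x : Euc n) (t : ℝ) : Prop :=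
  ContDiffAt ℝ 2 (fun y => u y t) x ∧ ∃ d, HasDerivAt (u x) d t ∧
    ∃ l : Bil n →ₗ[ℝ] ℝ, EllF lam Lam l ∧ l (hess (fun y => u y t) x) = d

lemma ContDiffAt.eventually_differentiableAt {n : ℕ} {f : Euc n → ℝ} {x : Euc n}
    (hf : ContDiffAt ℝ 2 f x) : ∀ᶠ y in nhds x, DifferentiableAt ℝ f y := by
  filter_upwards [hf.eventually (by simp)] with y hy
  exact hy.differentiableAt (by simp)

lemma ContDiffAt.differentiableAt_fderiv {n : ℕ} {f : Euc n → ℝ} {x : Euc n}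
    (hf : ContDiffAt ℝ 2 f x) : DifferentiableAt ℝ (fderiv ℝ f) x :=
  (hf.fderiv_right (m := 1) (by norm_num)).differentiableAt (by simp)

lemma hess_add {n : ℕ} {f g : Euc n → ℝ} {x : Euc n} (hf : ContDiffAt ℝ 2 f x)
    (hg : ContDiffAt ℝ 2 g x) : hess (fun y => f y + g y) x = hess f x + hess g x := by
  have h : fderiv ℝ (fun y => f y + g y) =ᶠ[nhds x] fun y => fderiv ℝ f y + fderiv ℝ g y := by
    filter_upwards [hf.eventually_differentiableAt, hg.eventually_differentiableAt] with y h1 h2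
    exact fderiv_fun_add h1 h2
  unfold hess
  rw [h.fderiv_eq]
  exact fderiv_fun_add hf.differentiableAt_fderiv hg.differentiableAt_fderiv

lemma hess_const_mul {n : ℕ} {f : Euc n → ℝ} {x : Euc n} (hf : ContDiffAt ℝ 2 f x) (c : ℝ) :
    hess (fun y => c * f y) x = c • hess f x := by
  have h : fderiv ℝ (fun y => c * f y) =ᶠ[nhds x] fun y => c • fderiv ℝ f y := by
    filter_upwards [hf.eventually_differentiableAt] with y h1
    exact fderiv_const_mul h1 c
  unfold hess
  rw [h.fderiv_eq]
  exact fderiv_fun_const_smul hf.differentiableAt_fderiv c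

lemma hess_const {n : ℕ} (c : ℝ) (x : Euc n) : hess (fun _ => c) x = 0 := by
  unfold hess
  have : fderiv ℝ (fun _ : Euc n => c) = fun _ => 0 := by
    ext1 y; simp
  rw [this]; simp

lemma hess_affine {n : ℕ} {f : Euc n → ℝ} {x : Euc n} (hf : ContDiffAt ℝ 2 f x) (c k : ℝ) :
    hess (fun y => c * f y + k) x = c • hess f x := by
  rw [hess_add (f := fun y => c * f y) (contDiffAt_const.mul hf) contDiffAt_const,
    hess_const_mul hf, hess_const]
  exact add_zero (c • hess f x)

lemma hess_clm {n : ℕ} (L : Euc n →L[ℝ] ℝ) (x : Euc n) : hess (fun y => L y) x = 0 := by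
  unfold hess
  have : fderiv ℝ (fun y : Euc n => L y) = fun _ => L := by
    ext1 y; simp
  rw [this]; simp

lemma hess_symm {n : ℕ} {f : Euc n → ℝ} {x : Euc n} (hf : ContDiffAt ℝ 2 f x) (v w : Euc n) :
    hess f x v w = hess f x w v := by
  have := hf.isSymmSndFDerivAt (by simp)
  exact this v w

lemma hess_comp_affine {n : ℕ} {f : Euc n → ℝ} (a x : Euc n) (r : ℝ)
    (hf : ContDiffAt ℝ 2 f (a + r • x)) :
    hess (fun y => f (a + r • y)) x = r ^ 2 • hess f (a + r • x) := by
  have hd : ∀ y : Euc n, HasFDerivAt (fun y : Euc n => a + r • y)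
      (r • ContinuousLinearMap.id ℝ (Euc n)) y := fun y => by
    simpa using ((hasFDerivAt_id y).const_smul r).const_add a
  have hc : Filter.Tendsto (fun y : Euc n => a + r • y) (nhds x) (nhds (a + r • x)) :=
    (hd x).continuousAt
  have h : fderiv ℝ (fun y => f (a + r • y)) =ᶠ[nhds x] fun y => r • fderiv ℝ f (a + r • y) := by
    filter_upwards [hc.eventually hf.eventually_differentiableAt] with y h1
    have := (h1.hasFDerivAt.comp y (hd y)).fderiv
    rw [show (fun y => f (a + r • y)) = f ∘ (fun y => a + r • y) from rfl, this]
    ext v; simp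
  unfold hess
  rw [h.fderiv_eq]
  have h2 : HasFDerivAt (fun y => fderiv ℝ f (a + r • y))
      ((fderiv ℝ (fderiv ℝ f) (a + r • x)).comp (r • ContinuousLinearMap.id ℝ (Euc n))) x :=
    hf.differentiableAt_fderiv.hasFDerivAt.comp x (hd x)
  rw [(show HasFDerivAt (fun y => r • fderiv ℝ f (a + r • y)) _ x from h2.const_smul r).fderiv]
  ext v w; simp; ring

lemma psd_hess_of_isLocalMin {n : ℕ} {f : Euc n → ℝ} {x : Euc n} (hf : ContDiffAt ℝ 2 f x)
    (hm : IsLocalMin f x) : PSD (hess f x) := by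
  refine ⟨hess_symm hf, fun v => ?_⟩
  by_contra! hneg
  set φ : ℝ → ℝ := fun s => f (x + s • v) with hφ
  have hd : ∀ s : ℝ, HasDerivAt (fun s : ℝ => x + s • v) v s := fun s => by
    simpa using ((hasDerivAt_id s).smul_const v).const_add x
  have hc : Filter.Tendsto (fun s : ℝ => x + s • v) (nhds 0) (nhds x) := by
    simpa using (hd 0).continuousAt.tendsto
  have h1 : deriv φ =ᶠ[nhds 0] fun s => fderiv ℝ f (x + s • v) v := by
    filter_upwards [hc.eventually hf.eventually_differentiableAt] with s hs
    exact (hs.hasFDerivAt.comp_hasDerivAt s (hd s)).deriv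
  have hx0 : x + (0:ℝ) • v = x := by simp
  have h2 : HasDerivAt (fun s : ℝ => fderiv ℝ f (x + s • v) v) (hess f x v v) 0 := by
    have hA : HasFDerivAt (fderiv ℝ f) (hess f x) (x + (0:ℝ) • v) := by
      rw [hx0]; exact hf.differentiableAt_fderiv.hasFDerivAt
    have := hA.comp_hasDerivAt (0:ℝ) (hd 0)
    have h3 := (this.clm_apply (hasDerivAt_const (0:ℝ) v))
    simpa using h3
  have h3 : deriv (deriv φ) 0 = hess f x v v := by
    rw [h1.deriv_eq]; exact h2.deriv
  have hmin : IsLocalMin φ 0 := by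
    have : ∀ᶠ s in nhds (0:ℝ), f x ≤ f (x + s • v) := hc.eventually hm
    filter_upwards [this] with s hs
    simpa [hφ] using hs
  have hφc : ContinuousAt φ 0 := by
    have : ContinuousAt f (x + (0:ℝ) • v) := by rw [hx0]; exact hf.continuousAt
    exact ContinuousAt.comp (f := fun s : ℝ => x + s • v) this (hd 0).continuousAt
  have hmax : IsLocalMax φ 0 :=
    isLocalMax_of_deriv_deriv_neg (by rw [h3]; exact hneg) hmin.deriv_eq_zero hφc
  have hconst : φ =ᶠ[nhds 0] fun _ => φ 0 := by
    filter_upwards [hmin, hmax] with s h1 h2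
    exact le_antisymm h2 h1
  have : deriv φ =ᶠ[nhds 0] fun _ => 0 := by
    have := hconst.deriv
    simpa using this
  have h4 : deriv (deriv φ) 0 = 0 := by rw [this.deriv_eq]; simp
  linarith [h3, h4]

lemma PSD.trc_nonneg {n : ℕ} {H : Bil n} (h : PSD H) : 0 ≤ trc H :=
  Finset.sum_nonneg fun _ _ => h.2 _

/-- The inner product as a bilinear form. -/
def innerBil (n : ℕ) : Bil n := innerSL ℝ

/-- The rank one form `(v,w) ↦ ⟪x,v⟫⟪x,w⟫`. -/
def rankOneBil {n : ℕ} (x : Euc n) : Bil n := (innerSL ℝ x).smulRight (innerSL ℝ x)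

lemma innerBil_apply {n : ℕ} (v w : Euc n) : innerBil n v w = inner ℝ v w := rfl
lemma rankOneBil_apply {n : ℕ} (x v w : Euc n) :
    rankOneBil x v w = inner ℝ x v * inner ℝ x w := rfl

lemma psd_innerBil (n : ℕ) : PSD (innerBil n) :=
  ⟨fun v w => by simp only [innerBil_apply]; exact real_inner_comm _ _,
    fun v => by simp only [innerBil_apply]; exact real_inner_self_nonneg⟩

lemma psd_rankOneBil {n : ℕ} (x : Euc n) : PSD (rankOneBil x) :=
  ⟨fun v w => by simp only [rankOneBil_apply]; ring,
    fun v => by simp only [rankOneBil_apply]; exact mul_self_nonneg _⟩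

lemma trc_innerBil (n : ℕ) : trc (innerBil n) = n := by
  simp [trc, innerBil_apply]

lemma trc_rankOneBil {n : ℕ} (x : Euc n) : trc (rankOneBil x) = ‖x‖ ^ 2 := by
  simp [trc, rankOneBil_apply, EuclideanSpace.inner_single_right, EuclideanSpace.norm_sq_eq]
  exact Finset.sum_congr rfl fun i _ => by ring

lemma hasFDerivAt_norm_sq' {n : ℕ} (x : Euc n) :
    HasFDerivAt (fun y : Euc n => ‖y‖ ^ 2) ((2:ℝ) • innerSL ℝ x) x := by
  have := (hasStrictFDerivAt_norm_sq x).hasFDerivAt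
  rw [two_smul] at this ⊢
  exact this

lemma contDiff_barrier {n : ℕ} (c : Euc n) (b : ℝ) :
    ContDiff ℝ 2 (fun y : Euc n => (b - ‖y - c‖ ^ 2) ^ 3) :=
  (contDiff_const.sub ((contDiff_id.sub contDiff_const).norm_sq ℝ)).pow 3

/-- Hessian of the cubic bump `(b - ‖y‖²)³`. -/
lemma hess_barrier {n : ℕ} (b : ℝ) (x : Euc n) :
    hess (fun y : Euc n => (b - ‖y‖ ^ 2) ^ 3) x =
      (24 * (b - ‖x‖ ^ 2)) • rankOneBil x + (-(6 * (b - ‖x‖ ^ 2) ^ 2)) • innerBil n := by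
  have h1 : ∀ y : Euc n, HasFDerivAt (fun y : Euc n => b - ‖y‖ ^ 2) (-((2:ℝ) • innerSL ℝ y)) y :=
    fun y => (hasFDerivAt_norm_sq' y).const_sub b
  have h2 : fderiv ℝ (fun y : Euc n => (b - ‖y‖ ^ 2) ^ 3) =
      fun y => (-6 * (b - ‖y‖ ^ 2) ^ 2) • (innerSL ℝ y : Euc n →L[ℝ] ℝ) := by
    ext1 y
    rw [((h1 y).pow 3).fderiv]
    ext v; simp; ring
  unfold hess
  rw [h2]
  have h3 : HasFDerivAt (fun y : Euc n => -6 * (b - ‖y‖ ^ 2) ^ 2)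
      ((24 * (b - ‖x‖ ^ 2)) • (innerSL ℝ x : Euc n →L[ℝ] ℝ)) x := by
    have := ((h1 x).pow 2).const_mul (-6)
    refine this.congr_fderiv ?_
    ext v; simp; ring
  have h4 : HasFDerivAt (fun y : Euc n => (innerSL ℝ y : Euc n →L[ℝ] ℝ)) (innerBil n) x :=
    (innerBil n).hasFDerivAt
  rw [(show HasFDerivAt (fun y : Euc n => (-6 * (b - ‖y‖ ^ 2) ^ 2) • (innerSL ℝ y : Euc n →L[ℝ] ℝ))
    _ x from h3.smul h4).fderiv]
  ext v w
  simp [innerBil_apply, rankOneBil_apply]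
  ring

lemma SolAt.superAt {n : ℕ} {lam Lam : ℝ} {u : Euc n → ℝ → ℝ} {x : Euc n} {t : ℝ}
    (h : SolAt lam Lam u x t) : SuperAt lam Lam u x t := by
  obtain ⟨h1, d, hd, l, hl, he⟩ := h
  exact ⟨h1, d, hd, l, hl, he.le⟩

lemma SuperAt.affine {n : ℕ} {lam Lam : ℝ} {u : Euc n → ℝ → ℝ} {x : Euc n} {t : ℝ}
    (h : SuperAt lam Lam u x t) {c : ℝ} (hc : 0 ≤ c) (k : ℝ) :
    SuperAt lam Lam (fun y s => c * u y s + k) x t := by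
  obtain ⟨h1, d, hd, l, hl, he⟩ := h
  refine ⟨(contDiffAt_const.mul h1).add contDiffAt_const, c * d, (hd.const_mul c).add_const k, l,
    hl, ?_⟩
  rw [hess_affine h1, map_smul, smul_eq_mul]
  exact mul_le_mul_of_nonneg_left he hc

lemma SolAt.affine {n : ℕ} {lam Lam : ℝ} {u : Euc n → ℝ → ℝ} {x : Euc n} {t : ℝ}
    (h : SolAt lam Lam u x t) (c k : ℝ) :
    SolAt lam Lam (fun y s => c * u y s + k) x t := by
  obtain ⟨h1, d, hd, l, hl, he⟩ := h
  refine ⟨(contDiffAt_const.mul h1).add contDiffAt_const, c * d, (hd.const_mul c).add_const k, l,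
    hl, ?_⟩
  rw [hess_affine h1, map_smul, smul_eq_mul, he]

lemma hasDerivAt_time_scale {f : ℝ → ℝ} {d t0 k t : ℝ} (h : HasDerivAt f d (t0 + k * t)) :
    HasDerivAt (fun s => f (t0 + k * s)) (k * d) t := by
  have := h.comp t (((hasDerivAt_id t).const_mul k).const_add t0)
  simp only [mul_one] at this
  rw [mul_comm]
  exact this

lemma SuperAt.scale {n : ℕ} {lam Lam : ℝ} {u : Euc n → ℝ → ℝ} {x x0 : Euc n} {t t0 r : ℝ}
    (h : SuperAt lam Lam u (x0 + r • x) (t0 + r ^ 2 * t)) :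
    SuperAt lam Lam (fun y s => u (x0 + r • y) (t0 + r ^ 2 * s)) x t := by
  obtain ⟨h1, d, hd, l, hl, he⟩ := h
  refine ⟨?_, r ^ 2 * d, hasDerivAt_time_scale hd, l, hl, ?_⟩
  · exact ContDiffAt.comp (g := fun z => u z (t0 + r ^ 2 * t)) x h1
      (contDiffAt_const.add (contDiffAt_id.const_smul r))
  · rw [hess_comp_affine (f := fun z => u z (t0 + r ^ 2 * t)) x0 x r h1, map_smul, smul_eq_mul]
    exact mul_le_mul_of_nonneg_left he (by positivity)

lemma SolAt.scale {n : ℕ} {lam Lam : ℝ} {u : Euc n → ℝ → ℝ} {x x0 : Euc n} {t t0 r : ℝ}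
    (h : SolAt lam Lam u (x0 + r • x) (t0 + r ^ 2 * t)) :
    SolAt lam Lam (fun y s => u (x0 + r • y) (t0 + r ^ 2 * s)) x t := by
  obtain ⟨h1, d, hd, l, hl, he⟩ := h
  refine ⟨?_, r ^ 2 * d, hasDerivAt_time_scale hd, l, hl, ?_⟩
  · exact ContDiffAt.comp (g := fun z => u z (t0 + r ^ 2 * t)) x h1
      (contDiffAt_const.add (contDiffAt_id.const_smul r))
  · rw [hess_comp_affine (f := fun z => u z (t0 + r ^ 2 * t)) x0 x r h1, map_smul, smul_eq_mul, he]

/-- Forward-in-time lower semicontinuity. -/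
def RLsc {n : ℕ} (u : Euc n → ℝ → ℝ) (x : Euc n) (t : ℝ) : Prop :=
  ∀ c < u x t, ∀ᶠ p : Euc n × ℝ in nhds (x, t), t ≤ p.2 → c < u p.1 p.2

/-- Forward-in-time continuity. -/
def RightCont {n : ℕ} (u : Euc n → ℝ → ℝ) (x : Euc n) (t : ℝ) : Prop :=
  ∀ ε > 0, ∀ᶠ p : Euc n × ℝ in nhds (x, t), t ≤ p.2 → |u p.1 p.2 - u x t| < ε

lemma RightCont.affine {n : ℕ} {u : Euc n → ℝ → ℝ} {x : Euc n} {t : ℝ} (h : RightCont u x t)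
    (c k : ℝ) : RightCont (fun y s => c * u y s + k) x t := by
  intro ε hε
  filter_upwards [h (ε / (|c| + 1)) (by positivity)] with p hp ht
  have := hp ht
  have h2 : c * u p.1 p.2 + k - (c * u x t + k) = c * (u p.1 p.2 - u x t) := by ring
  rw [h2, abs_mul]
  rw [lt_div_iff₀ (by positivity)] at this
  nlinarith [abs_nonneg (u p.1 p.2 - u x t), abs_nonneg c]

lemma RightCont.rlsc {n : ℕ} {u : Euc n → ℝ → ℝ} {x : Euc n} {t : ℝ} (h : RightCont u x t) :
    RLsc u x t := by
  intro c hc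
  filter_upwards [h (u x t - c) (by linarith)] with p hp ht
  have := (abs_lt.1 (hp ht)).1
  linarith

lemma tendsto_scale {n : ℕ} (x0 x : Euc n) (t0 t r : ℝ) :
    Filter.Tendsto (fun p : Euc n × ℝ => (x0 + r • p.1, t0 + r ^ 2 * p.2)) (nhds (x, t))
      (nhds (x0 + r • x, t0 + r ^ 2 * t)) := by
  have : Continuous (fun p : Euc n × ℝ => (x0 + r • p.1, t0 + r ^ 2 * p.2)) := by fun_prop
  exact this.tendsto (x, t)

lemma RightCont.scale {n : ℕ} {u : Euc n → ℝ → ℝ} {x x0 : Euc n} {t t0 r : ℝ}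
    (h : RightCont u (x0 + r • x) (t0 + r ^ 2 * t)) :
    RightCont (fun y s => u (x0 + r • y) (t0 + r ^ 2 * s)) x t := by
  intro ε hε
  filter_upwards [(tendsto_scale x0 x t0 t r).eventually (h ε hε)] with p hp ht
  exact hp (by have := mul_le_mul_of_nonneg_left ht (sq_nonneg r); linarith)

lemma RLsc.scale {n : ℕ} {u : Euc n → ℝ → ℝ} {x x0 : Euc n} {t t0 r : ℝ}
    (h : RLsc u (x0 + r • x) (t0 + r ^ 2 * t)) :
    RLsc (fun y s => u (x0 + r • y) (t0 + r ^ 2 * s)) x t := by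
  intro c hc
  filter_upwards [(tendsto_scale x0 x t0 t r).eventually (h c hc)] with p hp ht
  exact hp (by have := mul_le_mul_of_nonneg_left ht (sq_nonneg r); linarith)

lemma RLsc.affine {n : ℕ} {u : Euc n → ℝ → ℝ} {x : Euc n} {t : ℝ} (h : RLsc u x t)
    {c : ℝ} (hc : 0 < c) (k : ℝ) : RLsc (fun y s => c * u y s + k) x t := by
  intro a ha
  have : (a - k) / c < u x t := by rw [div_lt_iff₀ hc]; linarith
  filter_upwards [h _ this] with p hp ht
  have := hp ht
  rw [div_lt_iff₀ hc] at this
  linarith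

lemma volume_image_le_of_local_lipschitz {h : ℝ → ℝ} {S : Set ℝ} {C : NNReal} {δ : ℝ} (hδ : 0 < δ)
    (H : ∀ s ∈ S, ∀ t ∈ S, s ≤ t → t - δ < s → |h s - h t| ≤ C * (t - s)) :
    MeasureTheory.volume (h '' S) ≤ C * MeasureTheory.volume S := by
  set I : ℤ → Set ℝ := fun k => Set.Ioc (0 + k • (δ / 2)) (0 + (k + 1) • (δ / 2)) with hI
  have hU : ⋃ k, I k = Set.univ := iUnion_Ioc_add_zsmul (by positivity) 0
  have hd : Pairwise (Function.onFun Disjoint I) := Set.pairwise_disjoint_Ioc_add_zsmul 0 (δ / 2)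
  have hloc : ∀ k, MeasureTheory.volume (h '' (S ∩ I k)) ≤ C * MeasureTheory.volume (S ∩ I k) := by
    intro k
    have hL : LipschitzOnWith C h (S ∩ I k) := by
      refine LipschitzOnWith.of_dist_le_mul fun x hx y hy => ?_
      have hx2 := hx.2
      have hy2 := hy.2
      simp only [hI, Set.mem_Ioc, zsmul_eq_mul, Int.cast_add, Int.cast_one] at hx2 hy2
      rcases le_total x y with hxy | hxy
      · rw [Real.dist_eq, dist_comm, Real.dist_eq, abs_of_nonneg (sub_nonneg.2 hxy)]
        exact H x hx.1 y hy.1 hxy (by linarith)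
      · rw [dist_comm (h x), Real.dist_eq, Real.dist_eq, abs_of_nonneg (sub_nonneg.2 hxy)]
        exact H y hy.1 x hx.1 hxy (by linarith)
    have := hL.hausdorffMeasure_image_le (d := 1) zero_le_one
    rw [MeasureTheory.hausdorffMeasure_real] at this
    simpa using this
  have hS : h '' S = ⋃ k, h '' (S ∩ I k) := by
    rw [← Set.image_iUnion, ← Set.inter_iUnion, hU, Set.inter_univ]
  calc MeasureTheory.volume (h '' S) ≤ ∑' k, MeasureTheory.volume (h '' (S ∩ I k)) := by
        rw [hS]; exact MeasureTheory.measure_iUnion_le _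
    _ ≤ ∑' k, C * MeasureTheory.volume (S ∩ I k) := ENNReal.tsum_le_tsum hloc
    _ = C * ∑' k, MeasureTheory.volume (S ∩ I k) := ENNReal.tsum_mul_left
    _ ≤ C * MeasureTheory.volume S := by
        gcongr
        set B := MeasureTheory.toMeasurable MeasureTheory.volume S with hB
        rw [← MeasureTheory.measure_toMeasurable S]
        calc ∑' k, MeasureTheory.volume (S ∩ I k) ≤ ∑' k, MeasureTheory.volume (B ∩ I k) := by
              refine ENNReal.tsum_le_tsum fun k => MeasureTheory.measure_mono ?_
              exact Set.inter_subset_inter_left _ (MeasureTheory.subset_toMeasurable _ _)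
          _ = MeasureTheory.volume (⋃ k, B ∩ I k) := by
              rw [MeasureTheory.measure_iUnion]
              · intro i j hij
                exact (hd hij).mono Set.inter_subset_right Set.inter_subset_right
              · exact fun k => (MeasureTheory.measurableSet_toMeasurable _ _).inter measurableSet_Ioc
          _ ≤ MeasureTheory.volume B := by
              refine MeasureTheory.measure_mono (Set.iUnion_subset fun k => Set.inter_subset_left)

/-- An antitone continuous function which is locally constant to the right off `Act` and has
bounded left slope on `Act` decreases by at most `C * |Act|`. -/
lemma decrease_le_volume_active {h : ℝ → ℝ} {a b : ℝ} (hab : a ≤ b) {Act : Set ℝ} {C : NNReal}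
    (hanti : AntitoneOn h (Set.Icc a b)) (hcont : ContinuousOn h (Set.Icc a b))
    (h1 : ∀ t ∈ Act, a < t → t ≤ b →
      ∃ δ > 0, ∀ s, a ≤ s → s ≤ t → t - δ < s → h s - h t ≤ C * (t - s))
    (h2 : ∀ t, a ≤ t → t < b → t ∉ Act →
      ∃ ε > 0, ∀ s, t ≤ s → s ≤ b → s < t + ε → h s = h t) :
    ENNReal.ofReal (h a - h b) ≤ C * MeasureTheory.volume (Act ∩ Set.Icc a b) := by
  set A' := Act ∩ Set.Ioc a b with hA'
  set A : ℕ → Set ℝ := fun j => {t | t ∈ A' ∧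
    ∀ s, a ≤ s → s ≤ t → t - 1 / ((j:ℝ) + 1) < s → h s - h t ≤ C * (t - s)} with hA
  have hAU : A' = ⋃ j, A j := by
    ext t
    simp only [Set.mem_iUnion, hA, Set.mem_ofPred_eq]
    constructor
    · intro ht
      obtain ⟨δ, hδ, H⟩ := h1 t ht.1 ht.2.1 ht.2.2
      obtain ⟨j, hj⟩ := exists_nat_one_div_lt hδ
      exact ⟨j, ht, fun s hs hst hs' => H s hs hst (by linarith)⟩
    · rintro ⟨j, hj, -⟩; exact hj
  have hAm : Monotone A := by
    intro i j hij t ht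
    refine ⟨ht.1, fun s hs hst hs' => ht.2 s hs hst ?_⟩
    have : 1 / ((j:ℝ) + 1) ≤ 1 / ((i:ℝ) + 1) := by
      apply one_div_le_one_div_of_le (by positivity)
      have : (i:ℝ) ≤ j := by exact_mod_cast hij
      linarith
    linarith
  have hj : ∀ j, MeasureTheory.volume (h '' A j) ≤ C * MeasureTheory.volume (A j) := by
    intro j
    refine volume_image_le_of_local_lipschitz (δ := 1 / ((j:ℝ) + 1)) (by positivity) ?_
    intro s hs t ht hst hlt
    have hs' := hs.1.2
    have ht' := ht.1.2
    have hle : h t ≤ h s := hanti ⟨hs'.1.le, hs'.2⟩ ⟨ht'.1.le, ht'.2⟩ hst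
    rw [abs_of_nonneg (by linarith)]
    exact ht.2 s hs'.1.le hst hlt
  have hAct : MeasureTheory.volume (h '' A') ≤ C * MeasureTheory.volume A' := by
    have him : h '' A' = ⋃ j, h '' A j := by rw [hAU, Set.image_iUnion]
    have hmono : Monotone fun j => h '' A j := fun i j hij => Set.image_mono (hAm hij)
    rw [him, hmono.measure_iUnion]
    refine iSup_le fun j => (hj j).trans ?_
    gcongr
    rw [hAU]; exact Set.subset_iUnion _ j
  set N : Set ℝ := {h a} ∪ {h b} ∪ h '' (Set.range ((↑) : ℚ → ℝ)) with hN
  have hN0 : MeasureTheory.volume N = 0 := by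
    refine Set.Countable.measure_zero ?_ _
    exact ((Set.countable_singleton _).union (Set.countable_singleton _)).union
      ((Set.countable_range _).image _)
  have hsub : Set.Icc (h b) (h a) ⊆ h '' A' ∪ N := by
    intro y hy
    obtain ⟨t, ht, rfl⟩ := intermediate_value_Icc' hab hcont hy
    by_cases hta : t = a
    · right; left; left; simp [hta]
    by_cases htb : t = b
    · right; left; right; simp [htb]
    have h3 : a < t := lt_of_le_of_ne ht.1 (Ne.symm hta)
    have h4 : t < b := lt_of_le_of_ne ht.2 htb
    by_cases hact : t ∈ Act
    · left; exact ⟨t, ⟨hact, h3, ht.2⟩, rfl⟩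
    · obtain ⟨ε, hε, H⟩ := h2 t ht.1 h4 hact
      obtain ⟨q, hq1, hq2⟩ := exists_rat_btwn (show t < min b (t + ε) from lt_min h4 (by linarith))
      right; right
      exact ⟨q, ⟨q, rfl⟩, H q hq1.le (hq2.le.trans (min_le_left _ _))
        (hq2.trans_le (min_le_right _ _))⟩
  calc ENNReal.ofReal (h a - h b) = MeasureTheory.volume (Set.Icc (h b) (h a)) := by
        rw [Real.volume_Icc]
    _ ≤ MeasureTheory.volume (h '' A') + MeasureTheory.volume N :=
        (MeasureTheory.measure_mono hsub).trans (MeasureTheory.measure_union_le _ _)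
    _ ≤ C * MeasureTheory.volume A' := by rw [hN0, add_zero]; exact hAct
    _ ≤ C * MeasureTheory.volume (Act ∩ Set.Icc a b) := by
        gcongr
        exact Set.inter_subset_inter_right _ Set.Ioc_subset_Icc_self

lemma abs_det_le_trc_pow {n : ℕ} {H : Bil n} (hH : PSD H) :
    |(((InnerProductSpace.toDual ℝ (Euc n)).symm.toContinuousLinearEquiv.toContinuousLinearMap.comp
      H : Euc n →L[ℝ] Euc n)).det| ≤ trc H ^ n := by
  set T : Euc n →L[ℝ] Euc n :=
    (InnerProductSpace.toDual ℝ (Euc n)).symm.toContinuousLinearEquiv.toContinuousLinearMap.comp H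
    with hT
  have hTi : ∀ v w, inner ℝ (T v) w = H v w := fun v w => by
    simp [hT]
  have hpos : (T : Euc n →ₗ[ℝ] Euc n).IsPositive := by
    refine ⟨fun v w => ?_, fun v => ?_⟩
    · change inner ℝ (T v) w = inner ℝ v (T w)
      rw [real_inner_comm (T w) v, hTi, hTi, hH.1]
    · change 0 ≤ RCLike.re (inner ℝ (T v) v)
      rw [hTi]; exact hH.2 v
  have hn : Module.finrank ℝ (Euc n) = n := by simp
  have hev := hpos.nonneg_eigenvalues hn
  have htr : trc H = ∑ i, hpos.isSymmetric.eigenvalues hn i := by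
    have h1 := hpos.isSymmetric.trace_eq_sum_eigenvalues hn
    rw [LinearMap.trace_eq_sum_inner _ (EuclideanSpace.basisFun (Fin n) ℝ)] at h1
    simp only [RCLike.ofReal_real_eq_id, id] at h1
    rw [← h1]
    refine Finset.sum_congr rfl fun i _ => ?_
    rw [real_inner_comm]
    change _ = inner ℝ (T _) _
    rw [hTi]; simp
  have hdet : T.det = ∏ i, hpos.isSymmetric.eigenvalues hn i := by
    have h1 := hpos.isSymmetric.det_eq_prod_eigenvalues hn
    simpa using h1
  rw [hdet, abs_of_nonneg (Finset.prod_nonneg fun i _ => hev i), htr]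
  calc ∏ i, hpos.isSymmetric.eigenvalues hn i
      ≤ ∏ _i : Fin n, ∑ j, hpos.isSymmetric.eigenvalues hn j := by
        refine Finset.prod_le_prod (fun i _ => hev i) fun i hi => ?_
        exact Finset.single_le_sum (f := hpos.isSymmetric.eigenvalues hn) (fun j _ => hev j) hi
    _ = _ := by simp

lemma volume_slopes_le {n : ℕ} {f : Euc n → ℝ} {A : Set (Euc n)} (hA : MeasurableSet A)
    {C δ : ℝ} (hδ : 0 < δ)
    (h : ∀ x ∈ A, ContDiffAt ℝ 2 f x ∧ PSD (hess f x) ∧ trc (hess f x) ≤ C)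
    {Y : Set (Euc n)} (hY : ∀ y ∈ Y, ∃ x ∈ A, fderiv ℝ f x = -(δ • innerSL ℝ y)) :
    MeasureTheory.volume Y ≤ ENNReal.ofReal ((C / δ) ^ n) * MeasureTheory.volume A := by
  set J : (Euc n →L[ℝ] ℝ) →L[ℝ] Euc n :=
    (InnerProductSpace.toDual ℝ (Euc n)).symm.toContinuousLinearEquiv.toContinuousLinearMap
    with hJ
  set G : Euc n → Euc n := fun x => (-δ⁻¹) • J (fderiv ℝ f x) with hG
  have hYG : Y ⊆ G '' A := by
    intro y hy
    obtain ⟨x, hx, hxy⟩ := hY y hy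
    refine ⟨x, hx, ?_⟩
    have hJy : J (innerSL ℝ y) = y := by
      apply (InnerProductSpace.toDual ℝ (Euc n)).injective
      simp [hJ]
      ext v; simp
    simp only [hG, hxy, map_neg, map_smul, hJy, smul_neg, neg_smul, neg_neg]
    rw [smul_smul, inv_mul_cancel₀ hδ.ne', one_smul]
  have hder : ∀ x ∈ A, HasFDerivWithinAt G ((-δ⁻¹) • (J.comp (hess f x))) A x := by
    intro x hx
    have h1 : HasFDerivAt (fderiv ℝ f) (hess f x) x :=
      (h x hx).1.differentiableAt_fderiv.hasFDerivAt
    exact ((J.hasFDerivAt.comp x h1).const_smul (-δ⁻¹)).hasFDerivWithinAt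
  calc MeasureTheory.volume Y ≤ MeasureTheory.volume (G '' A) := MeasureTheory.measure_mono hYG
    _ ≤ ∫⁻ x in A, ENNReal.ofReal |((-δ⁻¹) • (J.comp (hess f x))).det| :=
        MeasureTheory.addHaar_image_le_lintegral_abs_det_fderiv _ hA hder
    _ ≤ ∫⁻ _x in A, ENNReal.ofReal ((C / δ) ^ n) := by
        refine MeasureTheory.setLIntegral_mono' hA fun x hx => ENNReal.ofReal_le_ofReal ?_
        have h1 := abs_det_le_trc_pow (h x hx).2.1
        have h2 : ((-δ⁻¹) • (J.comp (hess f x))).det = (-δ⁻¹) ^ n * (J.comp (hess f x)).det := by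
          have := LinearMap.det_smul (-δ⁻¹) ((J.comp (hess f x) : Euc n →L[ℝ] Euc n) :
            Euc n →ₗ[ℝ] Euc n)
          rw [show Module.finrank ℝ (Euc n) = n by simp] at this
          exact this
        rw [h2, abs_mul, abs_pow, abs_neg, abs_of_pos (inv_pos.2 hδ), div_eq_mul_inv, mul_pow,
          mul_comm]
        refine mul_le_mul_of_nonneg_right ?_ (by positivity)
        exact h1.trans (pow_le_pow_left₀ (h x hx).2.1.trc_nonneg (h x hx).2.2 n)
    _ = _ := by simp

/-- Standing regularity assumptions for the sliding-planes argument. -/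
structure SlideHyp {n : ℕ} (v : Euc n → ℝ → ℝ) (M : ℝ) : Prop where
  cx : ∀ t ∈ Set.Icc (1 / 4 : ℝ) 1, ContinuousOn (fun x => v x t) (Metric.closedBall 0 (3 / 2))
  ct : ∀ x ∈ Metric.closedBall (0 : Euc n) (3 / 2), ContinuousOn (v x) (Set.Icc (1 / 4) 1)
  rl : ∀ x ∈ Metric.closedBall (0 : Euc n) (3 / 2), ∀ t ∈ Set.Ico (1 / 4 : ℝ) 1, RLsc v x t
  lb : ∀ x ∈ Metric.closedBall (0 : Euc n) (3 / 2), ∀ t ∈ Set.Icc (1 / 4 : ℝ) 1, -M ≤ v x t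

/-- `v` tilted by a linear function of slope `y/8`. -/
def tilt {n : ℕ} (v : Euc n → ℝ → ℝ) (y x : Euc n) (s : ℝ) : ℝ := v x s + 1 / 8 * inner ℝ y x

/-- Running minimum in time of the tilted function. -/
def lowVal {n : ℕ} (v : Euc n → ℝ → ℝ) (y : Euc n) (t : ℝ) : ℝ :=
  sInf {r | ∃ x ∈ Metric.closedBall (0 : Euc n) (3 / 2), ∃ s ∈ Set.Icc (1 / 4) t, r = tilt v y x s}

lemma abs_inner_le_of_closedBall {n : ℕ} {x : Euc n} (y : Euc n)
    (hx : x ∈ Metric.closedBall (0 : Euc n) (3 / 2)) : |inner ℝ y x| ≤ 3 / 2 * ‖y‖ := by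
  have h1 := abs_real_inner_le_norm y x
  have h2 : ‖x‖ ≤ 3 / 2 := by simpa using hx
  nlinarith [norm_nonneg y]

namespace SlideHyp
variable {n : ℕ} {v : Euc n → ℝ → ℝ} {M : ℝ}

lemma bddBelow (hv : SlideHyp v M) (y : Euc n) {t : ℝ} (ht : t ≤ 1) :
    BddBelow {r | ∃ x ∈ Metric.closedBall (0 : Euc n) (3 / 2), ∃ s ∈ Set.Icc (1 / 4) t,
      r = tilt v y x s} := by
  refine ⟨-M - 3 / 16 * ‖y‖, ?_⟩
  rintro r ⟨x, hx, s, hs, rfl⟩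
  have h1 := hv.lb x hx s ⟨hs.1, hs.2.trans ht⟩
  have h2 := (abs_le.1 (abs_inner_le_of_closedBall y hx)).1
  unfold tilt; linarith

lemma lowVal_le (hv : SlideHyp v M) (y : Euc n) {x : Euc n} {s t : ℝ} (ht : t ≤ 1)
    (hx : x ∈ Metric.closedBall (0 : Euc n) (3 / 2)) (hs : s ∈ Set.Icc (1 / 4) t) :
    lowVal v y t ≤ tilt v y x s :=
  csInf_le (hv.bddBelow y ht) ⟨x, hx, s, hs, rfl⟩

lemma le_lowVal (y : Euc n) {t c : ℝ} (ht : 1 / 4 ≤ t)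
    (h : ∀ x ∈ Metric.closedBall (0 : Euc n) (3 / 2), ∀ s ∈ Set.Icc (1 / 4) t, c ≤ tilt v y x s) :
    c ≤ lowVal v y t := by
  refine le_csInf ⟨_, 0, Metric.mem_closedBall_self (by norm_num), t, ⟨ht, le_rfl⟩, rfl⟩ ?_
  rintro r ⟨x, hx, s, hs, rfl⟩
  exact h x hx s hs

lemma exists_lt (y : Euc n) {t c : ℝ} (ht : 1 / 4 ≤ t) (hc : lowVal v y t < c) :
    ∃ x ∈ Metric.closedBall (0 : Euc n) (3 / 2), ∃ s ∈ Set.Icc (1 / 4) t, tilt v y x s < c := by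
  by_contra! h
  exact absurd (le_lowVal y ht h) (not_le.2 hc)

lemma lowVal_anti (hv : SlideHyp v M) (y : Euc n) :
    AntitoneOn (lowVal v y) (Set.Icc (1 / 4) 1) := by
  intro s hs t ht hst
  refine le_lowVal y hs.1 fun x hx r hr => ?_
  exact hv.lowVal_le y ht.2 hx ⟨hr.1, hr.2.trans hst⟩

lemma lowVal_lip (hv : SlideHyp v M) (y z : Euc n) {t : ℝ} (ht : t ∈ Set.Icc (1 / 4 : ℝ) 1) :
    lowVal v y t ≤ lowVal v z t + 3 / 16 * ‖y - z‖ := by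
  rw [← sub_le_iff_le_add]
  refine le_lowVal z ht.1 fun x hx r hr => ?_
  have h1 := hv.lowVal_le y ht.2 hx hr
  have h2 := (abs_le.1 (abs_inner_le_of_closedBall (y - z) hx)).2
  rw [inner_sub_left] at h2
  unfold tilt at *
  linarith

lemma tilt_rlsc (hv : SlideHyp v M) (y : Euc n) {x : Euc n} {t c : ℝ}
    (hx : x ∈ Metric.closedBall (0 : Euc n) (3 / 2)) (ht : t ∈ Set.Ico (1 / 4 : ℝ) 1)
    (hc : c < tilt v y x t) :
    ∀ᶠ p : Euc n × ℝ in nhds (x, t), t ≤ p.2 → c < tilt v y p.1 p.2 := by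
  unfold tilt at hc
  set e := v x t + 1 / 8 * inner ℝ y x - c with he
  have h1 := hv.rl x hx t ht (v x t - e / 2) (by linarith)
  have hcont : Continuous fun p : Euc n × ℝ => 1 / 8 * inner ℝ y p.1 := by fun_prop
  have h2 : ∀ᶠ p : Euc n × ℝ in nhds (x, t), 1 / 8 * inner ℝ y x - e / 2 < 1 / 8 * inner ℝ y p.1 :=
    hcont.continuousAt.eventually (lt_mem_nhds (by dsimp only; linarith))
  filter_upwards [h1, h2] with p hp1 hp2 hp
  have := hp1 hp
  unfold tilt
  linarith

/-- A strict lower bound for the tilted function at time `t` persists for a short time. -/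
lemma persist (hv : SlideHyp v M) (y : Euc n) {t c : ℝ} (ht : t ∈ Set.Ico (1 / 4 : ℝ) 1)
    (h : ∀ x ∈ Metric.closedBall (0 : Euc n) (3 / 2), c < tilt v y x t) :
    ∃ ε > 0, ∀ s, t ≤ s → s < t + ε → ∀ x ∈ Metric.closedBall (0 : Euc n) (3 / 2),
      c < tilt v y x s := by
  have hK : IsCompact (Metric.closedBall (0 : Euc n) (3 / 2)) := isCompact_closedBall _ _
  have := hK.eventually_forall_of_forall_eventually (x₀ := t)
    (P := fun s x => t ≤ s → c < tilt v y x s) (fun x hx => by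
      have h1 := hv.tilt_rlsc y hx ht (h x hx)
      exact (continuous_swap.tendsto (t, x)).eventually h1)
  obtain ⟨ε, hε, hb⟩ := Metric.eventually_nhds_iff.1 this
  refine ⟨ε, hε, fun s hts hs x hx => hb ?_ x hx hts⟩
  rw [Real.dist_eq, abs_of_nonneg (by linarith)]; linarith

lemma lowVal_right (hv : SlideHyp v M) (y : Euc n) {t c : ℝ} (ht : t ∈ Set.Ico (1 / 4 : ℝ) 1)
    (hc : c ≤ lowVal v y t)
    (h : ∀ x ∈ Metric.closedBall (0 : Euc n) (3 / 2), c < tilt v y x t) :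
    ∃ ε > 0, ∀ s, t ≤ s → s < t + ε → s ≤ 1 → c ≤ lowVal v y s := by
  obtain ⟨ε, hε, hp⟩ := hv.persist y ht h
  refine ⟨ε, hε, fun s hts hs hs1 => le_lowVal y (ht.1.trans hts) fun x hx r hr => ?_⟩
  rcases le_total r t with hrt | hrt
  · exact hc.trans (hv.lowVal_le y ht.2.le hx ⟨hr.1, hrt⟩)
  · exact (hp r hrt (hr.2.trans_lt hs) x hx).le

lemma lowVal_continuousOn (hv : SlideHyp v M) (y : Euc n) :
    ContinuousOn (lowVal v y) (Set.Icc (1 / 4) 1) := by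
  intro t ht
  rw [Metric.continuousWithinAt_iff]
  intro ε hε
  have hR : ∃ δ > 0, ∀ s ∈ Set.Icc (1 / 4 : ℝ) 1, t ≤ s → s < t + δ →
      lowVal v y t - ε < lowVal v y s := by
    rcases lt_or_eq_of_le ht.2 with h1 | h1
    · obtain ⟨δ, hδ, hp⟩ := hv.lowVal_right y (c := lowVal v y t - ε / 2) ⟨ht.1, h1⟩ (by linarith)
        (fun x hx => by
          have := hv.lowVal_le y ht.2 hx ⟨ht.1, le_rfl⟩
          linarith)
      exact ⟨δ, hδ, fun s hs hts hs' => by have := hp s hts hs' hs.2; linarith⟩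
    · refine ⟨1, one_pos, fun s hs hts _ => ?_⟩
      have : s = t := le_antisymm (h1 ▸ hs.2) hts
      rw [this]; linarith
  have hL : ∃ δ > 0, ∀ s ∈ Set.Icc (1 / 4 : ℝ) 1, s ≤ t → t - δ < s →
      lowVal v y s < lowVal v y t + ε := by
    obtain ⟨x, hx, r, hr, hlt⟩ := exists_lt (v := v) y ht.1 (show lowVal v y t < lowVal v y t + ε by
      linarith)
    rcases lt_or_eq_of_le hr.2 with h1 | h1
    · refine ⟨t - r, by linarith, fun s hs hst hs' => ?_⟩
      exact (hv.lowVal_le y hs.2 hx ⟨hr.1, by linarith⟩).trans_lt hlt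
    · subst h1
      have hc := hv.ct x hx r ht
      rw [Metric.continuousWithinAt_iff] at hc
      obtain ⟨δ, hδ, hcl⟩ := hc (lowVal v y r + ε - tilt v y x r) (by linarith)
      refine ⟨δ, hδ, fun s hs hst hs' => ?_⟩
      have h2 := hcl hs (by rw [Real.dist_eq, abs_sub_lt_iff]; constructor <;> linarith)
      rw [Real.dist_eq] at h2
      have h3 := (abs_lt.1 h2).2
      refine (hv.lowVal_le y hs.2 hx ⟨hs.1, le_rfl⟩).trans_lt ?_
      unfold tilt at *
      linarith
  obtain ⟨δ1, hδ1, H1⟩ := hR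
  obtain ⟨δ2, hδ2, H2⟩ := hL
  refine ⟨min δ1 δ2, lt_min hδ1 hδ2, fun s hs hd => ?_⟩
  rw [Real.dist_eq] at hd ⊢
  have hd1 := abs_lt.1 (hd.trans_le (min_le_left _ _))
  have hd2 := abs_lt.1 (hd.trans_le (min_le_right _ _))
  rcases le_total t s with h | h
  · have h1 := H1 s hs h (by linarith)
    have h2 := hv.lowVal_anti y ht hs h
    rw [abs_sub_lt_iff]; constructor <;> linarith
  · have h1 := H2 s hs h (by linarith)
    have h2 := hv.lowVal_anti y hs ht h
    rw [abs_sub_lt_iff]; constructor <;> linarith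

lemma exists_min_tilt (hv : SlideHyp v M) (y : Euc n) {t : ℝ} (ht : t ∈ Set.Icc (1 / 4 : ℝ) 1) :
    ∃ x ∈ Metric.closedBall (0 : Euc n) (3 / 2), ∀ z ∈ Metric.closedBall (0 : Euc n) (3 / 2),
      tilt v y x t ≤ tilt v y z t := by
  have hc : ContinuousOn (fun x => tilt v y x t) (Metric.closedBall (0 : Euc n) (3 / 2)) := by
    unfold tilt
    exact (hv.cx t ht).add (by fun_prop)
  obtain ⟨x, hx, hm⟩ := (isCompact_closedBall (0 : Euc n) (3 / 2)).exists_isMinOn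
    ⟨0, Metric.mem_closedBall_self (by norm_num)⟩ hc
  exact ⟨x, hx, fun z hz => hm hz⟩

/-- The time section of the running minimum loses at most `C` times the measure of active times. -/
lemma decrease_le (hv : SlideHyp v M) (y : Euc n) {a : ℝ} (ha : a ∈ Set.Icc (1 / 4 : ℝ) 1)
    {C : NNReal} {Act : Set ℝ}
    (hAct : ∀ t ∈ Set.Icc a 1, ∀ x ∈ Metric.closedBall (0 : Euc n) (3 / 2),
      tilt v y x t ≤ lowVal v y t → t ∈ Act)
    (hslope : ∀ t ∈ Set.Ioc a 1, t ∈ Act →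
      ∃ x ∈ Metric.closedBall (0 : Euc n) (3 / 2), tilt v y x t ≤ lowVal v y t ∧
      ∃ d, HasDerivAt (v x) d t ∧ -(C : ℝ) < d) :
    ENNReal.ofReal (lowVal v y a - lowVal v y 1) ≤
      C * MeasureTheory.volume (Act ∩ Set.Icc a 1) := by
  refine decrease_le_volume_active ha.2
    ((hv.lowVal_anti y).mono (Set.Icc_subset_Icc_left ha.1))
    ((hv.lowVal_continuousOn y).mono (Set.Icc_subset_Icc_left ha.1)) ?_ ?_
  · intro t htA hat ht1
    obtain ⟨x, hx, hle, d, hd, hdC⟩ := hslope t ⟨hat, ht1⟩ htA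
    have hslo : ∀ᶠ s in nhdsWithin t {t}ᶜ, -(C : ℝ) < slope (v x) t s :=
      (hasDerivAt_iff_tendsto_slope.1 hd).eventually (lt_mem_nhds hdC)
    rw [eventually_nhdsWithin_iff, Metric.eventually_nhds_iff] at hslo
    obtain ⟨δ, hδ, hs⟩ := hslo
    refine ⟨δ, hδ, fun s has hst hts => ?_⟩
    rcases eq_or_lt_of_le hst with h | h
    · subst h; simp
    have h1 := hs (y := s) (by rw [Real.dist_eq, abs_sub_lt_iff]; constructor <;> linarith) h.ne
    rw [slope_def_field, lt_div_iff_of_neg (by linarith)] at h1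
    have h2 := hv.lowVal_le y (hst.trans ht1) hx (s := s) ⟨ha.1.trans has, le_rfl⟩
    unfold tilt at *
    linarith
  · intro t hat ht1 htA
    have hgt : ∀ x ∈ Metric.closedBall (0 : Euc n) (3 / 2), lowVal v y t < tilt v y x t := by
      intro x hx
      by_contra! hle
      exact htA (hAct t ⟨hat, ht1.le⟩ x hx hle)
    obtain ⟨ε, hε, H⟩ := hv.lowVal_right y ⟨ha.1.trans hat, ht1⟩ le_rfl hgt
    refine ⟨ε, hε, fun s hts hs1 hs => le_antisymm ?_ (H s hts hs hs1)⟩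
    exact hv.lowVal_anti y ⟨ha.1.trans hat, ht1.le⟩ ⟨ha.1.trans (hat.trans hts), hs1⟩ hts

end SlideHyp

lemma measurableSet_inter_lt {X : Type*} [TopologicalSpace X] [MeasurableSpace X]
    [OpensMeasurableSpace X] {Q : Set X} (hQ : MeasurableSet Q) {f : X → ℝ} (hf : ContinuousOn f Q)
    (c : ℝ) : MeasurableSet {q | q ∈ Q ∧ f q < c} := by
  obtain ⟨O, hO, h⟩ := (continuousOn_iff'.1 hf) (Set.Iio c) isOpen_Iio
  have : {q | q ∈ Q ∧ f q < c} = O ∩ Q := by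
    rw [← h]; ext q; simp [and_comm]
  rw [this]
  exact hO.measurableSet.inter hQ

namespace SlideHyp
variable {n : ℕ} {v : Euc n → ℝ → ℝ} {M : ℝ}

lemma lowVal_joint (hv : SlideHyp v M) :
    ContinuousOn (fun q : Euc n × ℝ => lowVal v q.1 q.2)
      (Metric.closedBall 0 1 ×ˢ Set.Icc (1 / 4) 1) := by
  refine continuousOn_prod_of_continuousOn_lipschitzOnWith _ (3 / 16) ?_ ?_
  · intro y _
    exact hv.lowVal_continuousOn y
  · intro t ht
    refine LipschitzOnWith.of_le_add_mul _ fun y _ z _ => ?_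
    rw [dist_eq_norm]
    exact hv.lowVal_lip y z ht

/-- The set of slopes and times at which a tilted plane touches from below. -/
def active (v : Euc n → ℝ → ℝ) : Set (Euc n × ℝ) :=
  {q | q ∈ Metric.closedBall (0 : Euc n) 1 ×ˢ Set.Icc (1 / 4 : ℝ) 1 ∧ lowVal v q.1 q.2 ≤ -1 / 2 ∧
    ∃ x ∈ Metric.closedBall (0 : Euc n) (3 / 2), tilt v q.1 x q.2 ≤ lowVal v q.1 q.2}

lemma measurableSet_active (hv : SlideHyp v M) : MeasurableSet (active v) := by
  set Q : Set (Euc n × ℝ) := Metric.closedBall (0 : Euc n) 1 ×ˢ Set.Icc (1 / 4 : ℝ) 1 with hQ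
  have hQm : MeasurableSet Q :=
    (Metric.isClosed_closedBall.prod isClosed_Icc).measurableSet
  have hB : (Metric.closedBall (0 : Euc n) (3 / 2)).Nonempty :=
    ⟨0, Metric.mem_closedBall_self (by norm_num)⟩
  have : Nonempty (Metric.closedBall (0 : Euc n) (3 / 2)) := hB.to_subtype
  set D := TopologicalSpace.denseSeq (Metric.closedBall (0 : Euc n) (3 / 2)) with hD
  have hDd : DenseRange D := TopologicalSpace.denseRange_denseSeq _
  have hjoint := hv.lowVal_joint
  have heq : active v = {q | q ∈ Q ∧ lowVal v q.1 q.2 ≤ -1 / 2} ∩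
      ⋂ k : ℕ, ⋃ j : ℕ, {q | q ∈ Q ∧ tilt v q.1 (D j) q.2 - lowVal v q.1 q.2 < 1 / ((k : ℝ) + 1)} := by
    ext q
    simp only [active, Set.mem_ofPred_eq, Set.mem_inter_iff, Set.mem_iInter, Set.mem_iUnion]
    constructor
    · rintro ⟨hq, hlow, x, hx, hle⟩
      refine ⟨⟨hq, hlow⟩, fun k => ?_⟩
      have hc : Continuous fun z : Metric.closedBall (0 : Euc n) (3 / 2) =>
          tilt v q.1 z q.2 - lowVal v q.1 q.2 := by
        have h1 := continuousOn_iff_continuous_domRestrict.1 (hv.cx q.2 hq.2)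
        unfold tilt
        exact (h1.add (by fun_prop)).sub continuous_const
      have hop := hc.isOpen_preimage (Set.Iio (1 / ((k : ℝ) + 1))) isOpen_Iio
      have hpos : (0 : ℝ) < 1 / ((k : ℝ) + 1) := by positivity
      obtain ⟨j, hj⟩ := hDd.exists_mem_open hop ⟨⟨x, hx⟩, by
        simp only [Set.mem_preimage, Set.mem_Iio]; linarith⟩
      exact ⟨j, hq, hj⟩
    · rintro ⟨⟨hq, hlow⟩, h⟩
      refine ⟨hq, hlow, ?_⟩
      obtain ⟨x, hx, hm⟩ := hv.exists_min_tilt q.1 hq.2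
      refine ⟨x, hx, ?_⟩
      refine le_of_forall_pos_le_add fun ε hε => ?_
      obtain ⟨k, hk⟩ := exists_nat_one_div_lt hε
      obtain ⟨j, -, hj⟩ := h k
      have := hm (D j) (D j).2
      linarith
  rw [heq]
  refine MeasurableSet.inter ?_ (MeasurableSet.iInter fun k => MeasurableSet.iUnion fun j => ?_)
  · have h1 := measurableSet_inter_lt hQm hjoint.neg (1 / 2)
    have h2 : {q | q ∈ Q ∧ lowVal v q.1 q.2 ≤ -1 / 2} =
        ⋂ k : ℕ, {q | q ∈ Q ∧ lowVal v q.1 q.2 < -1 / 2 + 1 / ((k : ℝ) + 1)} := by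
      ext q
      simp only [Set.mem_ofPred_eq, Set.mem_iInter]
      constructor
      · rintro ⟨hq, h⟩ k
        have hpos : (0 : ℝ) < 1 / ((k : ℝ) + 1) := by positivity
        exact ⟨hq, by linarith⟩
      · intro h
        refine ⟨(h 0).1, le_of_forall_pos_le_add fun ε hε => ?_⟩
        obtain ⟨k, hk⟩ := exists_nat_one_div_lt hε
        have := (h k).2
        linarith
    rw [h2]
    exact MeasurableSet.iInter fun k => measurableSet_inter_lt hQm hjoint _
  · refine measurableSet_inter_lt hQm ?_ _
    refine ContinuousOn.sub ?_ hjoint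
    unfold tilt
    refine ContinuousOn.add ?_ (by fun_prop)
    exact (hv.ct _ (D j).2).comp continuousOn_snd fun q hq => hq.2

end SlideHyp

/-- Sliding-planes (parabolic ABP type) measure estimate. -/
lemma slide_measure {n : ℕ} {v : Euc n → ℝ → ℝ} {M C1 C2 : ℝ} (hC2 : 0 < C2)
    (hv : SlideHyp v M)
    (h0 : ∀ x ∈ Metric.closedBall (0 : Euc n) (3 / 2), 0 ≤ v x (1 / 4))
    {x0 : Euc n} (hx0 : x0 ∈ Metric.closedBall (0 : Euc n) (3 / 2)) (hvx0 : v x0 1 ≤ -1)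
    {S : Set (Euc n × ℝ)}
    (hcontact : ∀ x ∈ Metric.closedBall (0 : Euc n) (3 / 2), ∀ t ∈ Set.Icc (1 / 4 : ℝ) 1,
      ∀ y : Euc n, ‖y‖ ≤ 1 → tilt v y x t ≤ -1 / 2 →
      (∀ z ∈ Metric.closedBall (0 : Euc n) (3 / 2), tilt v y x t ≤ tilt v y z t) →
      (∀ s ∈ Set.Icc (1 / 4) t, v x t ≤ v x s) →
      (x, t) ∈ S ∧ ContDiffAt ℝ 2 (fun z => v z t) x ∧ PSD (hess (fun z => v z t) x) ∧
      trc (hess (fun z => v z t) x) ≤ C1 ∧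
      fderiv ℝ (fun z => v z t) x = -((1 / 8 : ℝ) • innerSL ℝ y) ∧
      ∃ d, HasDerivAt (v x) d t ∧ -C2 < d) :
    ENNReal.ofReal (1 / 4) * MeasureTheory.volume (Metric.closedBall (0 : Euc n) 1) ≤
      ENNReal.ofReal C2 * (ENNReal.ofReal ((C1 / (1 / 8)) ^ n) * MeasureTheory.volume S) := by
  set G := SlideHyp.active v with hG
  have hGm : MeasurableSet G := hv.measurableSet_active
  have hcon : ∀ y t, y ∈ Metric.closedBall (0 : Euc n) 1 → t ∈ Set.Icc (1 / 4 : ℝ) 1 →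
      lowVal v y t ≤ -1 / 2 → ∀ x ∈ Metric.closedBall (0 : Euc n) (3 / 2),
      tilt v y x t ≤ lowVal v y t →
      (x, t) ∈ S ∧ ContDiffAt ℝ 2 (fun z => v z t) x ∧ PSD (hess (fun z => v z t) x) ∧
      trc (hess (fun z => v z t) x) ≤ C1 ∧
      fderiv ℝ (fun z => v z t) x = -((1 / 8 : ℝ) • innerSL ℝ y) ∧
      ∃ d, HasDerivAt (v x) d t ∧ -C2 < d := by
    intro y t hy ht hlow x hx hle
    refine hcontact x hx t ht y (by simpa using hy) (hle.trans hlow) ?_ ?_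
    · exact fun z hz => hle.trans (hv.lowVal_le y ht.2 hz ⟨ht.1, le_rfl⟩)
    · intro s hs
      have := hle.trans (hv.lowVal_le y ht.2 hx hs)
      unfold tilt at this
      linarith
  have hlower : ∀ y ∈ Metric.closedBall (0 : Euc n) 1,
      ENNReal.ofReal (1 / 4) ≤ ENNReal.ofReal C2 * MeasureTheory.volume (Prod.mk y ⁻¹' G) := by
    intro y hy
    have hy1 : ‖y‖ ≤ 1 := by simpa using hy
    have hstart : -3 / 16 ≤ lowVal v y (1 / 4) := by
      refine SlideHyp.le_lowVal y le_rfl fun x hx s hs => ?_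
      have hs' : s = 1 / 4 := le_antisymm hs.2 hs.1
      have h1 := h0 x hx
      have h2 := (abs_le.1 (abs_inner_le_of_closedBall y hx)).1
      unfold tilt; rw [hs']; linarith
    have hend : lowVal v y 1 ≤ -13 / 16 := by
      have h1 := hv.lowVal_le y le_rfl hx0 (s := 1) ⟨by norm_num, le_rfl⟩
      have h2 := (abs_le.1 (abs_inner_le_of_closedBall y hx0)).2
      unfold tilt at h1; linarith
    obtain ⟨a, ha, hae⟩ := intermediate_value_Icc' (by norm_num) (hv.lowVal_continuousOn y)
      (show (-1 / 2 : ℝ) ∈ Set.Icc _ _ from ⟨by linarith, by linarith⟩)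
    have hlow : ∀ t ∈ Set.Icc a 1, lowVal v y t ≤ -1 / 2 := fun t ht =>
      (hv.lowVal_anti y ha ⟨ha.1.trans ht.1, ht.2⟩ ht.1).trans_eq hae
    have hd := hv.decrease_le y ha (C := C2.toNNReal) (Act := Prod.mk y ⁻¹' G) ?_ ?_
    · calc ENNReal.ofReal (1 / 4) ≤ ENNReal.ofReal (lowVal v y a - lowVal v y 1) := by
            apply ENNReal.ofReal_le_ofReal; linarith
        _ ≤ _ := hd
        _ ≤ _ := by
            rw [ENNReal.ofReal]
            gcongr
            exact Set.inter_subset_left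
    · intro t ht x hx hle
      exact ⟨⟨hy, ha.1.trans ht.1, ht.2⟩, hlow t ht, x, hx, hle⟩
    · rintro t ht ⟨⟨-, ht2⟩, hl, x, hx, hle⟩
      obtain ⟨-, -, -, -, -, d, hd, hdC⟩ := hcon y t hy ht2 hl x hx hle
      exact ⟨x, hx, hle, d, hd, by rwa [Real.coe_toNNReal _ hC2.le]⟩
  set S' := MeasureTheory.toMeasurable MeasureTheory.volume S with hS'
  have hupper : ∀ t, MeasureTheory.volume ((fun y => (y, t)) ⁻¹' G) ≤
      ENNReal.ofReal ((C1 / (1 / 8)) ^ n) * MeasureTheory.volume ((fun x => (x, t)) ⁻¹' S') := by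
    intro t
    by_cases ht : t ∈ Set.Icc (1 / 4 : ℝ) 1
    swap
    · have : (fun y => (y, t)) ⁻¹' G = ∅ := by
        ext y; simp only [Set.mem_preimage, Set.mem_empty_iff_false, iff_false]
        exact fun h => ht h.1.2
      rw [this]; simp
    set A : Set (Euc n) := Prod.fst '' {q : Euc n × Euc n |
      q ∈ Metric.closedBall (0 : Euc n) (3 / 2) ×ˢ Metric.closedBall (0 : Euc n) 1 ∧
      lowVal v q.2 t ≤ -1 / 2 ∧ tilt v q.2 q.1 t ≤ lowVal v q.2 t} with hA
    have hK : IsCompact (Metric.closedBall (0 : Euc n) (3 / 2) ×ˢ Metric.closedBall (0 : Euc n) 1) :=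
      (isCompact_closedBall _ _).prod (isCompact_closedBall _ _)
    have hAc : IsCompact A := by
      refine IsCompact.image ?_ continuous_fst
      have hl : ContinuousOn (fun q : Euc n × Euc n => lowVal v q.2 t)
          (Metric.closedBall (0 : Euc n) (3 / 2) ×ˢ Metric.closedBall (0 : Euc n) 1) :=
        hv.lowVal_joint.comp (f := fun q : Euc n × Euc n => (q.2, t)) (by fun_prop)
          fun q hq => ⟨hq.2, ht⟩
      have hti : ContinuousOn (fun q : Euc n × Euc n => tilt v q.2 q.1 t)
          (Metric.closedBall (0 : Euc n) (3 / 2) ×ˢ Metric.closedBall (0 : Euc n) 1) := by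
        unfold tilt
        refine ContinuousOn.add ?_ (by fun_prop)
        exact (hv.cx t ht).comp continuousOn_fst fun q hq => hq.1
      have hcl : IsClosed {q : Euc n × Euc n |
          q ∈ Metric.closedBall (0 : Euc n) (3 / 2) ×ˢ Metric.closedBall (0 : Euc n) 1 ∧
          lowVal v q.2 t ≤ -1 / 2 ∧ tilt v q.2 q.1 t ≤ lowVal v q.2 t} := by
        have h1 := hl.preimage_isClosed_of_isClosed hK.isClosed (isClosed_Iic (a := (-1 / 2 : ℝ)))
        have h2 := (hti.sub hl).preimage_isClosed_of_isClosed hK.isClosed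
          (isClosed_Iic (a := (0 : ℝ)))
        convert h1.inter h2 using 1
        ext q
        simp only [Set.mem_ofPred_eq, Set.mem_inter_iff, Set.mem_preimage, Set.mem_Iic, Pi.sub_apply,
          sub_nonpos]
        tauto
      exact hK.of_isClosed_subset hcl fun q hq => hq.1
    have hslopes := volume_slopes_le (f := fun z => v z t) hAc.measurableSet
      (show (0 : ℝ) < 1 / 8 by norm_num) (C := C1) (Y := (fun y => (y, t)) ⁻¹' G) ?_ ?_
    · refine hslopes.trans ?_
      gcongr
      rintro x ⟨⟨x', y⟩, ⟨hq, hl, hle⟩, rfl⟩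
      exact MeasureTheory.subset_toMeasurable _ _ (hcon y t hq.2 ht hl x' hq.1 hle).1
    · rintro x ⟨⟨x', y⟩, ⟨hq, hl, hle⟩, rfl⟩
      obtain ⟨-, h1, h2, h3, -⟩ := hcon y t hq.2 ht hl x' hq.1 hle
      exact ⟨h1, h2, h3⟩
    · rintro y ⟨⟨hy, -⟩, hl, x, hx, hle⟩
      exact ⟨x, ⟨(x, y), ⟨⟨hx, hy⟩, hl, hle⟩, rfl⟩, (hcon y t hy ht hl x hx hle).2.2.2.2.1⟩
  calc ENNReal.ofReal (1 / 4) * MeasureTheory.volume (Metric.closedBall (0 : Euc n) 1)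
      = ∫⁻ _y in Metric.closedBall (0 : Euc n) 1, ENNReal.ofReal (1 / 4) := by simp
    _ ≤ ∫⁻ y in Metric.closedBall (0 : Euc n) 1,
        ENNReal.ofReal C2 * MeasureTheory.volume (Prod.mk y ⁻¹' G) :=
        MeasureTheory.setLIntegral_mono' Metric.isClosed_closedBall.measurableSet hlower
    _ ≤ ∫⁻ y, ENNReal.ofReal C2 * MeasureTheory.volume (Prod.mk y ⁻¹' G) :=
        MeasureTheory.setLIntegral_le_lintegral _ _
    _ = ENNReal.ofReal C2 * MeasureTheory.volume G := by
        rw [MeasureTheory.lintegral_const_mul' _ _ ENNReal.ofReal_ne_top,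
          MeasureTheory.Measure.volume_eq_prod, MeasureTheory.Measure.prod_apply hGm]
    _ = ENNReal.ofReal C2 * ∫⁻ t, MeasureTheory.volume ((fun y => (y, t)) ⁻¹' G) := by
        rw [MeasureTheory.Measure.volume_eq_prod, MeasureTheory.Measure.prod_apply_symm hGm]
    _ ≤ ENNReal.ofReal C2 * ∫⁻ t, ENNReal.ofReal ((C1 / (1 / 8)) ^ n) *
          MeasureTheory.volume ((fun x => (x, t)) ⁻¹' S') := by
        gcongr with t
        exact hupper t
    _ = ENNReal.ofReal C2 * (ENNReal.ofReal ((C1 / (1 / 8)) ^ n) * MeasureTheory.volume S) := by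
        rw [MeasureTheory.lintegral_const_mul' _ _ ENNReal.ofReal_ne_top,
          ← MeasureTheory.measure_toMeasurable S, ← hS', MeasureTheory.Measure.volume_eq_prod,
          MeasureTheory.Measure.prod_apply_symm (MeasureTheory.measurableSet_toMeasurable _ _)]

lemma RLsc.sub_continuousAt {n : ℕ} {u f : Euc n → ℝ → ℝ} {x : Euc n} {t : ℝ} (h : RLsc u x t)
    (hf : ContinuousAt (fun p : Euc n × ℝ => f p.1 p.2) (x, t)) :
    RLsc (fun y s => u y s - f y s) x t := by
  intro c hc
  set e := u x t - f x t - c with he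
  have h1 := h (u x t - e / 2) (by linarith)
  have h2 : ∀ᶠ p : Euc n × ℝ in nhds (x, t), f p.1 p.2 < f x t + e / 2 :=
    hf.eventually (gt_mem_nhds (by dsimp only; linarith))
  filter_upwards [h1, h2] with p hp1 hp2 hp
  have := hp1 hp
  linarith

/-- The explicit subsolution barrier. -/
def barrier {n : ℕ} (q : ℝ) (x : Euc n) (t : ℝ) : ℝ :=
  (t - 1 / 4) * Real.exp (-(q * t)) * (1 / 16 + 2 * (t - 1 / 4) - ‖x‖ ^ 2) ^ 3

lemma continuous_barrier {n : ℕ} (q : ℝ) :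
    Continuous (fun p : Euc n × ℝ => barrier q p.1 p.2) := by
  unfold barrier; fun_prop

lemma contDiff_barrier_slice {n : ℕ} (q t : ℝ) : ContDiff ℝ 2 (fun x : Euc n => barrier q x t) := by
  unfold barrier
  exact contDiff_const.mul ((contDiff_const.sub (contDiff_id.norm_sq ℝ)).pow 3)

lemma hasDerivAt_barrier {n : ℕ} (q : ℝ) (x : Euc n) (t : ℝ) :
    HasDerivAt (barrier q x) (Real.exp (-(q * t)) * (1 / 16 + 2 * (t - 1 / 4) - ‖x‖ ^ 2) ^ 2 *
      ((1 / 16 + 2 * (t - 1 / 4) - ‖x‖ ^ 2) - q * (t - 1 / 4) *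
        (1 / 16 + 2 * (t - 1 / 4) - ‖x‖ ^ 2) + 6 * (t - 1 / 4))) t := by
  have h1 : HasDerivAt (fun t : ℝ => t - 1 / 4) 1 t := (hasDerivAt_id t).sub_const _
  have h2 : HasDerivAt (fun t : ℝ => Real.exp (-(q * t))) (Real.exp (-(q * t)) * (-(q * 1))) t :=
    (((hasDerivAt_id t).const_mul q).neg).exp
  have h3 : HasDerivAt (fun t : ℝ => 1 / 16 + 2 * (t - 1 / 4) - ‖x‖ ^ 2) (2 * 1) t :=
    ((h1.const_mul 2).const_add _).sub_const _
  have := (h1.mul h2).mul (h3.pow 3)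
  refine HasDerivAt.congr_deriv this ?_
  simp only [Pi.mul_apply, Pi.pow_apply]
  push_cast
  ring

lemma hess_barrier_slice {n : ℕ} (q t : ℝ) (x : Euc n) :
    hess (fun x : Euc n => barrier q x t) x = ((t - 1 / 4) * Real.exp (-(q * t))) •
      ((24 * (1 / 16 + 2 * (t - 1 / 4) - ‖x‖ ^ 2)) • rankOneBil x +
        (-(6 * (1 / 16 + 2 * (t - 1 / 4) - ‖x‖ ^ 2) ^ 2)) • innerBil n) := by
  unfold barrier
  rw [hess_const_mul, hess_barrier]
  exact ((contDiff_const.sub (contDiff_id.norm_sq ℝ)).pow 3).contDiffAt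

/-- Ellipticity lower bound for the operator applied to the barrier. -/
lemma barrier_ell {n : ℕ} {lam Lam : ℝ} {l : Bil n →ₗ[ℝ] ℝ} (hl : EllF lam Lam l) (q t : ℝ)
    (x : Euc n) (ht : 1 / 4 ≤ t) (hZ : 0 ≤ 1 / 16 + 2 * (t - 1 / 4) - ‖x‖ ^ 2) :
    (t - 1 / 4) * Real.exp (-(q * t)) *
      (24 * (1 / 16 + 2 * (t - 1 / 4) - ‖x‖ ^ 2) * (lam * ‖x‖ ^ 2) -
        6 * (1 / 16 + 2 * (t - 1 / 4) - ‖x‖ ^ 2) ^ 2 * (Lam * n)) ≤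
    l (hess (fun x : Euc n => barrier q x t) x) := by
  rw [hess_barrier_slice, map_smul, map_add, map_smul, map_smul, smul_eq_mul, smul_eq_mul,
    smul_eq_mul]
  have h1 := (hl _ (psd_rankOneBil x)).1
  have h2 := (hl _ (psd_innerBil n)).2
  rw [trc_rankOneBil] at h1
  rw [trc_innerBil] at h2
  refine mul_le_mul_of_nonneg_left ?_ (mul_nonneg (by linarith) (Real.exp_pos _).le)
  set Z := 1 / 16 + 2 * (t - 1 / 4) - ‖x‖ ^ 2
  have h3 := mul_le_mul_of_nonneg_left h1 (show 0 ≤ 24 * Z by linarith)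
  have h4 := mul_le_mul_of_nonneg_left h2 (show 0 ≤ 6 * Z ^ 2 by positivity)
  linarith

lemma barrier_sub_pos {lam a q Z b τ X : ℝ} (hlam : 0 < lam)
    (hq : q = 16 + (a + 24 * lam) ^ 2 / lam) (hZ : 0 < Z) (hb : 3 / 16 ≤ b) (hX : X = b - Z)
    (hτ : 1 / 16 ≤ τ) :
    0 < τ * (24 * Z * (lam * X) - a * Z ^ 2 + q * Z ^ 3) - Z ^ 3 := by
  have h1 : 0 < 24 * lam * X - a * Z + (q - 16) * Z ^ 2 := by
    set B := a + 24 * lam with hB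
    have h2 : (q - 16) * Z ^ 2 = (B * Z) ^ 2 / lam := by rw [hq]; ring
    have h3 : lam * (24 * lam * X - a * Z + (q - 16) * Z ^ 2) =
        24 * lam ^ 2 * b - lam * (B * Z) + (B * Z) ^ 2 := by
      rw [h2, hX, hB]; field_simp; ring
    have h4 : 0 < lam * (24 * lam * X - a * Z + (q - 16) * Z ^ 2) := by
      rw [h3]; nlinarith [sq_nonneg (B * Z - lam / 2), mul_pos hlam hlam]
    exact (pos_iff_pos_of_mul_pos h4).1 hlam
  have h5 : τ * (24 * Z * (lam * X) - a * Z ^ 2 + q * Z ^ 3) - Z ^ 3 =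
      Z * (τ * (24 * lam * X - a * Z + (q - 16) * Z ^ 2) + (16 * τ - 1) * Z ^ 2) := by ring
  rw [h5]
  refine mul_pos hZ (add_pos_of_pos_of_nonneg (mul_pos (by linarith) h1) ?_)
  exact mul_nonneg (by linarith) (sq_nonneg _)

lemma barrier_sub_lower {lam a q Z τ X : ℝ} (hlam : 0 ≤ lam) (ha : 0 ≤ a) (hq : 0 ≤ q)
    (hZ : 0 ≤ Z) (hZ2 : Z ≤ 2) (hX : 0 ≤ X) (hτ : 0 ≤ τ) (hτ1 : τ ≤ 1) :
    -(4 * a + 8) ≤ τ * (24 * Z * (lam * X) - a * Z ^ 2 + q * Z ^ 3) - Z ^ 3 := by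
  have h2 : Z ^ 2 ≤ 4 := by nlinarith
  have h3 : Z ^ 3 ≤ 8 := by nlinarith
  have h4 : 0 ≤ τ * (24 * Z * (lam * X) + q * Z ^ 3) := mul_nonneg hτ (by positivity)
  have h5 : τ * (a * Z ^ 2) ≤ 1 * (a * 4) :=
    mul_le_mul hτ1 (by gcongr) (by positivity) one_pos.le
  linarith

set_option maxHeartbeats 1000000 in
/-- Point-to-measure estimate. -/
lemma point_to_measure (n : ℕ) {lam Lam : ℝ} (hlam : 0 < lam) (hLam : lam ≤ Lam) :
    ∃ M > (1 : ℝ), ∃ μ > (0 : ℝ), ∀ w : Euc n → ℝ → ℝ,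
      (∀ x t, ‖x‖ ≤ 3 / 2 → t ∈ Set.Icc (1 / 4 : ℝ) 1 → 0 ≤ w x t ∧
        ContinuousAt (fun y => w y t) x ∧ ContinuousAt (w x) t ∧ (t < 1 → RLsc w x t) ∧
        (w x t ≤ M → SuperAt lam Lam w x t)) →
      ∀ x0 : Euc n, ‖x0‖ ≤ 1 → w x0 1 ≤ 1 →
      ENNReal.ofReal μ ≤ MeasureTheory.volume {p : Euc n × ℝ | ‖p.1‖ < 1 / 2 ∧ 1 / 4 < p.2 ∧
        p.2 < 5 / 16 ∧ w p.1 p.2 ≤ M} := by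
  have hLam0 : 0 < Lam := hlam.trans_le hLam
  set a : ℝ := 6 * (Lam * n + 1) with ha
  have ha0 : 0 < a := by positivity
  set q : ℝ := 16 + (a + 24 * lam) ^ 2 / lam with hq
  have hq0 : 0 < q := by positivity
  set L : ℝ := 20 * Real.exp q with hL
  have hL20 : 20 ≤ L := by
    have := Real.one_le_exp hq0.le; rw [hL]; linarith
  set C0 : ℝ := 4 * a + 8 with hC0
  have hC00 : 0 < C0 := by positivity
  set C1 : ℝ := L * C0 / lam with hC1
  have hC1p : 0 < C1 := by positivity
  set C2 : ℝ := L * C0 + 1 with hC2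
  have hC2p : 0 < C2 := by positivity
  set vB := MeasureTheory.volume (Metric.closedBall (0 : Euc n) 1) with hvB
  have hvB0 : 0 < vB := Metric.measure_closedBall_pos _ _ one_pos
  have hvBt : vB ≠ ⊤ := (isCompact_closedBall _ _).measure_ne_top
  have hvBr : 0 < vB.toReal := ENNReal.toReal_pos hvB0.ne' hvBt
  set D := (C1 / (1 / 8)) ^ n with hD
  have hDp : 0 < D := by positivity
  refine ⟨8 * L, by linarith, 1 / 4 * vB.toReal / (C2 * D), by positivity, ?_⟩
  intro w hw x0 hx0 hwx0
  clear_value C0 C1 C2 D L q a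
  set v : Euc n → ℝ → ℝ := fun x t => w x t - L * barrier q x t with hv
  have hmem : ∀ {x : Euc n}, x ∈ Metric.closedBall (0 : Euc n) (3 / 2) ↔ ‖x‖ ≤ 3 / 2 := by
    intro x; simp
  have hbarle : ∀ (x : Euc n) (t : ℝ), t ∈ Set.Icc (1 / 4 : ℝ) 1 → barrier q x t ≤ 8 := by
    intro x t ht
    have hE : Real.exp (-(q * t)) ≤ 1 := by
      apply Real.exp_le_one_iff.2
      have := mul_nonneg hq0.le (show 0 ≤ t by linarith [ht.1])
      linarith
    unfold barrier
    have hZ : 1 / 16 + 2 * (t - 1 / 4) - ‖x‖ ^ 2 ≤ 2 := by nlinarith [ht.2, sq_nonneg ‖x‖]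
    have hZ3 : (1 / 16 + 2 * (t - 1 / 4) - ‖x‖ ^ 2) ^ 3 ≤ 8 := by
      set Z := 1 / 16 + 2 * (t - 1 / 4) - ‖x‖ ^ 2
      have h1 : 0 ≤ (2 - Z) * (4 + 2 * Z + Z ^ 2) :=
        mul_nonneg (by linarith) (by nlinarith [sq_nonneg (Z + 1)])
      linarith
    have h1 : 0 ≤ (t - 1 / 4) * Real.exp (-(q * t)) :=
      mul_nonneg (by linarith [ht.1]) (Real.exp_pos _).le
    have h2 : (t - 1 / 4) * Real.exp (-(q * t)) ≤ 1 := by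
      have := mul_le_mul (show t - 1 / 4 ≤ 1 by linarith [ht.2]) hE (Real.exp_pos _).le one_pos.le
      linarith
    nlinarith
  have hslide : SlideHyp v (8 * L) := by
    refine ⟨fun t ht x hx => ?_, fun x hx t ht => ?_, fun x hx t ht => ?_, fun x hx t ht => ?_⟩
    · refine ContinuousAt.continuousWithinAt ?_
      exact (hw x t (hmem.1 hx) ht).2.1.sub
        (continuous_const.mul (contDiff_barrier_slice q t).continuous).continuousAt
    · refine ContinuousAt.continuousWithinAt ?_
      exact (hw x t (hmem.1 hx) ht).2.2.1.sub
        ((hasDerivAt_barrier q x t).continuousAt.const_mul L)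
    · refine ((hw x t (hmem.1 hx) ⟨ht.1, ht.2.le⟩).2.2.2.1 ht.2).sub_continuousAt
        (f := fun x t => L * barrier q x t) ?_
      exact (continuous_const.mul (continuous_barrier q)).continuousAt
    · have h1 := (hw x t (hmem.1 hx) ht).1
      have h2 := hbarle x t ht
      have : L * barrier q x t ≤ L * 8 := mul_le_mul_of_nonneg_left h2 (by linarith)
      simp only [hv]; linarith
  have key := slide_measure (C1 := C1) hC2p hslide (x0 := x0) (S := {p : Euc n × ℝ | ‖p.1‖ < 1 / 2 ∧
    1 / 4 < p.2 ∧ p.2 < 5 / 16 ∧ w p.1 p.2 ≤ 8 * L}) ?_ (hmem.2 (by linarith)) ?_ ?_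
  · rw [← hvB, ← hD, ← mul_assoc, ← ENNReal.ofReal_mul hC2p.le] at key
    rw [div_eq_mul_inv, mul_comm, ENNReal.ofReal_mul (by positivity),
      ENNReal.ofReal_inv_of_pos (by positivity),
      ENNReal.ofReal_mul (p := 1 / 4) (by positivity), ENNReal.ofReal_toReal hvBt]
    rw [ENNReal.inv_mul_le_iff (by simpa using by positivity) ENNReal.ofReal_ne_top]
    exact key
  · intro x hx
    have := (hw x (1 / 4) (hmem.1 hx) ⟨le_rfl, by norm_num⟩).1
    simp only [hv, barrier]; simpa using this
  · have h1 : (1 / 10 : ℝ) * Real.exp (-q) ≤ barrier q x0 1 := by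
      unfold barrier
      have h2 : (9 / 16 : ℝ) ≤ 1 / 16 + 2 * (1 - 1 / 4) - ‖x0‖ ^ 2 := by
        nlinarith [norm_nonneg x0]
      have h3 := pow_le_pow_left₀ (by norm_num) h2 3
      rw [mul_one]
      nlinarith [Real.exp_pos (-q)]
    have h4 : L * ((1 / 10 : ℝ) * Real.exp (-q)) = 2 := by
      rw [hL, Real.exp_neg]; field_simp; norm_num
    have h5 := mul_le_mul_of_nonneg_left h1 (show 0 ≤ L by linarith)
    simp only [hv]; linarith
  · intro x hx t ht y hy htilt hmin htime
    have hvneg : v x t < 0 := by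
      have h2 := (abs_le.1 (abs_inner_le_of_closedBall y hx)).1
      unfold tilt at htilt; linarith
    obtain ⟨hw0, -, -, -, hws⟩ := hw x t (hmem.1 hx) ht
    have hbpos : 0 < barrier q x t := by
      simp only [hv] at hvneg
      by_contra! hle
      have := mul_nonpos_of_nonneg_of_nonpos (show 0 ≤ L by linarith) hle
      linarith
    have hwle : w x t ≤ 8 * L := by
      have h2 := hbarle x t ht
      have : L * barrier q x t ≤ L * 8 := mul_le_mul_of_nonneg_left h2 (by linarith)
      simp only [hv] at hvneg; linarith
    have ht4 : 1 / 4 < t := by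
      refine lt_of_le_of_ne ht.1 fun h => ?_
      rw [← h] at hbpos; simp [barrier] at hbpos
    set Z := 1 / 16 + 2 * (t - 1 / 4) - ‖x‖ ^ 2 with hZ
    have hE0 := Real.exp_pos (-(q * t))
    have hE1 : Real.exp (-(q * t)) ≤ 1 := by
      apply Real.exp_le_one_iff.2
      have := mul_nonneg hq0.le (show 0 ≤ t by linarith)
      linarith
    have hZpos : 0 < Z := by
      have h1 : 0 < (t - 1 / 4) * Real.exp (-(q * t)) * Z ^ 3 := hbpos
      have h2 : 0 < Z ^ 3 := (pos_iff_pos_of_mul_pos h1).1 (mul_pos (by linarith) hE0)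
      exact (Odd.pow_pos_iff (by decide)).1 h2
    obtain ⟨hc2, d, hd, l, hl, hle⟩ := hws hwle
    have hbC : ContDiffAt ℝ 2 (fun z : Euc n => L * barrier q z t) x :=
      contDiffAt_const.mul (contDiff_barrier_slice q t).contDiffAt
    have hvC : ContDiffAt ℝ 2 (fun z => v z t) x := hc2.sub hbC
    have hxint : Metric.closedBall (0 : Euc n) (3 / 2) ∈ nhds x := by
      refine Metric.closedBall_mem_nhds_of_mem ?_
      rw [mem_ball_zero_iff]
      nlinarith [ht.2, norm_nonneg x]
    have hlin : ContDiffAt ℝ 2 (fun z : Euc n => ((1 / 8 : ℝ) • innerSL ℝ y : Euc n →L[ℝ] ℝ) z) x :=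
      ContinuousLinearMap.contDiff _ |>.contDiffAt
    have htiltC : ContDiffAt ℝ 2 (fun z => v z t + ((1 / 8 : ℝ) • innerSL ℝ y : Euc n →L[ℝ] ℝ) z) x :=
      hvC.add hlin
    have hlocmin : IsLocalMin
        (fun z => v z t + ((1 / 8 : ℝ) • innerSL ℝ y : Euc n →L[ℝ] ℝ) z) x := by
      filter_upwards [hxint] with z hz
      have := hmin z hz
      simpa [tilt] using this
    have hpsd : PSD (hess (fun z => v z t) x) := by
      have := psd_hess_of_isLocalMin htiltC hlocmin
      rw [hess_add hvC hlin, hess_clm] at this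
      rwa [add_zero (hess (fun z => v z t) x)] at this
    have hfd : fderiv ℝ (fun z => v z t) x = -((1 / 8 : ℝ) • innerSL ℝ y) := by
      have h1 := hlocmin.fderiv_eq_zero
      rw [fderiv_fun_add (hvC.differentiableAt (by simp)) (by fun_prop)] at h1
      rw [ContinuousLinearMap.fderiv] at h1
      exact eq_neg_of_add_eq_zero_left h1
    set dB := Real.exp (-(q * t)) * Z ^ 2 * (Z - q * (t - 1 / 4) * Z + 6 * (t - 1 / 4)) with hdB
    have hdv : HasDerivAt (v x) (d - L * dB) t := hd.sub ((hasDerivAt_barrier q x t).const_mul L)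
    have hdv0 : d - L * dB ≤ 0 := by
      by_contra! hpos
      have hslo : ∀ᶠ s in nhdsWithin t {t}ᶜ, 0 < slope (v x) t s :=
        (hasDerivAt_iff_tendsto_slope.1 hdv).eventually (lt_mem_nhds hpos)
      rw [eventually_nhdsWithin_iff, Metric.eventually_nhds_iff] at hslo
      obtain ⟨δ, hδ, hs⟩ := hslo
      set s := max (1 / 4) (t - δ / 2) with hsd
      have hst : s < t := max_lt ht4 (by linarith)
      have hs1 := hs (y := s) (by
        rw [Real.dist_eq, abs_sub_lt_iff]
        constructor <;> linarith [le_max_right (1 / 4) (t - δ / 2)]) hst.ne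
      rw [slope_def_field, lt_div_iff_of_neg (by linarith)] at hs1
      have := htime s ⟨le_max_left _ _, hst.le⟩
      linarith
    have hhess : hess (fun z => w z t) x =
        hess (fun z => v z t) x + L • hess (fun z => barrier q z t) x := by
      have h1 : (fun z => w z t) = fun z => v z t + L * barrier q z t := by
        ext z; simp only [hv]; ring
      rw [h1, hess_add hvC hbC, hess_const_mul (contDiff_barrier_slice q t).contDiffAt]
    have hineq : l (hess (fun z => v z t) x) + L * l (hess (fun z => barrier q z t) x) ≤ d := by
      have := hle
      rw [hhess, map_add, map_smul, smul_eq_mul] at this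
      exact this
    have hlv := (hl _ hpsd).1
    have hlb := barrier_ell hl q t x ht.1 hZpos.le
    rw [← hZ] at hlb
    have htrc := hpsd.trc_nonneg
    have hlamtrc : 0 ≤ lam * trc (hess (fun z => v z t) x) := mul_nonneg hlam.le htrc
    set lB := l (hess (fun z => barrier q z t) x) with hlB
    clear_value lB dB Z
    have hdiff : Real.exp (-(q * t)) * ((t - 1 / 4) * (24 * Z * (lam * ‖x‖ ^ 2) - a * Z ^ 2 +
        q * Z ^ 3) - Z ^ 3) ≤ lB - dB := by
      refine le_trans (le_of_eq ?_) (sub_le_sub_right hlb dB)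
      rw [hdB, ha]; ring
    have hZ2 : Z ≤ 2 := by rw [hZ]; nlinarith [ht.2, sq_nonneg ‖x‖]
    have hlow : -C0 ≤ lB - dB := by
      refine le_trans ?_ hdiff
      have h1 := barrier_sub_lower (lam := lam) (a := a) (q := q) (τ := t - 1 / 4)
        (X := ‖x‖ ^ 2) hlam.le ha0.le hq0.le hZpos.le hZ2 (by positivity) (by linarith)
        (by linarith [ht.2])
      rw [← hC0] at h1
      refine le_trans ?_ (mul_le_mul_of_nonneg_left h1 hE0.le)
      have := mul_le_mul_of_nonneg_right hE1 hC00.le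
      linarith
    have ht516 : t < 5 / 16 := by
      by_contra! hge
      have hpos := barrier_sub_pos (a := a) hlam hq hZpos
        (b := 1 / 16 + 2 * (t - 1 / 4)) (by linarith) (X := ‖x‖ ^ 2) (by rw [hZ]; ring)
        (τ := t - 1 / 4) (by linarith)
      have h1 : 0 < lB - dB := (mul_pos hE0 hpos).trans_le hdiff
      have h2 : 0 < L * (lB - dB) := mul_pos (by linarith) h1
      linarith
    have hLlow : -(L * C0) ≤ L * (lB - dB) := by
      have := mul_le_mul_of_nonneg_left hlow (show 0 ≤ L by linarith)
      linarith
    refine ⟨⟨?_, ht4, ht516, hwle⟩, hvC, hpsd, ?_, hfd, d - L * dB, hdv, ?_⟩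
    · show ‖x‖ < 1 / 2
      nlinarith [norm_nonneg x]
    · rw [hC1, le_div_iff₀ hlam]
      linarith
    · rw [hC2]; linarith

/-- The parabolic scaling about the point `(y,τ)`. -/
def parScale {n : ℕ} (y : Euc n) (τ ρ : ℝ) (p : Euc n × ℝ) : Euc n × ℝ :=
  (y + ρ • p.1, τ + ρ ^ 2 * p.2)

lemma volume_image_parScale {n : ℕ} (y : Euc n) (τ : ℝ) {ρ : ℝ} (hρ : 0 < ρ)
    (A : Set (Euc n × ℝ)) :
    MeasureTheory.volume (parScale y τ ρ '' A) =
      ENNReal.ofReal (ρ ^ (n + 2)) * MeasureTheory.volume A := by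
  set L : (Euc n × ℝ) →ₗ[ℝ] (Euc n × ℝ) :=
    (ρ • LinearMap.id).prodMap (ρ ^ 2 • LinearMap.id) with hL
  have h1 : parScale y τ ρ '' A = (fun p => (y, τ) + p) '' (L '' A) := by
    rw [Set.image_image]
    rfl
  have : (MeasureTheory.volume : MeasureTheory.Measure (Euc n × ℝ)).IsAddHaarMeasure := by
    rw [MeasureTheory.Measure.volume_eq_prod]; infer_instance
  rw [h1, Set.image_add_left, MeasureTheory.measure_preimage_add,
    MeasureTheory.Measure.addHaar_image_linearMap]
  congr 2
  rw [hL, LinearMap.det_prodMap, LinearMap.det_smul, LinearMap.det_smul]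
  simp
  rw [abs_of_pos hρ]; ring

lemma measurableSet_sublevel_of_separately {n : ℕ} {w : Euc n → ℝ → ℝ} {U : Set (Euc n)}
    {I : Set ℝ} (hU : MeasurableSet U) (hI : MeasurableSet I)
    (hx : ∀ x ∈ U, ∀ t ∈ I, ContinuousAt (fun y => w y t) x)
    (ht : ∀ x ∈ U, ∀ t ∈ I, ContinuousAt (w x) t) (c : ℝ) :
    MeasurableSet {p : Euc n × ℝ | p.1 ∈ U ∧ p.2 ∈ I ∧ w p.1 p.2 ≤ c} := by
  have hm : Measurable (Function.uncurry (fun (t : I) (x : U) => w x.1 t.1)) := by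
    refine MeasureTheory.measurable_uncurry_of_continuous_of_measurable ?_ ?_
    · intro x
      refine continuous_iff_continuousAt.2 fun t => ?_
      exact ContinuousAt.comp (f := fun t : I => t.1) (ht x x.2 t t.2) continuousAt_subtype_val
    · intro t
      refine Continuous.measurable (continuous_iff_continuousAt.2 fun x => ?_)
      exact ContinuousAt.comp (g := fun z => w z t.1) (f := fun x : U => x.1) (hx x x.2 t t.2)
        continuousAt_subtype_val
  have hs : MeasurableSet {q : I × U | w q.2.1 q.1.1 ≤ c} := measurableSet_le hm measurable_const
  have he : MeasurableEmbedding (fun q : I × U => (q.2.1, q.1.1)) := by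
    have := (MeasurableEmbedding.subtype_coe hU).prodMap (MeasurableEmbedding.subtype_coe hI)
    exact this.comp MeasurableEquiv.prodComm.measurableEmbedding
  have := he.measurableSet_image.2 hs
  convert this using 1
  ext p
  constructor
  · rintro ⟨h1, h2, h3⟩
    exact ⟨(⟨p.2, h2⟩, ⟨p.1, h1⟩), h3, rfl⟩
  · rintro ⟨⟨t, x⟩, h, rfl⟩
    exact ⟨x.2, t.2, h⟩

/-- The conclusion of `point_to_measure`, in parabolically scaled form. -/
def PointToMeasure (n : ℕ) (lam Lam M μ : ℝ) : Prop :=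
  ∀ (w : Euc n → ℝ → ℝ) (y : Euc n) (τ ρ c : ℝ), 0 < ρ → 0 < c →
      (∀ x t, ‖x - y‖ ≤ 3 / 2 * ρ → t ∈ Set.Icc (τ + ρ ^ 2 / 4) (τ + ρ ^ 2) → 0 ≤ w x t ∧
        ContinuousAt (fun y => w y t) x ∧ ContinuousAt (w x) t ∧ (t < τ + ρ ^ 2 → RLsc w x t) ∧
        (w x t ≤ c * M → SuperAt lam Lam w x t)) →
      ∀ x0 : Euc n, ‖x0 - y‖ ≤ ρ → w x0 (τ + ρ ^ 2) ≤ c →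
      ENNReal.ofReal (μ * ρ ^ (n + 2)) ≤ MeasureTheory.volume {p : Euc n × ℝ |
        ‖p.1 - y‖ < ρ / 2 ∧ τ + ρ ^ 2 / 4 < p.2 ∧ p.2 < τ + 5 * ρ ^ 2 / 16 ∧ w p.1 p.2 ≤ c * M}

lemma exists_pointToMeasure (n : ℕ) {lam Lam : ℝ} (hlam : 0 < lam) (hLam : lam ≤ Lam) :
    ∃ M > (1 : ℝ), ∃ μ > (0 : ℝ), PointToMeasure n lam Lam M μ := by
  obtain ⟨M, hM, μ, hμ, h⟩ := point_to_measure n hlam hLam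
  refine ⟨M, hM, μ, hμ, ?_⟩
  intro w y τ ρ c hρ hc hw x0 hx0 hwx0
  have key := h (fun z s => c⁻¹ * w (y + ρ • z) (τ + ρ ^ 2 * s) + 0) ?_ (ρ⁻¹ • (x0 - y)) ?_ ?_
  · have h2 := mul_le_mul_right key (ENNReal.ofReal (ρ ^ (n + 2)))
    rw [← volume_image_parScale y τ hρ, ← ENNReal.ofReal_mul (by positivity), mul_comm] at h2
    refine h2.trans (MeasureTheory.measure_mono ?_)
    rintro _ ⟨⟨x, s⟩, ⟨h1, h2, h3, h4⟩, rfl⟩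
    have hp : 0 < ρ ^ 2 := by positivity
    simp only [add_zero] at h4
    refine ⟨?_, ?_, ?_, ?_⟩
    · simp only [parScale, add_sub_cancel_left, norm_smul, Real.norm_eq_abs, abs_of_pos hρ]
      simp only at h1
      nlinarith
    · simp only [parScale]; simp only at h2; nlinarith
    · simp only [parScale]; simp only at h3; nlinarith
    · rw [inv_mul_le_iff₀ hc] at h4
      exact h4
  · intro x t hx ht
    have hp : 0 < ρ ^ 2 := by positivity
    have h1 : ‖y + ρ • x - y‖ ≤ 3 / 2 * ρ := by
      rw [add_sub_cancel_left, norm_smul, Real.norm_eq_abs, abs_of_pos hρ]; nlinarith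
    have h2 : τ + ρ ^ 2 * t ∈ Set.Icc (τ + ρ ^ 2 / 4) (τ + ρ ^ 2) :=
      ⟨by nlinarith [ht.1], by nlinarith [ht.2]⟩
    obtain ⟨a1, a2, a3, a4, a5⟩ := hw _ _ h1 h2
    refine ⟨by positivity, ?_, ?_, ?_, ?_⟩
    · refine ContinuousAt.add (continuousAt_const.mul ?_) continuousAt_const
      exact ContinuousAt.comp (g := fun z => w z (τ + ρ ^ 2 * t)) (f := fun z => y + ρ • z) a2
        (by fun_prop)
    · refine ContinuousAt.add (continuousAt_const.mul ?_) continuousAt_const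
      exact ContinuousAt.comp (g := w (y + ρ • x)) (f := fun s => τ + ρ ^ 2 * s) a3 (by fun_prop)
    · intro ht1
      exact (RLsc.affine (RLsc.scale (a4 (by nlinarith))) (inv_pos.2 hc) 0)
    · intro hle
      refine SuperAt.affine (SuperAt.scale (a5 ?_)) (inv_pos.2 hc).le 0
      rw [add_zero, inv_mul_le_iff₀ hc] at hle
      exact hle
  · rw [norm_smul, norm_inv, Real.norm_eq_abs, abs_of_pos hρ, inv_mul_le_iff₀ hρ]; linarith
  · simp only [smul_smul, mul_inv_cancel₀ hρ.ne', one_smul, add_sub_cancel, mul_one, add_zero]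
    rw [inv_mul_le_iff₀ hc]; linarith

/-- The hypotheses on a nonnegative function which is a supersolution where it is at most `B`. -/
def SuperBelow {n : ℕ} (lam Lam B : ℝ) (w : Euc n → ℝ → ℝ) : Prop :=
  ∀ x t, ‖x‖ < 9 → 0 < t → t ≤ 41 / 2 → 0 ≤ w x t ∧
    ContinuousAt (fun y => w y t) x ∧ ContinuousAt (w x) t ∧ (t < 41 / 2 → RLsc w x t) ∧
    (w x t ≤ B → SuperAt lam Lam w x t)

lemma SuperBelow.hyp_scaled {n : ℕ} {lam Lam B : ℝ} {w : Euc n → ℝ → ℝ}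
    (hw : SuperBelow lam Lam B w) {x : Euc n} {t ρ b : ℝ} (hx : ‖x‖ < 2) (ht : 0 < t) (hρ : 0 < ρ)
    (hs : t + ρ ^ 2 ≤ 41 / 2) (hb : b ≤ B) :
    ∀ z s, ‖z - x‖ ≤ 3 / 2 * ρ → s ∈ Set.Icc (t + ρ ^ 2 / 4) (t + ρ ^ 2) → 0 ≤ w z s ∧
        ContinuousAt (fun y => w y s) z ∧ ContinuousAt (w z) s ∧ (s < t + ρ ^ 2 → RLsc w z s) ∧
        (w z s ≤ b → SuperAt lam Lam w z s) := by
  intro z s hz hs'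
  have hρ2 : ρ < 4.6 := by
    by_contra! h
    nlinarith
  have hz9 : ‖z‖ < 9 := by
    have : ‖z‖ ≤ ‖z - x‖ + ‖x‖ := by simpa using norm_add_le (z - x) x
    linarith
  have hp : 0 < ρ ^ 2 := by positivity
  obtain ⟨a1, a2, a3, a4, a5⟩ := hw z s hz9 (by linarith [hs'.1]) (by linarith [hs'.2])
  exact ⟨a1, a2, a3, fun h => a4 (by linarith), fun h => a5 (h.trans hb)⟩

lemma exists_hit {n : ℕ} {lam Lam M μ : ℝ} (hP : PointToMeasure n lam Lam M μ) (hM : 1 < M)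
    (hμ : 0 < μ) {K : ℕ} {w : Euc n → ℝ → ℝ} (hw : SuperBelow lam Lam (M ^ K) w) {z : Euc n}
    (hz : ‖z‖ ≤ 2) (hwz : w z (41 / 2) ≤ 1) {x : Euc n} {t : ℝ} (hx : ‖x‖ < 2) (ht : 0 < t)
    (ht2 : t < 2) : ∀ k ≤ K, ∃ x' s', ‖x' - x‖ ^ 2 ≤ s' - t ∧ 0 < s' - t ∧
      s' - t ≤ (5 / 16) ^ k * (41 / 2 - t) ∧ w x' s' ≤ M ^ k := by
  intro k
  induction k with
  | zero =>
    intro _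
    refine ⟨z, 41 / 2, ?_, by linarith, by simp, by simpa using hwz⟩
    have : ‖z - x‖ ≤ 4 := (norm_sub_le _ _).trans (by linarith)
    nlinarith [norm_nonneg (z - x)]
  | succ k ih =>
    intro hk
    obtain ⟨x', s', h1, h2, h3, h4⟩ := ih (by omega)
    set ρ := Real.sqrt (s' - t) with hρ
    have hρ0 : 0 < ρ := Real.sqrt_pos.2 h2
    have hρ2 : ρ ^ 2 = s' - t := Real.sq_sqrt h2.le
    have hq : (5 / 16 : ℝ) ^ k ≤ 1 := pow_le_one₀ (by norm_num) (by norm_num)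
    have hs : t + ρ ^ 2 ≤ 41 / 2 := by nlinarith
    have key := hP w x t ρ (M ^ k) hρ0 (by positivity)
      (hw.hyp_scaled hx ht hρ0 hs (by rw [← pow_succ]; exact pow_le_pow_right₀ hM.le hk)) x'
      (by rw [hρ]; exact Real.le_sqrt_of_sq_le h1) (by rw [hρ2, add_sub_cancel]; exact h4)
    have hne : MeasureTheory.volume {p : Euc n × ℝ |
        ‖p.1 - x‖ < ρ / 2 ∧ t + ρ ^ 2 / 4 < p.2 ∧ p.2 < t + 5 * ρ ^ 2 / 16 ∧
          w p.1 p.2 ≤ M ^ k * M} ≠ 0 := by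
      intro h0
      rw [h0, nonpos_iff_eq_zero, ENNReal.ofReal_eq_zero] at key
      have : 0 < μ * ρ ^ (n + 2) := by positivity
      linarith
    obtain ⟨⟨x'', s''⟩, g1, g2, g3, g4⟩ := MeasureTheory.nonempty_of_measure_ne_zero hne
    simp only at g1 g2 g3 g4
    have hp : 0 < ρ ^ 2 := by positivity
    refine ⟨x'', s'', ?_, by linarith, ?_, by rw [pow_succ]; exact g4⟩
    · nlinarith [norm_nonneg (x'' - x)]
    · rw [pow_succ]; nlinarith

/-- The shifted cylinder in which `PointToMeasure` finds its points. -/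
def lensSet {n : ℕ} (x : Euc n) (t ρ : ℝ) : Set (Euc n × ℝ) :=
  Metric.ball x (ρ / 2) ×ˢ Set.Ioo (t + ρ ^ 2 / 4) (t + 5 * ρ ^ 2 / 16)

lemma exists_lens {n : ℕ} {lam Lam M μ : ℝ} (hP : PointToMeasure n lam Lam M μ) (hM : 1 < M)
    (hμ : 0 < μ) {K : ℕ} {w : Euc n → ℝ → ℝ} (hw : SuperBelow lam Lam (M ^ K) w) {z : Euc n}
    (hz : ‖z‖ ≤ 2) (hwz : w z (41 / 2) ≤ 1) {k : ℕ} (hk : k + 1 ≤ K) {x : Euc n} {t : ℝ}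
    (hx : ‖x‖ < 2) (ht : 0 < t) (ht2 : t < 2) (hwx : M ^ k < w x t) :
    ∃ ρ > 0, ρ ^ 2 ≤ (5 / 16) ^ k * (41 / 2) ∧ (∀ p ∈ lensSet x t ρ, M ^ k < w p.1 p.2) ∧
      ENNReal.ofReal (μ * ρ ^ (n + 2)) ≤
        MeasureTheory.volume (lensSet x t ρ ∩ {p | w p.1 p.2 ≤ M ^ (k + 1)}) := by
  obtain ⟨x1, s1, h1, h2, h3, h4⟩ := exists_hit hP hM hμ hw hz hwz hx ht ht2 k (by omega)
  set H : Set ℝ := {s | ∃ x', ‖x' - x‖ ^ 2 ≤ s - t ∧ w x' s ≤ M ^ k} with hH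
  have hs1 : s1 ∈ H := ⟨x1, h1, h4⟩
  have hbdd : BddBelow H := ⟨t, fun s ⟨x', h, _⟩ => by nlinarith [sq_nonneg ‖x' - x‖]⟩
  have hinf : t < sInf H := by
    obtain ⟨δ, hδ, hδw⟩ := Metric.eventually_nhds_iff_ball.1
      ((hw x t (by linarith) ht (by linarith)).2.2.2.1 (by linarith) _ hwx)
    set e := min (δ / 2) ((δ / 2) ^ 2) with he
    have he0 : 0 < e := lt_min (by positivity) (by positivity)
    refine (lt_add_of_pos_right t he0).trans_le (le_csInf ⟨s1, hs1⟩ ?_)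
    rintro s ⟨x', g1, g2⟩
    by_contra! hlt
    have hst : t ≤ s := by nlinarith [sq_nonneg ‖x' - x‖]
    have g3 : s - t < δ / 2 := by linarith [min_le_left (δ / 2) ((δ / 2) ^ 2)]
    have g4 : s - t < (δ / 2) ^ 2 := by linarith [min_le_right (δ / 2) ((δ / 2) ^ 2)]
    have g5 : ‖x' - x‖ < δ / 2 := lt_of_pow_lt_pow_left₀ 2 (by positivity) (by linarith)
    have := hδw (x', s) (by
      rw [Metric.mem_ball, Prod.dist_eq, max_lt_iff]
      constructor
      · rw [dist_eq_norm]; simp only; linarith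
      · rw [Real.dist_eq]; simp only; rw [abs_of_nonneg (by linarith)]; linarith) hst
    simp only at this
    linarith
  obtain ⟨s0, ⟨x0, g1, g2⟩, g3, g4⟩ : ∃ s0 ∈ H, s0 - t < 2 * (sInf H - t) ∧ s0 ≤ s1 := by
    by_cases hc : s1 - t < 2 * (sInf H - t)
    · exact ⟨s1, hs1, hc, le_rfl⟩
    · obtain ⟨s, hs, hs'⟩ := exists_lt_of_csInf_lt ⟨s1, hs1⟩
        (show sInf H < 2 * (sInf H - t) + t by linarith)
      exact ⟨s, hs, by linarith, by linarith⟩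
  have hs0 : 0 < s0 - t := by
    have := csInf_le hbdd (show s0 ∈ H from ⟨x0, g1, g2⟩)
    linarith
  set ρ := Real.sqrt (s0 - t) with hρ
  have hρ0 : 0 < ρ := Real.sqrt_pos.2 hs0
  have hρ2 : ρ ^ 2 = s0 - t := Real.sq_sqrt hs0.le
  have hq : (5 / 16 : ℝ) ^ k ≤ 1 := pow_le_one₀ (by norm_num) (by norm_num)
  have hq0 : 0 < (5 / 16 : ℝ) ^ k := by positivity
  have hs : t + ρ ^ 2 ≤ 41 / 2 := by nlinarith
  refine ⟨ρ, hρ0, by nlinarith, ?_, ?_⟩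
  · rintro ⟨x', s⟩ ⟨k1, k2, k3⟩
    simp only [Metric.mem_ball, dist_eq_norm] at k1 k2 k3
    by_contra! hle
    simp only at hle
    have hmem : s ∈ H := ⟨x', by nlinarith [norm_nonneg (x' - x)], hle⟩
    have := csInf_le hbdd hmem
    nlinarith
  · have key := hP w x t ρ (M ^ k) hρ0 (by positivity)
      (hw.hyp_scaled hx ht hρ0 hs (by rw [← pow_succ]; exact pow_le_pow_right₀ hM.le hk)) x0
      (by rw [hρ]; exact Real.le_sqrt_of_sq_le g1) (by rw [hρ2, add_sub_cancel]; exact g2)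
    refine key.trans (MeasureTheory.measure_mono ?_)
    rintro p ⟨k1, k2, k3, k4⟩
    refine ⟨⟨by rw [Metric.mem_ball, dist_eq_norm]; exact k1, k2, k3⟩, ?_⟩
    rw [← pow_succ] at k4
    exact k4

lemma volume_parabolic_cylinder_le {n : ℕ} (x : Euc n) (t : ℝ) {ρ : ℝ} (hρ : 0 < ρ) :
    MeasureTheory.volume {p : Euc n × ℝ | ‖p.1 - x‖ ≤ 3 * ρ ∧ |p.2 - t| ≤ 5 * ρ ^ 2} ≤
      ENNReal.ofReal (ρ ^ (n + 2)) *
        MeasureTheory.volume (Metric.closedBall (0 : Euc n) 3 ×ˢ Set.Icc (-5 : ℝ) 5) := by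
  rw [← volume_image_parScale x t hρ]
  refine MeasureTheory.measure_mono ?_
  rintro ⟨y, s⟩ ⟨h1, h2⟩
  have hp : 0 < ρ ^ 2 := by positivity
  rw [abs_le] at h2
  simp only at h1 h2
  refine ⟨(ρ⁻¹ • (y - x), (ρ ^ 2)⁻¹ * (s - t)), ⟨?_, ?_, ?_⟩, ?_⟩
  · rw [mem_closedBall_zero_iff, norm_smul, norm_inv, Real.norm_eq_abs, abs_of_pos hρ,
      inv_mul_le_iff₀ hρ]
    linarith
  · rw [← div_eq_inv_mul, le_div_iff₀ hp]; linarith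
  · rw [← div_eq_inv_mul, div_le_iff₀ hp]; linarith
  · simp only [parScale, smul_smul, mul_inv_cancel₀ hρ.ne', one_smul, add_sub_cancel]
    rw [mul_inv_cancel_left₀ hp.ne']
    simp

lemma isOpen_lensSet {n : ℕ} (x : Euc n) (t ρ : ℝ) : IsOpen (lensSet x t ρ) :=
  Metric.isOpen_ball.prod isOpen_Ioo

lemma lensSet_nonempty {n : ℕ} (x : Euc n) (t : ℝ) {ρ : ℝ} (hρ : 0 < ρ) :
    (lensSet x t ρ).Nonempty := by
  have hp : 0 < ρ ^ 2 := by positivity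
  refine ⟨(x, t + 9 * ρ ^ 2 / 32), ?_, ?_, ?_⟩
  · simpa using hρ
  · simp only; linarith
  · simp only; linarith

/-- A Vitali covering estimate for the forward lenses. -/
lemma volume_le_of_lenses {n : ℕ} {A D F : Set (Euc n × ℝ)} (hF : MeasurableSet F) {μ R : ℝ}
    (hμ : 0 < μ) (ρ : Euc n × ℝ → ℝ) (hρ : ∀ p ∈ A, 0 < ρ p) (hR : ∀ p ∈ A, ρ p ≤ R)
    (hD : ∀ p ∈ A, lensSet p.1 p.2 (ρ p) ∩ F ⊆ D)
    (hvol : ∀ p ∈ A, ENNReal.ofReal (μ * ρ p ^ (n + 2)) ≤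
      MeasureTheory.volume (lensSet p.1 p.2 (ρ p) ∩ F)) :
    ENNReal.ofReal μ * MeasureTheory.volume A ≤
      MeasureTheory.volume (Metric.closedBall (0 : Euc n) 3 ×ˢ Set.Icc (-5 : ℝ) 5) *
        MeasureTheory.volume D := by
  set V := MeasureTheory.volume (Metric.closedBall (0 : Euc n) 3 ×ˢ Set.Icc (-5 : ℝ) 5) with hV
  set B : Euc n × ℝ → Set (Euc n × ℝ) :=
    fun p => {q | ‖q.1 - p.1‖ ≤ ρ p ∧ |q.2 - p.2| ≤ ρ p ^ 2} with hB
  obtain ⟨U, hUA, hdisj, hcov⟩ := Vitali.exists_disjoint_subfamily_covering_enlargement B A ρ 2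
    (by norm_num) (fun p hp => (hρ p hp).le) R hR (fun p hp => ⟨p, by simp [(hρ p hp).le], by
      simp [sq_nonneg]⟩)
  have hLB : ∀ p ∈ A, lensSet p.1 p.2 (ρ p) ⊆ B p := by
    rintro p hp q ⟨h1, h2, h3⟩
    have := hρ p hp
    have hp2 : 0 < ρ p ^ 2 := by positivity
    rw [Metric.mem_ball, dist_eq_norm] at h1
    refine ⟨by linarith, ?_⟩
    rw [abs_le]
    constructor <;> linarith
  have hdisjL : U.PairwiseDisjoint (fun p => lensSet p.1 p.2 (ρ p)) := by
    intro p hp q hq hpq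
    exact (hdisj hp hq hpq).mono (hLB p (hUA hp)) (hLB q (hUA hq))
  have hcount : U.Countable := hdisjL.countable_of_isOpen (fun p _ => isOpen_lensSet _ _ _)
    (fun p hp => lensSet_nonempty _ _ (hρ p (hUA hp)))
  have hAsub : A ⊆ ⋃ p ∈ U, {q : Euc n × ℝ | ‖q.1 - p.1‖ ≤ 3 * ρ p ∧ |q.2 - p.2| ≤ 5 * ρ p ^ 2} := by
    intro q hq
    obtain ⟨p, hp, ⟨z, ⟨h1, h2⟩, ⟨h3, h4⟩⟩, h5⟩ := hcov q hq
    refine Set.mem_biUnion hp ⟨?_, ?_⟩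
    · have : ‖q.1 - p.1‖ ≤ ‖z.1 - p.1‖ + ‖z.1 - q.1‖ := by
        have := norm_sub_le (z.1 - p.1) (z.1 - q.1)
        rwa [show z.1 - p.1 - (z.1 - q.1) = q.1 - p.1 by abel] at this
      linarith
    · have h6 : ρ q ^ 2 ≤ 4 * ρ p ^ 2 := by
        have := pow_le_pow_left₀ (hρ q hq).le h5 2
        linarith [this, mul_pow 2 (ρ p) 2]
      rw [abs_le] at *
      constructor <;> linarith [h2.1, h2.2, h4.1, h4.2]
  calc ENNReal.ofReal μ * MeasureTheory.volume A
      ≤ ENNReal.ofReal μ * ∑' p : U, MeasureTheory.volume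
          {q : Euc n × ℝ | ‖q.1 - p.1.1‖ ≤ 3 * ρ p ∧ |q.2 - p.1.2| ≤ 5 * ρ p ^ 2} := by
        gcongr
        refine (MeasureTheory.measure_mono hAsub).trans ?_
        exact MeasureTheory.measure_biUnion_le _ hcount _
    _ ≤ ENNReal.ofReal μ * ∑' p : U, ENNReal.ofReal (ρ p ^ (n + 2)) * V := by
        gcongr with p
        exact volume_parabolic_cylinder_le _ _ (hρ p (hUA p.2))
    _ = V * ∑' p : U, ENNReal.ofReal (μ * ρ p ^ (n + 2)) := by
        rw [← ENNReal.tsum_mul_left, ← ENNReal.tsum_mul_left]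
        refine tsum_congr fun p => ?_
        rw [ENNReal.ofReal_mul hμ.le]
        ring
    _ ≤ V * ∑' p : U, MeasureTheory.volume (lensSet p.1.1 p.1.2 (ρ p) ∩ F) := by
        gcongr with p
        exact hvol p (hUA p.2)
    _ = V * MeasureTheory.volume (⋃ p ∈ U, lensSet p.1 p.2 (ρ p) ∩ F) := by
        rw [MeasureTheory.measure_biUnion hcount]
        · exact fun p hp q hq hpq => (hdisjL hp hq hpq).mono Set.inter_subset_left
            Set.inter_subset_left
        · exact fun p _ => (isOpen_lensSet _ _ _).measurableSet.inter hF
    _ ≤ V * MeasureTheory.volume D := by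
        gcongr
        exact Set.iUnion₂_subset fun p hp => hD p (hUA hp)

/-- The power decay of the distribution function of nonnegative supersolutions. -/
lemma exists_decay {n : ℕ} {lam Lam M μ : ℝ} (hP : PointToMeasure n lam Lam M μ) (hM : 1 < M)
    (hμ : 0 < μ) : ∃ C > (0 : ℝ), ∃ θ ∈ Set.Ioo (0 : ℝ) 1, ∀ (K : ℕ) (w : Euc n → ℝ → ℝ),
      SuperBelow lam Lam (M ^ K) w → ∀ z : Euc n, ‖z‖ ≤ 2 → w z (41 / 2) ≤ 1 → ∀ k ≤ K,
      MeasureTheory.volume {p : Euc n × ℝ | ‖p.1‖ < 1 ∧ 0 < p.2 ∧ p.2 < 1 ∧ M ^ k < w p.1 p.2} ≤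
        ENNReal.ofReal (C * θ ^ k) := by
  set V := MeasureTheory.volume (Metric.closedBall (0 : Euc n) 3 ×ˢ Set.Icc (-5 : ℝ) 5) with hV
  have hVtop : V ≠ ⊤ := ((isCompact_closedBall _ _).prod isCompact_Icc).measure_lt_top.ne
  set v := V.toReal with hv
  have hVv : V = ENNReal.ofReal v := (ENNReal.ofReal_toReal hVtop).symm
  have hv0 : 0 < v := by
    refine ENNReal.toReal_pos ?_ hVtop
    have : 0 < MeasureTheory.volume (Metric.ball (0 : Euc n) 3 ×ˢ Set.Ioo (-5 : ℝ) 5) :=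
      (Metric.isOpen_ball.prod isOpen_Ioo).measure_pos _ ⟨(0, 0), by simp⟩
    exact (this.trans_le (MeasureTheory.measure_mono
      (Set.prod_mono Metric.ball_subset_closedBall Set.Ioo_subset_Icc_self))).ne'
  set θ := v / (v + μ) with hθ
  have hθ0 : 0 < θ := by positivity
  have hθ1 : θ < 1 := by rw [hθ, div_lt_one (by positivity)]; linarith
  refine ⟨v * (θ ^ 6)⁻¹, by positivity, θ, ⟨hθ0, hθ1⟩, ?_⟩
  intro K w hw z hz hwz k hk
  set R : ℕ → ℝ := fun j => 1 + (3 / 5) ^ j with hR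
  have hR2 : ∀ j, R j ≤ 2 := fun j => by
    have : (3 / 5 : ℝ) ^ j ≤ 1 := pow_le_one₀ (by norm_num) (by norm_num)
    simp only [hR]; linarith
  set Ω : ℕ → ℕ → Set (Euc n × ℝ) := fun j k =>
    {p | ‖p.1‖ < R j ∧ 0 < p.2 ∧ p.2 < R j ∧ M ^ k < w p.1 p.2} with hΩ
  have hmeas : ∀ k : ℕ, MeasurableSet {p : Euc n × ℝ | p.1 ∈ Metric.ball 0 2 ∧
      p.2 ∈ Set.Ioo (0 : ℝ) 2 ∧ w p.1 p.2 ≤ M ^ k} := fun k => by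
    refine measurableSet_sublevel_of_separately measurableSet_ball measurableSet_Ioo ?_ ?_ _
    · intro x hx t ht
      rw [mem_ball_zero_iff] at hx
      exact (hw x t (by linarith) ht.1 (by linarith [ht.2])).2.1
    · intro x hx t ht
      rw [mem_ball_zero_iff] at hx
      exact (hw x t (by linarith) ht.1 (by linarith [ht.2])).2.2.1
  have hsubV : ∀ j k, Ω j k ⊆ Metric.closedBall (0 : Euc n) 3 ×ˢ Set.Icc (-5 : ℝ) 5 := by
    rintro j k ⟨x, t⟩ ⟨h1, h2, h3, -⟩
    have := hR2 j
    simp only at h1 h2 h3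
    refine ⟨?_, ?_, ?_⟩
    · rw [mem_closedBall_zero_iff]; simp only; linarith
    · simp only; linarith
    · simp only; linarith
  have hle : ∀ j k, MeasureTheory.volume (Ω j k) ≤ V := fun j k =>
    MeasureTheory.measure_mono (hsubV j k)
  have hfin : ∀ j k, MeasureTheory.volume (Ω j k) ≠ ⊤ := fun j k =>
    ((hle j k).trans_lt hVtop.lt_top).ne
  have step : ∀ j, j + 7 ≤ K → (MeasureTheory.volume (Ω (j + 1) (j + 7))).toReal ≤
      θ * (MeasureTheory.volume (Ω j (j + 6))).toReal := by
    intro j hj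
    have hRj : R (j + 1) + 2 / 5 * (3 / 5) ^ j = R j := by
      simp only [hR, pow_succ]; ring
    have hlens : ∀ p ∈ Ω (j + 1) (j + 6), ∃ ρ > 0, ρ ^ 2 ≤ (5 / 16) ^ (j + 6) * (41 / 2) ∧
        (∀ q ∈ lensSet p.1 p.2 ρ, M ^ (j + 6) < w q.1 q.2) ∧
        ENNReal.ofReal (μ * ρ ^ (n + 2)) ≤
          MeasureTheory.volume (lensSet p.1 p.2 ρ ∩ {p | w p.1 p.2 ≤ M ^ (j + 6 + 1)}) := by
      rintro ⟨x, t⟩ ⟨h1, h2, h3, h4⟩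
      have hpos : 0 < (3 / 5 : ℝ) ^ j := by positivity
      exact exists_lens hP hM hμ hw hz hwz (by omega) (by linarith [hR2 j]) h2
        (by linarith [hR2 j]) h4
    choose! ρ hρ0 hρ1 hρ2 hρ3 using hlens
    have hin : ∀ p ∈ Ω (j + 1) (j + 6), ∀ q ∈ lensSet p.1 p.2 (ρ p),
        ‖q.1‖ < R j ∧ 0 < q.2 ∧ q.2 < R j := by
      rintro p hp q ⟨k1, k2, k3⟩
      have e1 := hρ1 p hp
      have e2 := hρ0 p hp
      obtain ⟨h1, h2, h3, h4⟩ := hp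
      have hpos : 0 < (3 / 5 : ℝ) ^ j := by positivity
      have e3 : ρ p ^ 2 ≤ (9 / 25) ^ j * (1 / 25) := by
        have : (5 / 16 : ℝ) ^ j ≤ (9 / 25) ^ j := pow_le_pow_left₀ (by norm_num) (by norm_num) j
        rw [pow_add] at e1
        have h9 : (0:ℝ) < (9 / 25) ^ j := by positivity
        norm_num at e1
        nlinarith
      have e4 : (9 / 25 : ℝ) ^ j = ((3 / 5) ^ j) ^ 2 := by
        rw [← pow_mul, mul_comm, pow_mul]; norm_num
      have e5 : ρ p ≤ (3 / 5) ^ j / 5 := by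
        refine le_of_sq_le_sq ?_ (by positivity)
        rw [e4] at e3; nlinarith
      have e6 : (3 / 5 : ℝ) ^ j ≤ 1 := pow_le_one₀ (by norm_num) (by norm_num)
      rw [Metric.mem_ball, dist_eq_norm] at k1
      have e7 : ‖q.1‖ ≤ ‖q.1 - p.1‖ + ‖p.1‖ := by simpa using norm_add_le (q.1 - p.1) p.1
      refine ⟨by linarith, by nlinarith, ?_⟩
      nlinarith
    have key := volume_le_of_lenses (A := Ω (j + 1) (j + 6)) (D := Ω j (j + 6) \ Ω j (j + 7))
      (hmeas (j + 7)) (R := 5) hμ ρ hρ0 ?_ ?_ ?_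
    · have hsplit : MeasureTheory.volume (Ω j (j + 6) \ Ω j (j + 7)) +
          MeasureTheory.volume (Ω j (j + 7)) = MeasureTheory.volume (Ω j (j + 6)) := by
        have hsub : Ω j (j + 7) ⊆ Ω j (j + 6) := by
          rintro p ⟨h1, h2, h3, h4⟩
          exact ⟨h1, h2, h3, (pow_le_pow_right₀ hM.le (by omega)).trans_lt h4⟩
        have hm7 : MeasurableSet (Ω j (j + 7)) := by
          have : Ω j (j + 7) = (Metric.ball 0 (R j) ×ˢ Set.Ioo 0 (R j)) \
              {p : Euc n × ℝ | p.1 ∈ Metric.ball 0 2 ∧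
                p.2 ∈ Set.Ioo (0 : ℝ) 2 ∧ w p.1 p.2 ≤ M ^ (j + 7)} := by
            ext ⟨x, t⟩
            have := hR2 j
            simp only [hΩ, Set.mem_ofPred_eq, Set.mem_sdiff, Set.mem_prod, mem_ball_zero_iff,
              Set.mem_Ioo, not_and, not_le]
            constructor
            · rintro ⟨h1, h2, h3, h4⟩
              exact ⟨⟨h1, h2, h3⟩, fun _ _ => h4⟩
            · rintro ⟨⟨h1, h2, h3⟩, h4⟩
              exact ⟨h1, h2, h3, h4 (by linarith) ⟨h2, by linarith⟩⟩
          rw [this]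
          exact (measurableSet_ball.prod measurableSet_Ioo).diff (hmeas _)
        rw [MeasureTheory.measure_sdiff hsub hm7.nullMeasurableSet (hfin _ _),
          tsub_add_cancel_of_le (MeasureTheory.measure_mono hsub)]
      have hmono : MeasureTheory.volume (Ω (j + 1) (j + 7)) ≤
          MeasureTheory.volume (Ω (j + 1) (j + 6)) := MeasureTheory.measure_mono <| by
        rintro p ⟨h1, h2, h3, h4⟩
        exact ⟨h1, h2, h3, (pow_le_pow_right₀ hM.le (by omega)).trans_lt h4⟩
      have hmono2 : MeasureTheory.volume (Ω (j + 1) (j + 7)) ≤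
          MeasureTheory.volume (Ω j (j + 7)) := MeasureTheory.measure_mono <| by
        rintro p ⟨h1, h2, h3, h4⟩
        have hpos : 0 < (3 / 5 : ℝ) ^ j := by positivity
        exact ⟨by linarith, h2, by linarith, h4⟩
      have hdfin : MeasureTheory.volume (Ω j (j + 6) \ Ω j (j + 7)) ≠ ⊤ :=
        ((MeasureTheory.measure_mono Set.sdiff_subset).trans_lt (hfin j (j + 6)).lt_top).ne
      have key2 := ENNReal.toReal_mono (ENNReal.mul_ne_top hVtop hdfin) key
      rw [ENNReal.toReal_mul, ENNReal.toReal_mul, ENNReal.toReal_ofReal hμ.le] at key2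
      have hs := congrArg ENNReal.toReal hsplit
      rw [ENNReal.toReal_add hdfin (hfin _ _)] at hs
      have m1 := ENNReal.toReal_mono (hfin _ _) hmono
      have m2 := ENNReal.toReal_mono (hfin _ _) hmono2
      rw [hθ, div_mul_eq_mul_div, le_div_iff₀ (by positivity)]
      nlinarith
    · intro p hp
      have e1 := hρ1 p hp
      have : (5 / 16 : ℝ) ^ (j + 6) ≤ 1 := pow_le_one₀ (by norm_num) (by norm_num)
      by_contra! h
      nlinarith
    · rintro p hp q ⟨h1, h2⟩
      obtain ⟨k1, k2, k3⟩ := hin p hp q h1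
      exact ⟨⟨k1, k2, k3, hρ2 p hp q h1⟩, fun h => absurd h.2.2.2 (not_lt.2 h2.2.2)⟩
    · intro p hp
      refine (hρ3 p hp).trans (MeasureTheory.measure_mono ?_)
      rintro q ⟨h1, h2⟩
      obtain ⟨k1, k2, k3⟩ := hin p hp q h1
      have := hR2 j
      exact ⟨h1, by rw [mem_ball_zero_iff]; linarith, ⟨k2, by linarith⟩, h2⟩
  have iter : ∀ j, j + 6 ≤ K → (MeasureTheory.volume (Ω j (j + 6))).toReal ≤ θ ^ j * v := by
    intro j
    induction j with
    | zero =>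
      intro _
      rw [pow_zero, one_mul]
      exact ENNReal.toReal_mono hVtop (hle _ _)
    | succ j ih =>
      intro hj
      have h1 := step j (by omega)
      have h2 := ih (by omega)
      rw [show j + 1 + 6 = j + 7 by omega, pow_succ]
      nlinarith
  have hfinal : ∀ j, {p : Euc n × ℝ | ‖p.1‖ < 1 ∧ 0 < p.2 ∧ p.2 < 1 ∧ M ^ k < w p.1 p.2} ⊆
      Ω j k := by
    rintro j p ⟨h1, h2, h3, h4⟩
    have hpos : 0 < (3 / 5 : ℝ) ^ j := by positivity
    exact ⟨by simp only [hR]; linarith, h2, by simp only [hR]; linarith, h4⟩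
  rcases le_total 6 k with h6 | h6
  · obtain ⟨j, rfl⟩ := Nat.exists_eq_add_of_le' h6
    refine (MeasureTheory.measure_mono (hfinal j)).trans ?_
    rw [← ENNReal.ofReal_toReal (hfin j (j + 6))]
    refine ENNReal.ofReal_le_ofReal ((iter j hk).trans (le_of_eq ?_))
    rw [pow_add]; field_simp
  · refine (MeasureTheory.measure_mono (hfinal 0)).trans ((hle 0 k).trans ?_)
    rw [hVv]
    refine ENNReal.ofReal_le_ofReal ?_
    rw [mul_assoc]
    refine le_mul_of_one_le_right hv0.le ?_
    rw [inv_mul_eq_div, one_le_div (by positivity)]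
    exact pow_le_pow_of_le_one hθ0.le hθ1.le h6

lemma SolAt.continuousAt_space {n : ℕ} {lam Lam : ℝ} {u : Euc n → ℝ → ℝ} {x : Euc n} {t : ℝ}
    (h : SolAt lam Lam u x t) : ContinuousAt (fun y => u y t) x := h.1.continuousAt

lemma SolAt.continuousAt_time {n : ℕ} {lam Lam : ℝ} {u : Euc n → ℝ → ℝ} {x : Euc n} {t : ℝ}
    (h : SolAt lam Lam u x t) : ContinuousAt (u x) t :=
  h.2.choose_spec.1.continuousAt

/-- The conclusion of `exists_decay`. -/
def PowerDecay (n : ℕ) (lam Lam M C θ : ℝ) : Prop :=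
  ∀ (K : ℕ) (w : Euc n → ℝ → ℝ),
      SuperBelow lam Lam (M ^ K) w → ∀ z : Euc n, ‖z‖ ≤ 2 → w z (41 / 2) ≤ 1 → ∀ k ≤ K,
      MeasureTheory.volume {p : Euc n × ℝ | ‖p.1‖ < 1 ∧ 0 < p.2 ∧ p.2 < 1 ∧ M ^ k < w p.1 p.2} ≤
        ENNReal.ofReal (C * θ ^ k)

/-- The volume of the unit cylinder. -/
def unitVol (n : ℕ) : ℝ :=
  (MeasureTheory.volume (Metric.ball (0 : Euc n) 1 ×ˢ Set.Ioo (0 : ℝ) 1)).toReal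

lemma unitVol_top (n : ℕ) :
    MeasureTheory.volume (Metric.ball (0 : Euc n) 1 ×ˢ Set.Ioo (0 : ℝ) 1) ≠ ⊤ := by
  refine ((MeasureTheory.measure_mono (Set.prod_mono Metric.ball_subset_closedBall
    Set.Ioo_subset_Icc_self)).trans_lt
      ((isCompact_closedBall (0 : Euc n) 1).prod isCompact_Icc).measure_lt_top).ne

lemma unitVol_pos (n : ℕ) : 0 < unitVol n := by
  refine ENNReal.toReal_pos ?_ (unitVol_top n)
  exact ((Metric.isOpen_ball.prod isOpen_Ioo).measure_pos _ ⟨(0, 1 / 2), by norm_num⟩).ne.symm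

/-- The hypotheses on a solution in the unit Harnack configuration, where below time `0` the
function is merely bounded by `1`. -/
structure HarnackHyp {n : ℕ} (lam Lam σ : ℝ) (u : Euc n → ℝ → ℝ) : Prop where
  nonneg : ∀ x t, ‖x‖ < 9 → 0 < t → t ≤ 41 / 2 → 0 ≤ u x t
  sol : ∀ x t, ‖x‖ < 9 → 0 < t → t ≤ 41 / 2 → SolAt lam Lam u x t
  rc : ∀ x t, ‖x‖ < 9 → 0 < t → t < 41 / 2 → RightCont u x t
  bot : ∀ x t, ‖x‖ < 1 → σ - 1 / 4 < t → t ≤ 0 → 0 ≤ u x t ∧ u x t ≤ 1 ∧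
    ContinuousAt (fun y => u y t) x ∧ ContinuousAt (u x) t ∧ RightCont u x t

namespace HarnackHyp
variable {n : ℕ} {lam Lam σ : ℝ} {u : Euc n → ℝ → ℝ}

lemma regular (h : HarnackHyp lam Lam σ u) {x : Euc n} {t : ℝ} (hx : ‖x‖ < 1)
    (ht : σ - 1 / 4 < t) (ht2 : t ≤ 1 / 2) : 0 ≤ u x t ∧
    ContinuousAt (fun y => u y t) x ∧ ContinuousAt (u x) t ∧ RightCont u x t ∧
    (1 < u x t → 0 < t ∧ SolAt lam Lam u x t) := by
  rcases le_or_gt t 0 with h0 | h0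
  · obtain ⟨a1, a2, a3, a4, a5⟩ := h.bot x t hx ht h0
    exact ⟨a1, a3, a4, a5, fun h => absurd h (not_lt.2 a2)⟩
  · have hs := h.sol x t (by linarith) h0 (by linarith)
    exact ⟨h.nonneg x t (by linarith) h0 (by linarith), hs.continuousAt_space,
      hs.continuousAt_time, h.rc x t (by linarith) h0 (by linarith), fun _ => ⟨h0, hs⟩⟩

lemma superBelow (h : HarnackHyp lam Lam σ u) (B : ℝ) : SuperBelow lam Lam B u := by
  intro x t hx h0 h1
  have hs := h.sol x t hx h0 h1
  exact ⟨h.nonneg x t hx h0 h1, hs.continuousAt_space, hs.continuousAt_time,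
    fun h2 => (h.rc x t hx h0 h2).rlsc, fun _ => hs.superAt⟩

lemma growth_step (h : HarnackHyp lam Lam σ u) {M C θ : ℝ}
    (hdec : PowerDecay n lam Lam M C θ) (hM : 1 < M) {K k : ℕ}
    (hK : C * θ ^ K ≤ unitVol n / 2) {z : Euc n} (hz : ‖z‖ ≤ 2) (huz : u z (41 / 2) ≤ 1)
    {N r : ℝ} (hN : 2 ≤ N) (hNk : M ^ k ≤ N / 2) (hr : 0 < r)
    (hrk : C * θ ^ k < r ^ (n + 2) * (unitVol n / 2)) {x : Euc n} {t : ℝ} (hx : ‖x‖ + 9 * r < 1)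
    (ht : σ - 1 / 4 < t - 41 / 2 * r ^ 2) (ht2 : t ≤ 1 / 2) (hu : N ≤ u x t) :
    ∃ x' t', ‖x' - x‖ ≤ 9 * r ∧ t - 41 / 2 * r ^ 2 ≤ t' ∧ t' ≤ t ∧
      (1 + (M ^ K)⁻¹ / 2) * N ≤ u x' t' := by
  by_contra! hcon
  set δ := (M ^ K)⁻¹ / 2 with hδ
  have hMK : 0 < M ^ K := by positivity
  have hδ0 : 0 < δ := by positivity
  have hδM : δ * M ^ K = 1 / 2 := by rw [hδ]; field_simp
  have hN0 : 0 < N := by linarith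
  have hr2 : 0 < r ^ 2 := by positivity
  have hdN : 0 < δ * N := by positivity
  set τ := t - 41 / 2 * r ^ 2 with hτ
  set c := -(δ * N)⁻¹ with hc
  set w : Euc n → ℝ → ℝ := fun y s => c * u (x + r • y) (τ + r ^ 2 * s) + (1 + δ) / δ with hw
  have hwval : ∀ y s, w y s = ((1 + δ) * N - u (x + r • y) (τ + r ^ 2 * s)) / (δ * N) := by
    intro y s
    simp only [hw, hc]; field_simp; ring
  have hball : ∀ y : Euc n, ‖y‖ < 9 → ‖x + r • y‖ < 1 := fun y hy => by
    have := norm_add_le x (r • y)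
    rw [norm_smul, Real.norm_eq_abs, abs_of_pos hr] at this
    nlinarith
  have hsup : SuperBelow lam Lam (M ^ K) w := by
    intro y s hy hs hs2
    have hlo : σ - 1 / 4 < τ + r ^ 2 * s := by nlinarith
    have hhi : τ + r ^ 2 * s ≤ t := by nlinarith
    obtain ⟨a1, a2, a3, a4, a5⟩ := h.regular (hball y hy) hlo (hhi.trans ht2)
    have hlt := hcon (x + r • y) (τ + r ^ 2 * s) (by
      rw [add_sub_cancel_left, norm_smul, Real.norm_eq_abs, abs_of_pos hr]; nlinarith)
      (by nlinarith) hhi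
    refine ⟨?_, ?_, ?_, ?_, ?_⟩
    · rw [hwval]; exact div_nonneg (by linarith) hdN.le
    · refine ContinuousAt.add (continuousAt_const.mul ?_) continuousAt_const
      exact ContinuousAt.comp (g := fun z => u z (τ + r ^ 2 * s)) (f := fun z => x + r • z) a2
        (by fun_prop)
    · refine ContinuousAt.add (continuousAt_const.mul ?_) continuousAt_const
      exact ContinuousAt.comp (g := u (x + r • y)) (f := fun s => τ + r ^ 2 * s) a3 (by fun_prop)
    · intro _
      exact (RightCont.affine (RightCont.scale a4) c _).rlsc
    · intro hle
      rw [hwval, div_le_iff₀ hdN] at hle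
      have h1 : 1 < u (x + r • y) (τ + r ^ 2 * s) := by
        have : M ^ K * (δ * N) = N / 2 := by rw [← mul_assoc, mul_comm (M ^ K), hδM]; ring
        nlinarith
      exact (SolAt.affine (SolAt.scale (a5 h1).2) c _).superAt
  have hfin := hdec K w hsup 0 (by simp) (by
    rw [hwval, smul_zero, add_zero, div_le_one hdN, show τ + r ^ 2 * (41 / 2) = t by
      rw [hτ]; ring]
    linarith) K le_rfl
  set Q : Set (Euc n × ℝ) := Metric.ball (0 : Euc n) 1 ×ˢ Set.Ioo (0 : ℝ) 1 with hQ
  set E := Q \ {p : Euc n × ℝ | ‖p.1‖ < 1 ∧ 0 < p.2 ∧ p.2 < 1 ∧ M ^ K < w p.1 p.2} with hE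
  have hEvol : ENNReal.ofReal (unitVol n / 2) ≤ MeasureTheory.volume E := by
    have h1 : MeasureTheory.volume Q ≤ MeasureTheory.volume E + ENNReal.ofReal (unitVol n / 2) := by
      refine (MeasureTheory.measure_mono (show Q ⊆ E ∪ _ from fun p hp => ?_)).trans
        ((MeasureTheory.measure_union_le E _).trans
          (add_le_add le_rfl (hfin.trans (ENNReal.ofReal_le_ofReal hK))))
      by_cases hp2 : p ∈ {p : Euc n × ℝ | ‖p.1‖ < 1 ∧ 0 < p.2 ∧ p.2 < 1 ∧ M ^ K < w p.1 p.2}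
      · exact Or.inr hp2
      · exact Or.inl ⟨hp, hp2⟩
    have h2 : MeasureTheory.volume Q = ENNReal.ofReal (unitVol n / 2) +
        ENNReal.ofReal (unitVol n / 2) := by
      rw [← ENNReal.ofReal_add (by have := unitVol_pos n; positivity)
        (by have := unitVol_pos n; positivity), add_halves]
      exact (ENNReal.ofReal_toReal (unitVol_top n)).symm
    rw [h2] at h1
    exact (ENNReal.add_le_add_iff_right ENNReal.ofReal_ne_top).1 h1
  have hu2 := hdec k u (h.superBelow _) z hz huz k le_rfl
  have hsub : parScale x τ r '' E ⊆
      {p : Euc n × ℝ | ‖p.1‖ < 1 ∧ 0 < p.2 ∧ p.2 < 1 ∧ M ^ k < u p.1 p.2} := by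
    rintro _ ⟨⟨y, s⟩, ⟨⟨hy, hs1, hs2⟩, hnot⟩, rfl⟩
    simp only [mem_ball_zero_iff] at hy hs1 hs2
    have hle : w y s ≤ M ^ K := by
      by_contra! hgt
      exact hnot ⟨hy, hs1, hs2, hgt⟩
    have hval : N / 2 < u (x + r • y) (τ + r ^ 2 * s) := by
      rw [hwval, div_le_iff₀ hdN] at hle
      have : M ^ K * (δ * N) = N / 2 := by rw [← mul_assoc, mul_comm (M ^ K), hδM]; ring
      nlinarith
    have hlo : σ - 1 / 4 < τ + r ^ 2 * s := by nlinarith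
    have hhi : τ + r ^ 2 * s ≤ t := by nlinarith
    obtain ⟨-, -, -, -, a5⟩ := h.regular (hball y (by linarith)) hlo (hhi.trans ht2)
    refine ⟨hball y (by linarith), (a5 (by linarith)).1, ?_, ?_⟩
    · simp only [parScale]; linarith
    · simp only [parScale]; linarith
  have h3 := MeasureTheory.measure_mono (μ := MeasureTheory.volume) hsub
  rw [volume_image_parScale x τ hr] at h3
  have h4 : ENNReal.ofReal (r ^ (n + 2)) * ENNReal.ofReal (unitVol n / 2) ≤
      ENNReal.ofReal (C * θ ^ k) := le_trans (by gcongr) (h3.trans hu2)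
  rw [← ENNReal.ofReal_mul (by positivity)] at h4
  have hpos : 0 < r ^ (n + 2) * (unitVol n / 2) := by have := unitVol_pos n; positivity
  rw [ENNReal.ofReal_le_ofReal_iff'] at h4
  rcases h4 with h4 | h4 <;> linarith

end HarnackHyp

set_option maxHeartbeats 800000 in
/-- The Harnack inequality in unit scale. -/
lemma exists_harnack_unit (n : ℕ) {lam Lam : ℝ} (hlam : 0 < lam) (hLam : lam ≤ Lam) :
    ∃ C > (1 : ℝ), ∀ (σ : ℝ) (u : Euc n → ℝ → ℝ), HarnackHyp lam Lam σ u →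
      ∀ z : Euc n, ‖z‖ ≤ 2 → u z (41 / 2) ≤ 1 → ∀ x t, ‖x‖ ≤ 1 / 2 → σ ≤ t → t ≤ 1 / 2 →
        u x t ≤ C := by
  obtain ⟨M, hM, μ, hμ, hP⟩ := exists_pointToMeasure n hlam hLam
  obtain ⟨C, hC, θ, ⟨hθ0, hθ1⟩, hdec⟩ := exists_decay hP hM hμ
  replace hdec : PowerDecay n lam Lam M C θ := hdec
  have hV := unitVol_pos n
  have hsmall : ∀ ε > 0, ∃ k : ℕ, C * θ ^ k < ε := fun ε hε => by
    obtain ⟨k, hk⟩ := exists_pow_lt_of_lt_one (show 0 < ε / C by positivity) hθ1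
    exact ⟨k, by rwa [lt_div_iff₀ hC, mul_comm] at hk⟩
  obtain ⟨K, hK⟩ := hsmall (unitVol n / 2) (by positivity)
  set δ := (M ^ K)⁻¹ / 2 with hδ
  have hδ0 : 0 < δ := by positivity
  obtain ⟨m, hm⟩ := pow_unbounded_of_one_lt M (show 1 < 1 + δ by linarith)
  have hm0 : m ≠ 0 := by
    rintro rfl
    rw [pow_zero] at hm; linarith
  set γ := θ ^ ((((n + 2) * m : ℕ) : ℝ)⁻¹) with hγ
  have hγ0 : 0 < γ := Real.rpow_pos_of_pos hθ0 _
  have hγ1 : γ < 1 := Real.rpow_lt_one hθ0.le hθ1 (by positivity)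
  have hγm : γ ^ ((n + 2) * m) = θ := Real.rpow_inv_natCast_pow hθ0.le (by positivity)
  set A := (1 - γ) / 100 with hA
  have hA0 : 0 < A := by rw [hA]; linarith
  obtain ⟨k0, hk0⟩ := hsmall (θ * (A ^ (n + 2) * (unitVol n / 2))) (by positivity)
  set N0 := 2 * M ^ k0 with hN0
  have hMk0 : 1 ≤ M ^ k0 := one_le_pow₀ hM.le
  refine ⟨N0, by linarith, ?_⟩
  clear_value γ A δ N0
  intro σ u hu z hz huz x0 t0 hx0 ht0 ht02
  by_contra! hcon
  set S : ℕ → Euc n × ℝ → Prop := fun j q => ‖q.1‖ ≤ 1 / 2 + 9 / 100 * (1 - γ ^ j) ∧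
    σ - 205 / 1000 * (1 - γ ^ j) ≤ q.2 ∧ q.2 ≤ 1 / 2 ∧ N0 * (1 + δ) ^ j ≤ u q.1 q.2 with hS
  have step : ∀ j q, S j q → ∃ q', S (j + 1) q' ∧ ‖q'.1 - q.1‖ ≤ 9 * A * γ ^ j ∧ q'.2 ≤ q.2 := by
    rintro j ⟨x, t⟩ ⟨h1, h2, h3, h4⟩
    simp only at h1 h2 h3 h4
    have hg0 : 0 < γ ^ j := by positivity
    have hg1 : γ ^ j ≤ 1 := pow_le_one₀ hγ0.le hγ1.le
    have hd1 : 1 ≤ (1 + δ) ^ j := one_le_pow₀ (by linarith)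
    have hr1 : A * γ ^ j ≤ 1 := by nlinarith
    have hr2 : (A * γ ^ j) ^ 2 ≤ A * γ ^ j := by
      rw [sq]; exact mul_le_of_le_one_left (by positivity) hr1
    have hgs : γ ^ (j + 1) = γ ^ j * γ := pow_succ _ _
    have hAg : 100 * (A * γ ^ j) = γ ^ j - γ ^ (j + 1) := by rw [hgs, hA]; ring
    have hgs0 : 0 < γ ^ (j + 1) := by positivity
    have hNk : M ^ (k0 + j / m) ≤ N0 * (1 + δ) ^ j / 2 := by
      rw [pow_add]
      have : M ^ (j / m) ≤ (1 + δ) ^ j := by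
        refine (pow_le_pow_left₀ (by linarith) hm.le _).trans ?_
        rw [← pow_mul]
        exact pow_le_pow_right₀ (by linarith) (Nat.mul_div_le j m)
      nlinarith
    have hrk : C * θ ^ (k0 + j / m) < (A * γ ^ j) ^ (n + 2) * (unitVol n / 2) := by
      have h5 : θ * θ ^ (j / m) ≤ (γ ^ j) ^ (n + 2) := by
        rw [← pow_succ', ← hγm, ← pow_mul, ← pow_mul]
        refine pow_le_pow_of_le_one hγ0.le hγ1.le ?_
        have := Nat.lt_mul_div_succ j (Nat.pos_of_ne_zero hm0)
        calc j * (n + 2) ≤ (m * (j / m + 1)) * (n + 2) := Nat.mul_le_mul_right _ this.le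
          _ = (n + 2) * m * (j / m + 1) := by ring
      rw [mul_pow, pow_add, ← mul_assoc]
      have h6 : 0 < θ ^ (j / m) := by positivity
      have h7 : 0 < A ^ (n + 2) * (unitVol n / 2) := by positivity
      calc C * θ ^ k0 * θ ^ (j / m) < θ * (A ^ (n + 2) * (unitVol n / 2)) * θ ^ (j / m) :=
            mul_lt_mul_of_pos_right hk0 h6
        _ = (θ * θ ^ (j / m)) * (A ^ (n + 2) * (unitVol n / 2)) := by ring
        _ ≤ (γ ^ j) ^ (n + 2) * (A ^ (n + 2) * (unitVol n / 2)) := by gcongr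
        _ = _ := by ring
    obtain ⟨x', t', g1, g2, g3, g4⟩ := hu.growth_step hdec hM hK.le (k := k0 + j / m) hz huz
      (N := N0 * (1 + δ) ^ j) (r := A * γ ^ j) (by nlinarith) hNk (by positivity) hrk (x := x) (t := t)
      (by linarith) (by linarith) h3 h4
    refine ⟨(x', t'), ⟨?_, ?_, by simp only; linarith, ?_⟩, by simp only; linarith, g3⟩
    · have : ‖x'‖ ≤ ‖x' - x‖ + ‖x‖ := by simpa using norm_add_le (x' - x) x
      simp only; linarith
    · simp only; linarith
    · simp only
      refine le_trans (le_of_eq ?_) g4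
      rw [pow_succ, ← hδ]; ring
  choose! f hf1 hf2 hf3 using step
  set q : ℕ → Euc n × ℝ := fun j => Nat.rec (x0, t0) (fun j p => f j p) j with hq
  have hqs : ∀ j, q (j + 1) = f j (q j) := fun j => rfl
  have hSq : ∀ j, S j (q j) := by
    intro j
    induction j with
    | zero => exact ⟨by simpa [hq] using hx0, by simpa [hq] using ht0, ht02, by
        simpa [hq] using hcon.le⟩
    | succ j ih => rw [hqs]; exact hf1 j _ ih
  have hcx : CauchySeq (fun j => (q j).1) := by
    refine cauchySeq_of_le_geometric γ (9 * A) hγ1 fun j => ?_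
    rw [dist_comm, dist_eq_norm, hqs]
    exact hf2 j _ (hSq j)
  obtain ⟨xl, hxl⟩ := cauchySeq_tendsto_of_complete hcx
  have hanti : Antitone fun j => (q j).2 := antitone_nat_of_succ_le fun j => by
    rw [hqs]; exact hf3 j _ (hSq j)
  have hg1 : ∀ j, 1 - γ ^ j ≤ 1 := fun j => by have : 0 < γ ^ j := by positivity
                                               linarith
  have hlow : ∀ j, σ - 205 / 1000 ≤ (q j).2 := fun j => by
    have := (hSq j).2.1
    linarith [hg1 j]
  have htl := tendsto_atTop_ciInf hanti ⟨σ - 205 / 1000, by rintro _ ⟨j, rfl⟩; exact hlow j⟩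
  set tl := ⨅ j, (q j).2 with htl'
  have htle : ∀ j, tl ≤ (q j).2 := fun j => hanti.le_of_tendsto htl j
  have hxl2 : ‖xl‖ ≤ 1 / 2 + 9 / 100 := le_of_tendsto' hxl.norm fun j => by
    have := (hSq j).1
    linarith [hg1 j]
  have htl3 : σ - 205 / 1000 ≤ tl := ge_of_tendsto' htl hlow
  have hrc := (hu.regular (x := xl) (t := tl) (by linarith) (by linarith)
    ((htle 0).trans ht02)).2.2.2.1 1 one_pos
  have hqt : Filter.Tendsto q Filter.atTop (nhds (xl, tl)) := by
    rw [nhds_prod_eq]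
    exact hxl.prodMk htl
  have hbig : Filter.Tendsto (fun j : ℕ => N0 * (1 + δ) ^ j) Filter.atTop Filter.atTop :=
    (tendsto_pow_atTop_atTop_of_one_lt (by linarith)).const_mul_atTop (by linarith)
  obtain ⟨j, h1, h2⟩ := ((hqt.eventually hrc).and (hbig.eventually_ge_atTop (u xl tl + 1))).exists
  have h3 := (abs_lt.1 (h1 (htle j))).2
  have h4 := (hSq j).2.2.2
  linarith

/-- The interior Harnack inequality with constant `C`, at arbitrary scale. -/
def HarnackInterior (n : ℕ) (lam Lam C : ℝ) : Prop :=
  ∀ (u : Euc n → ℝ → ℝ) (x₁ x₂ : Euc n) (t r κ : ℝ), 0 < r → 0 < κ →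
    (∀ x s, ‖x - x₁‖ < 9 * r → t - r ^ 2 / 2 < s → s ≤ t + 20 * r ^ 2 →
      0 ≤ u x s ∧ SolAt lam Lam u x s ∧ (s < t + 20 * r ^ 2 → RightCont u x s)) →
    ‖x₂ - x₁‖ ≤ 2 * r → u x₂ (t + 20 * r ^ 2) ≤ κ → u x₁ t ≤ C * κ

/-- The Harnack inequality up to the bottom with constant `C`, at arbitrary scale. -/
def HarnackBottom (n : ℕ) (lam Lam C : ℝ) : Prop :=
  ∀ (u : Euc n → ℝ → ℝ) (y z : Euc n) (a R κ : ℝ), 0 < R → 0 < κ →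
    (∀ x s, ‖x - y‖ < 9 * R → a < s → s ≤ a + 41 / 2 * R ^ 2 →
      0 ≤ u x s ∧ SolAt lam Lam u x s ∧ (s < a + 41 / 2 * R ^ 2 → RightCont u x s)) →
    (∀ x, ‖x - y‖ < R → 0 ≤ u x a ∧ u x a ≤ κ ∧ RightCont u x a) →
    ‖z - y‖ ≤ 2 * R → u z (a + 41 / 2 * R ^ 2) ≤ κ →
    ∀ s, a ≤ s → s ≤ a + R ^ 2 / 2 → u y s ≤ C * κ

lemma norm_scale_sub {n : ℕ} {x z : Euc n} {r : ℝ} (hr : 0 < r) :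
    ‖x + r • z - x‖ = r * ‖z‖ := by
  rw [add_sub_cancel_left, norm_smul, Real.norm_eq_abs, abs_of_pos hr]

lemma harnackInterior_of_unit {n : ℕ} {lam Lam C : ℝ}
    (h : ∀ (σ : ℝ) (u : Euc n → ℝ → ℝ), HarnackHyp lam Lam σ u →
      ∀ z : Euc n, ‖z‖ ≤ 2 → u z (41 / 2) ≤ 1 → ∀ x t, ‖x‖ ≤ 1 / 2 → σ ≤ t → t ≤ 1 / 2 →
        u x t ≤ C) : HarnackInterior n lam Lam C := by
  intro u x₁ x₂ t r κ hr hκ hu hx hux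
  have hr2 : 0 < r ^ 2 := by positivity
  have hdom : ∀ (z : Euc n) (s : ℝ), ‖z‖ < 9 → 0 < s → s ≤ 41 / 2 →
      ‖x₁ + r • z - x₁‖ < 9 * r ∧ t - r ^ 2 / 2 < t - r ^ 2 / 2 + r ^ 2 * s ∧
      t - r ^ 2 / 2 + r ^ 2 * s ≤ t + 20 * r ^ 2 := by
    intro z s hz hs hs2
    rw [norm_scale_sub hr]
    refine ⟨by nlinarith, by nlinarith, by nlinarith⟩
  have key := h (1 / 4) (fun z s => κ⁻¹ * u (x₁ + r • z) (t - r ^ 2 / 2 + r ^ 2 * s) + 0)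
    ⟨?_, ?_, ?_, ?_⟩ (r⁻¹ • (x₂ - x₁)) ?_ ?_ 0 (1 / 2) (by simp) (by norm_num) le_rfl
  · simp only [smul_zero, add_zero] at key
    rw [show t - r ^ 2 / 2 + r ^ 2 * (1 / 2) = t by ring, inv_mul_le_iff₀ hκ] at key
    linarith
  · intro z s hz hs hs2
    obtain ⟨d1, d2, d3⟩ := hdom z s hz hs hs2
    have := (hu _ _ d1 d2 d3).1
    positivity
  · intro z s hz hs hs2
    obtain ⟨d1, d2, d3⟩ := hdom z s hz hs hs2
    exact SolAt.affine (SolAt.scale (hu _ _ d1 d2 d3).2.1) _ _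
  · intro z s hz hs hs2
    obtain ⟨d1, d2, d3⟩ := hdom z s hz hs hs2.le
    exact RightCont.affine (RightCont.scale ((hu _ _ d1 d2 d3).2.2 (by nlinarith))) _ _
  · intro z s _ h1 h2
    exact absurd h1 (by linarith)
  · rw [norm_smul, norm_inv, Real.norm_eq_abs, abs_of_pos hr, inv_mul_le_iff₀ hr]; linarith
  · simp only [smul_smul, mul_inv_cancel₀ hr.ne', one_smul, add_sub_cancel, add_zero]
    rw [show t - r ^ 2 / 2 + r ^ 2 * (41 / 2) = t + 20 * r ^ 2 by ring, inv_mul_le_iff₀ hκ]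
    linarith

lemma RightCont.congr_late {n : ℕ} {u v : Euc n → ℝ → ℝ} {x : Euc n} {t b : ℝ}
    (h : RightCont u x t) (hb : b < t) (huv : ∀ y s, b < s → u y s = v y s) :
    RightCont v x t := by
  intro ε hε
  have : ∀ᶠ p : Euc n × ℝ in nhds (x, t), b < p.2 :=
    continuousAt_snd.eventually (lt_mem_nhds hb)
  filter_upwards [h ε hε, this] with p h1 h2 h3
  rw [← huv _ _ h2, ← huv _ _ hb]
  exact h1 h3

lemma SolAt.congr_late {n : ℕ} {lam Lam : ℝ} {u v : Euc n → ℝ → ℝ} {x : Euc n} {t b : ℝ}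
    (h : SolAt lam Lam u x t) (hb : b < t) (huv : ∀ y s, b < s → u y s = v y s) :
    SolAt lam Lam v x t := by
  obtain ⟨h1, d, hd, l, hl, he⟩ := h
  have heq : (fun y => u y t) = fun y => v y t := funext fun y => huv y t hb
  refine ⟨heq ▸ h1, d, hd.congr_of_eventuallyEq ?_, l, hl, heq ▸ he⟩
  filter_upwards [lt_mem_nhds hb] with s hs
  exact (huv x s hs).symm

lemma harnackBottom_of_unit {n : ℕ} {lam Lam C : ℝ}
    (h : ∀ (σ : ℝ) (u : Euc n → ℝ → ℝ), HarnackHyp lam Lam σ u →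
      ∀ z : Euc n, ‖z‖ ≤ 2 → u z (41 / 2) ≤ 1 → ∀ x t, ‖x‖ ≤ 1 / 2 → σ ≤ t → t ≤ 1 / 2 →
        u x t ≤ C) : HarnackBottom n lam Lam C := by
  intro u y z a R κ hR hκ hu hbot hz huz s has hs
  have hR2 : 0 < R ^ 2 := by positivity
  have hdom : ∀ (z : Euc n) (s : ℝ), ‖z‖ < 9 → 0 < s → s ≤ 41 / 2 →
      ‖y + R • z - y‖ < 9 * R ∧ a < a + R ^ 2 * s ∧ a + R ^ 2 * s ≤ a + 41 / 2 * R ^ 2 := by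
    intro z s hz hs hs2
    rw [norm_scale_sub hR]
    refine ⟨by nlinarith, by nlinarith, by nlinarith⟩
  have hmax : ∀ (y' : Euc n) (s : ℝ), 0 < s → κ⁻¹ * u (y + R • y') (a + R ^ 2 * s) + 0 =
      κ⁻¹ * u (y + R • y') (a + R ^ 2 * max s 0) := by
    intro y' s hs
    rw [max_eq_left hs.le, add_zero]
  have key := h 0 (fun z s => κ⁻¹ * u (y + R • z) (a + R ^ 2 * max s 0))
    ⟨?_, ?_, ?_, ?_⟩ (R⁻¹ • (z - y)) ?_ ?_ 0 ((R ^ 2)⁻¹ * (s - a)) (by simp)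
      (by have : 0 ≤ s - a := by linarith
          positivity) (by rw [inv_mul_le_iff₀ hR2]; linarith)
  · rw [max_eq_left (by have : 0 ≤ s - a := by linarith
                        positivity), mul_inv_cancel_left₀ hR2.ne', smul_zero, add_zero,
      add_sub_cancel, inv_mul_le_iff₀ hκ] at key
    linarith
  · intro z s hz hs hs2
    obtain ⟨d1, d2, d3⟩ := hdom z s hz hs hs2
    have := (hu _ _ d1 d2 d3).1
    rw [max_eq_left hs.le]
    positivity
  · intro z s hz hs hs2
    obtain ⟨d1, d2, d3⟩ := hdom z s hz hs hs2
    exact (SolAt.affine (SolAt.scale (hu _ _ d1 d2 d3).2.1) κ⁻¹ 0).congr_late hs hmax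
  · intro z s hz hs hs2
    obtain ⟨d1, d2, d3⟩ := hdom z s hz hs hs2.le
    exact (RightCont.affine (RightCont.scale ((hu _ _ d1 d2 d3).2.2 (by nlinarith))) κ⁻¹ 0).congr_late
      hs hmax
  · intro x s hx _ hs0
    obtain ⟨b1, b2, b3⟩ := hbot (y + R • x) (by rw [norm_scale_sub hR]; nlinarith)
    have hcont : ContinuousAt (fun p : Euc n × ℝ => κ⁻¹ * u (y + R • p.1) (a + R ^ 2 * max p.2 0))
        (x, s) := by
      refine continuousAt_const.mul ?_
      rw [Metric.continuousAt_iff']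
      intro ε hε
      have htend : Filter.Tendsto (fun p : Euc n × ℝ => (y + R • p.1, a + R ^ 2 * max p.2 0))
          (nhds (x, s)) (nhds (y + R • x, a)) := by
        have : Continuous (fun p : Euc n × ℝ => (y + R • p.1, a + R ^ 2 * max p.2 0)) := by
          fun_prop
        have h2 := this.tendsto (x, s)
        simpa [max_eq_right hs0] using h2
      filter_upwards [htend.eventually (b3 ε hε)] with p hp
      have := hp (by nlinarith [le_max_right p.2 0])
      rw [Real.dist_eq]
      simpa [max_eq_right hs0] using this
    refine ⟨?_, ?_, ?_, ?_, ?_⟩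
    · rw [max_eq_right hs0, mul_zero, add_zero]; positivity
    · rw [max_eq_right hs0, mul_zero, add_zero, inv_mul_le_iff₀ hκ]; linarith
    · exact ContinuousAt.comp (f := fun z => (z, s)) hcont (by fun_prop)
    · exact ContinuousAt.comp (f := fun s => (x, s)) hcont (by fun_prop)
    · intro ε hε
      filter_upwards [Metric.continuousAt_iff'.1 hcont ε hε] with p hp _
      rwa [Real.dist_eq] at hp
  · rw [norm_smul, norm_inv, Real.norm_eq_abs, abs_of_pos hR, inv_mul_le_iff₀ hR]; linarith
  · rw [smul_smul, mul_inv_cancel₀ hR.ne', one_smul, add_sub_cancel, inv_mul_le_iff₀ hκ,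
      max_eq_left (by norm_num), mul_comm (R ^ 2), mul_one]
    exact huz

lemma HasDerivAt.nonpos_of_left {f : ℝ → ℝ} {d t a : ℝ} (h : HasDerivAt f d t) (ha : a < t)
    (hf : ∀ s, a ≤ s → s < t → f t ≤ f s) : d ≤ 0 := by
  have h1 := (hasDerivAt_iff_tendsto_slope.1 h).mono_left
    (nhdsWithin_mono t (show Set.Iio t ⊆ {t}ᶜ from fun s hs => ne_of_lt hs))
  refine le_of_tendsto h1 ?_
  filter_upwards [Ioo_mem_nhdsLT ha] with s hs
  rw [slope_def_field]
  have := hf s hs.1.le hs.2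
  exact div_nonpos_of_nonneg_of_nonpos (by linarith) (by linarith [hs.2])

/-- At the first time a function reaches a given negative level, it has a spatial minimum. -/
lemma exists_first_contact {n : ℕ} {v : Euc n → ℝ → ℝ} {T : ℝ} (hT : 0 < T)
    (hrl : ∀ x t, ‖x‖ ≤ 1 → 0 ≤ t → t < T → RLsc v x t)
    (hct : ∀ x t, ‖x‖ ≤ 1 → 0 < t → t ≤ T → ContinuousAt (v x) t)
    (hbot : ∀ x, ‖x‖ ≤ 1 → 0 ≤ v x 0)
    (hside : ∀ x t, ‖x‖ = 1 → 0 ≤ t → t ≤ T → 0 ≤ v x t) (hv : v 0 T < 0) :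
    ∃ x t, ‖x‖ < 1 ∧ 0 < t ∧ t ≤ T ∧ IsLocalMin (fun y => v y t) x ∧
      ∀ s, 0 ≤ s → s < t → v x t ≤ v x s := by
  set ε := -v 0 T with hε
  set A : Set ℝ := {t | 0 ≤ t ∧ t ≤ T ∧ ∃ x : Euc n, ‖x‖ ≤ 1 ∧ v x t ≤ -ε} with hA
  have hTA : T ∈ A := ⟨hT.le, le_rfl, 0, by simp, by linarith⟩
  have hbdd : BddBelow A := ⟨0, fun t ht => ht.1⟩
  set t := sInf A with ht
  have ht0 : 0 ≤ t := le_csInf ⟨T, hTA⟩ fun s hs => hs.1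
  have htT : t ≤ T := csInf_le hbdd hTA
  have htA : t ∈ A := by
    rcases htT.eq_or_lt with h | h
    · rw [h]; exact hTA
    · by_contra hnot
      have hgt : ∀ x ∈ Metric.closedBall (0 : Euc n) 1, ∀ᶠ z : ℝ × Euc n in nhds (t, x),
          t ≤ z.1 → -ε < v z.2 z.1 := by
        intro x hx
        rw [mem_closedBall_zero_iff] at hx
        have h1 : -ε < v x t := by
          by_contra! h2
          exact hnot ⟨ht0, htT, x, hx, h2⟩
        have h2 := hrl x t hx ht0 h _ h1
        exact (continuous_swap.tendsto (t, x)).eventually h2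
      have h2 := (isCompact_closedBall (0 : Euc n) 1).eventually_forall_of_forall_eventually
        (P := fun s x => t ≤ s → -ε < v x s) hgt
      obtain ⟨δ, hδ, h3⟩ := Metric.eventually_nhds_iff_ball.1 h2
      obtain ⟨s, hs, hs2⟩ := exists_lt_of_csInf_lt ⟨T, hTA⟩ (show sInf A < t + δ by linarith)
      have hts : t ≤ s := csInf_le hbdd hs
      obtain ⟨-, -, x, hx, hvx⟩ := hs
      have := h3 s (by rw [Metric.mem_ball, Real.dist_eq, abs_of_nonneg (by linarith)]; linarith) x
        (by rwa [mem_closedBall_zero_iff]) hts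
      linarith
  obtain ⟨-, -, x, hx, hvx⟩ := htA
  have htpos : 0 < t := by
    rcases ht0.eq_or_lt with h | h
    · have := hbot x hx
      rw [h] at this
      linarith
    · exact h
  have hbefore : ∀ s, 0 ≤ s → s < t → ∀ y : Euc n, ‖y‖ ≤ 1 → -ε < v y s := by
    intro s hs hst y hy
    by_contra! h
    exact absurd (csInf_le hbdd (show s ∈ A from ⟨hs, by linarith, y, hy, h⟩)) (not_le.2 hst)
  have hat : ∀ y : Euc n, ‖y‖ ≤ 1 → -ε ≤ v y t := by
    intro y hy
    have h1 : Filter.Tendsto (v y) (nhdsWithin t (Set.Iio t)) (nhds (v y t)) :=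
      (hct y t hy htpos htT).tendsto.mono_left nhdsWithin_le_nhds
    refine ge_of_tendsto h1 ?_
    filter_upwards [Ioo_mem_nhdsLT htpos] with s hs
    exact (hbefore s hs.1.le hs.2 y hy).le
  have hx1 : ‖x‖ < 1 := by
    refine lt_of_le_of_ne hx fun h => ?_
    have := hside x t h ht0 htT
    linarith
  refine ⟨x, t, hx1, htpos, htT, ?_, fun s hs hst => by
    have := hbefore s hs hst x hx
    linarith⟩
  filter_upwards [Metric.isOpen_ball.mem_nhds (show x ∈ Metric.ball (0 : Euc n) 1 by
    rwa [mem_ball_zero_iff])] with y hy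
  rw [mem_ball_zero_iff] at hy
  have := hat y hy.le
  linarith

/-- Comparison with an exponentially decaying bump, unit scale. -/
lemma exists_bump_lower_bound (n : ℕ) {lam Lam : ℝ} (hlam : 0 < lam) (hLam : lam ≤ Lam) :
    ∃ c > (0 : ℝ), ∀ (w : Euc n → ℝ → ℝ) (T V : ℝ), 0 < T → T ≤ 6 → 0 < V →
      (∀ x t, ‖x‖ ≤ 1 → 0 ≤ t → t ≤ T → 0 ≤ w x t ∧ (t < T → RLsc w x t) ∧
        (0 < t → SuperAt lam Lam w x t)) →
      (∀ x, ‖x‖ ≤ 1 → V ≤ w x 0) → c * V ≤ w 0 T := by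
  set b := 24 * lam + 6 * Lam * n with hb
  set q := b ^ 2 / (48 * lam) with hq
  have hq0 : 0 ≤ q := by positivity
  have hb0 : 0 < b := by have : 0 < Lam := hlam.trans_le hLam
                         positivity
  refine ⟨Real.exp (-(6 * q)), Real.exp_pos _, ?_⟩
  intro w T V hT hT6 hV hw hbot
  set φ : Euc n → ℝ → ℝ := fun x t => V * Real.exp (-(q * t)) * (1 - ‖x‖ ^ 2) ^ 3 with hφ
  have hφc : Continuous fun p : Euc n × ℝ => φ p.1 p.2 := by
    simp only [hφ]; fun_prop
  suffices h : 0 ≤ w 0 T - φ 0 T by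
    have h2 : φ 0 T = V * Real.exp (-(q * T)) := by simp [hφ]
    have h3 : Real.exp (-(6 * q)) ≤ Real.exp (-(q * T)) := Real.exp_le_exp.2 (by nlinarith)
    nlinarith
  by_contra! hneg
  have hctw : ∀ x t, ‖x‖ ≤ 1 → 0 < t → t ≤ T → ContinuousAt (w x) t := fun x t hx ht htT =>
    ((hw x t hx ht.le htT).2.2 ht).2.choose_spec.1.continuousAt
  obtain ⟨x, t, hx, ht, htT, hmin, hleft⟩ := exists_first_contact (v := fun x t => w x t - φ x t) hT
    (fun x t hx h0 h1 => RLsc.sub_continuousAt ((hw x t hx h0 h1.le).2.1 h1) hφc.continuousAt)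
    (fun x t hx h0 h1 => (hctw x t hx h0 h1).sub
      (ContinuousAt.comp (g := fun p : Euc n × ℝ => φ p.1 p.2) (f := fun s => (x, s))
        hφc.continuousAt (by fun_prop)))
    (fun x hx => by
      have h1 := hbot x hx
      have h2 : φ x 0 = V * (1 - ‖x‖ ^ 2) ^ 3 := by simp [hφ]
      have h3 : (1 - ‖x‖ ^ 2) ^ 3 ≤ 1 := pow_le_one₀ (by nlinarith [norm_nonneg x])
        (by nlinarith [norm_nonneg x])
      rw [h2]; nlinarith)
    (fun x t hx h0 h1 => by
      have h2 : φ x t = 0 := by simp [hφ, hx]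
      rw [h2, sub_zero]
      exact (hw x t hx.le h0 h1).1) hneg
  obtain ⟨h1, d, hd, l, hl, he⟩ := (hw x t hx.le ht.le htT).2.2 ht
  set P := 1 - ‖x‖ ^ 2 with hP
  have hP0 : 0 < P := by nlinarith [norm_nonneg x]
  set E := V * Real.exp (-(q * t)) with hE
  have hE0 : 0 < E := by positivity
  have hbump : ContDiffAt ℝ 2 (fun y : Euc n => (1 - ‖y‖ ^ 2) ^ 3) x := by
    have := contDiff_barrier (0 : Euc n) 1
    simp only [sub_zero] at this
    exact this.contDiffAt
  have hφC : ContDiffAt ℝ 2 (fun y : Euc n => -E * (1 - ‖y‖ ^ 2) ^ 3) x :=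
    contDiffAt_const.mul hbump
  have hvh : (fun y => w y t - φ y t) = fun y => w y t + -E * (1 - ‖y‖ ^ 2) ^ 3 := by
    funext y; simp only [hφ, hE]; ring
  rw [hvh] at hmin
  have hpsd := psd_hess_of_isLocalMin (h1.add hφC) hmin
  rw [hess_add h1 hφC, hess_const_mul hbump, hess_barrier] at hpsd
  have hl1 := (hl _ hpsd).1
  have htr := hpsd.trc_nonneg
  rw [map_add, map_smul, map_add, map_smul, map_smul] at hl1
  simp only [smul_eq_mul] at hl1
  have hl2 := (hl _ (psd_rankOneBil x)).1
  have hl3 := (hl _ (psd_innerBil n)).2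
  rw [trc_rankOneBil] at hl2
  rw [trc_innerBil] at hl3
  have hexp : HasDerivAt (fun s => Real.exp (-(q * s))) (Real.exp (-(q * t)) * (-q)) t := by
    have : HasDerivAt (fun s : ℝ => -(q * s)) (-q) t := by
      have h := (hasDerivAt_id t).const_mul (-q)
      simp only [id, mul_one, neg_mul] at h
      exact h
    exact this.exp
  have hdφ : HasDerivAt (φ x) (-q * E * P ^ 3) t := by
    have := (hexp.const_mul V).mul_const (P ^ 3)
    exact this.congr_deriv (by simp only [hE]; ring)
  have hdv := (hd.sub hdφ).nonpos_of_left ht hleft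
  have hX : ‖x‖ ^ 2 = 1 - P := by rw [hP]; ring
  rw [hX] at hl2
  have hquad : 0 < 24 * lam - b * P + q * P ^ 2 := by
    have h48 : q * (48 * lam) = b ^ 2 := by rw [hq]; field_simp
    have h1 : (24 * lam - b * P + q * P ^ 2) * (48 * lam) =
        (b * P - 24 * lam) ^ 2 + 576 * lam ^ 2 := by
      linear_combination P ^ 2 * h48
    have h2 : 0 < (24 * lam - b * P + q * P ^ 2) * (48 * lam) := by rw [h1]; positivity
    exact (pos_iff_pos_of_mul_pos h2).2 (by positivity)
  have hEP : 0 < E * P := by positivity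
  have hA := mul_le_mul_of_nonneg_left hl2 (show 0 ≤ E * (24 * P) by positivity)
  have hB := mul_le_mul_of_nonneg_left hl3 (show 0 ≤ E * (6 * P ^ 2) by positivity)
  have hfin := mul_pos hEP hquad
  have hlt : 0 ≤ lam * trc (hess (fun y => w y t) x + -E • ((24 * P) • rankOneBil x +
    (-(6 * P ^ 2)) • innerBil n)) := by positivity
  rw [hb] at hfin
  nlinarith

/-- Lower bound for positive supersolutions with constant `c`, at arbitrary scale. -/
def BumpBound (n : ℕ) (lam Lam c : ℝ) : Prop :=
  ∀ (w : Euc n → ℝ → ℝ) (y : Euc n) (a d s V : ℝ), 0 < d → a < s → s - a ≤ 6 * d ^ 2 → 0 < V →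
    (∀ x τ, ‖x - y‖ ≤ d → a ≤ τ → τ ≤ s → 0 ≤ w x τ ∧ (τ < s → RLsc w x τ) ∧
      (a < τ → SuperAt lam Lam w x τ)) →
    (∀ x, ‖x - y‖ ≤ d → V ≤ w x a) → c * V ≤ w y s

lemma exists_bumpBound (n : ℕ) {lam Lam : ℝ} (hlam : 0 < lam) (hLam : lam ≤ Lam) :
    ∃ c > (0 : ℝ), BumpBound n lam Lam c := by
  obtain ⟨c, hc, h⟩ := exists_bump_lower_bound n hlam hLam
  refine ⟨c, hc, ?_⟩
  intro w y a d s V hd has hs hV hw hbot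
  have hd2 : 0 < d ^ 2 := by positivity
  have hT : d ^ 2 * ((d ^ 2)⁻¹ * (s - a)) = s - a := mul_inv_cancel_left₀ hd2.ne' _
  have hdom : ∀ (z : Euc n), ‖z‖ ≤ 1 → ‖y + d • z - y‖ ≤ d := by
    intro z hz
    rw [norm_scale_sub hd]
    nlinarith
  have hpos : 0 < (d ^ 2)⁻¹ * (s - a) := by
    have : 0 < s - a := by linarith
    positivity
  have key := h (fun z τ => w (y + d • z) (a + d ^ 2 * τ)) ((d ^ 2)⁻¹ * (s - a)) V hpos
    (by rw [inv_mul_le_iff₀ hd2]; linarith) hV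
    (by
      intro z τ hz h0 h1
      have h2 := mul_le_mul_of_nonneg_left h1 hd2.le
      rw [hT] at h2
      have h3 : 0 ≤ d ^ 2 * τ := by positivity
      obtain ⟨k1, k2, k3⟩ := hw (y + d • z) (a + d ^ 2 * τ) (hdom z hz) (by linarith) (by linarith)
      refine ⟨k1, fun hlt => ?_, fun hlt => ?_⟩
      · have h4 := mul_lt_mul_of_pos_left hlt hd2
        rw [hT] at h4
        exact RLsc.scale (k2 (by linarith))
      · exact SuperAt.scale (k3 (by have := mul_pos hd2 hlt; linarith)))
    (by
      intro z hz
      simp only [mul_zero, add_zero]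
      exact hbot _ (hdom z hz))
  simp only [smul_zero, add_zero] at key
  rw [hT, add_sub_cancel] at key
  exact key

lemma exists_harnack (n : ℕ) {lam Lam : ℝ} (hlam : 0 < lam) (hLam : lam ≤ Lam) :
    ∃ C > (1 : ℝ), HarnackInterior n lam Lam C ∧ HarnackBottom n lam Lam C := by
  obtain ⟨C, hC, h⟩ := exists_harnack_unit n hlam hLam
  exact ⟨C, hC, harnackInterior_of_unit h, harnackBottom_of_unit h⟩

lemma exists_gap {T : Set ℝ} (hT : IsClosed T) {t0 s e : ℝ} (h0 : t0 ∈ T) (hs : t0 ≤ s)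
    (hse : s < e) : s ∈ T ∨ ∃ a b, t0 ≤ a ∧ a < s ∧ s < b ∧ b ≤ e ∧ a ∈ T ∧ (b ∈ T ∨ b = e) ∧
      ∀ σ, a < σ → σ < b → σ ∉ T := by
  by_cases hsT : s ∈ T
  · exact Or.inl hsT
  right
  obtain ⟨a, ⟨haT, ha⟩, hamax⟩ := (isCompact_Icc.inter_left hT).exists_isGreatest
    (s := T ∩ Set.Icc t0 s) ⟨t0, h0, le_rfl, hs⟩
  obtain ⟨b, ⟨hbT, hb⟩, hbmin⟩ := (isCompact_Icc.inter_left
    (hT.union (isClosed_singleton (x := e)))).exists_isLeast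
    (s := (T ∪ {e}) ∩ Set.Icc s e) ⟨e, Or.inr rfl, hse.le, le_rfl⟩
  have has : a < s := lt_of_le_of_ne ha.2 fun h => hsT (h ▸ haT)
  have hsb : s < b := by
    refine lt_of_le_of_ne hb.1 fun h => ?_
    rcases hbT with h1 | h1
    · exact hsT (h ▸ h1)
    · rw [Set.mem_singleton_iff] at h1
      linarith
  refine ⟨a, b, ha.1, has, hsb, hb.2, haT, hbT, fun σ h1 h2 hσ => ?_⟩
  rcases le_total σ s with h3 | h3
  · have : σ ≤ a := hamax ⟨hσ, by linarith [ha.1], h3⟩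
    linarith
  · have : b ≤ σ := hbmin ⟨Or.inl hσ, h3, by linarith [hb.2]⟩
    linarith

/-- A box around `(x0,t0)` in which `v` solves, is forward continuous off the closed set `Z`, and
is Lipschitz along the slices and columns through points of `Z`. -/
structure ZBox {n : ℕ} (lam Lam : ℝ) (v : Euc n → ℝ → ℝ) (Z : Set (Euc n × ℝ)) (x0 : Euc n)
    (t0 ρ k : ℝ) : Prop where
  pos : 0 < ρ
  le_one : ρ ≤ 1
  nonneg : 0 ≤ k
  closed : IsClosed Z
  mem : (x0, t0) ∈ Z
  sol : ∀ x t, ‖x - x0‖ < ρ → |t - t0| < ρ → SolAt lam Lam v x t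
  rc : ∀ x t, ‖x - x0‖ < ρ → |t - t0| < ρ → (x, t) ∉ Z → RightCont v x t
  space : ∀ x t y, ‖x - x0‖ < ρ → |t - t0| < ρ → (x, t) ∈ Z → ‖y - x0‖ < ρ →
    |v y t - v x t| ≤ k * ‖y - x‖
  time : ∀ x t s, ‖x - x0‖ < ρ → |t - t0| < ρ → (x, t) ∈ Z → |s - t0| < ρ →
    |v x s - v x t| ≤ k * |s - t|

namespace ZBox
variable {n : ℕ} {lam Lam : ℝ} {v : Euc n → ℝ → ℝ} {Z : Set (Euc n × ℝ)} {x0 : Euc n}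
  {t0 ρ k : ℝ}

lemma mono (h : ZBox lam Lam v Z x0 t0 ρ k) {ρ' : ℝ} (h0 : 0 < ρ') (h1 : ρ' ≤ ρ) :
    ZBox lam Lam v Z x0 t0 ρ' k where
  pos := h0
  le_one := h1.trans h.le_one
  nonneg := h.nonneg
  closed := h.closed
  mem := h.mem
  sol x t hx ht := h.sol x t (hx.trans_le h1) (ht.trans_le h1)
  rc x t hx ht := h.rc x t (hx.trans_le h1) (ht.trans_le h1)
  space x t y hx ht hz hy := h.space x t y (hx.trans_le h1) (ht.trans_le h1) hz (hy.trans_le h1)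
  time x t y hx ht hz hy := h.time x t y (hx.trans_le h1) (ht.trans_le h1) hz (hy.trans_le h1)

lemma affine (h : ZBox lam Lam v Z x0 t0 ρ k) {c : ℝ} (hc : |c| = 1) (e : ℝ) :
    ZBox lam Lam (fun x t => c * v x t + e) Z x0 t0 ρ k where
  pos := h.pos
  le_one := h.le_one
  nonneg := h.nonneg
  closed := h.closed
  mem := h.mem
  sol x t hx ht := (h.sol x t hx ht).affine c e
  rc x t hx ht hz := (h.rc x t hx ht hz).affine c e
  space x t y hx ht hz hy := by
    have := h.space x t y hx ht hz hy
    rwa [show c * v y t + e - (c * v x t + e) = c * (v y t - v x t) by ring, abs_mul, hc, one_mul]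
  time x t y hx ht hz hy := by
    have := h.time x t y hx ht hz hy
    rwa [show c * v x y + e - (c * v x t + e) = c * (v x y - v x t) by ring, abs_mul, hc, one_mul]

lemma slice (h : ZBox lam Lam v Z x0 t0 ρ k) {x y : Euc n} {t : ℝ} (hx : ‖x - x0‖ < ρ)
    (ht : |t - t0| < ρ) (hz : (x, t) ∈ Z) (hy : ‖y - x0‖ < ρ) :
    |v y t - v x0 t0| ≤ 10 * k * ρ := by
  have hx0 : ‖x0 - x0‖ < ρ := by simpa using h.pos
  have ht0 : |t0 - t0| < ρ := by simpa using h.pos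
  have h1 := h.space x t y hx ht hz hy
  have h2 := h.space x t x0 hx ht hz hx0
  have h3 := h.time x0 t0 t hx0 ht0 h.mem ht
  have hk := h.nonneg
  have h4 : ‖y - x‖ ≤ 2 * ρ := by
    have : y - x = (y - x0) - (x - x0) := by abel
    rw [this]
    exact (norm_sub_le _ _).trans (by linarith)
  have h5 : ‖x0 - x‖ ≤ ρ := by rw [norm_sub_rev]; exact hx.le
  have k1 := mul_le_mul_of_nonneg_left h4 hk
  have k2 := mul_le_mul_of_nonneg_left h5 hk
  have k3 := mul_le_mul_of_nonneg_left ht.le hk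
  have : 0 ≤ k * ρ := mul_nonneg hk h.pos.le
  rw [abs_le] at *
  constructor <;> linarith

lemma column (h : ZBox lam Lam v Z x0 t0 ρ k) {x : Euc n} {t s : ℝ} (hx : ‖x - x0‖ < ρ)
    (ht : |t - t0| < ρ) (hz : (x, t) ∈ Z) (hs : |s - t0| < ρ) :
    |v x s - v x0 t0| ≤ 10 * k * ρ := by
  have hx0 : ‖x0 - x0‖ < ρ := by simpa using h.pos
  have ht0 : |t0 - t0| < ρ := by simpa using h.pos
  have h1 := h.time x t s hx ht hz hs
  have h2 := h.space x t x0 hx ht hz hx0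
  have h3 := h.time x0 t0 t hx0 ht0 h.mem ht
  have hk := h.nonneg
  have h4 : |s - t| ≤ 2 * ρ := by
    rw [abs_le]
    rw [abs_lt] at hs ht
    constructor <;> linarith
  have h5 : ‖x0 - x‖ ≤ ρ := by rw [norm_sub_rev]; exact hx.le
  have k1 := mul_le_mul_of_nonneg_left h4 hk
  have k2 := mul_le_mul_of_nonneg_left h5 hk
  have k3 := mul_le_mul_of_nonneg_left ht.le hk
  have : 0 ≤ k * ρ := mul_nonneg hk h.pos.le
  rw [abs_le] at *
  constructor <;> linarith

/-- A time is either a time of `Z` or lies in a gap between times of `Z`. -/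
lemma gap (h : ZBox lam Lam v Z x0 t0 ρ k) {s τ : ℝ} (hτ : τ < ρ) (hs : t0 ≤ s)
    (hsτ : s < t0 + τ) :
    (∃ x, ‖x - x0‖ < ρ ∧ (x, s) ∈ Z) ∨
    ∃ a b, t0 ≤ a ∧ a < s ∧ s < b ∧ b ≤ t0 + τ ∧ (∃ x, ‖x - x0‖ < ρ ∧ (x, a) ∈ Z) ∧
      ((∃ x, ‖x - x0‖ < ρ ∧ (x, b) ∈ Z) ∨ b = t0 + τ) ∧
      ∀ x σ, ‖x - x0‖ < 3 / 4 * ρ → a < σ → σ < b → RightCont v x σ := by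
  have hρ := h.pos
  set T : Set ℝ := Prod.snd '' (Z ∩ (Metric.closedBall x0 (3 / 4 * ρ) ×ˢ Set.Icc t0 (t0 + τ)))
    with hT
  have hTc : IsClosed T := by
    refine IsCompact.isClosed (IsCompact.image ?_ continuous_snd)
    exact ((isCompact_closedBall x0 _).prod isCompact_Icc).inter_left h.closed
  have hmem : ∀ σ ∈ T, ∃ x, ‖x - x0‖ < ρ ∧ (x, σ) ∈ Z := by
    rintro σ ⟨⟨x, σ'⟩, ⟨h1, h2, -⟩, rfl⟩
    simp only [Metric.mem_closedBall, dist_eq_norm] at h2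
    exact ⟨x, by linarith, h1⟩
  have h0 : t0 ∈ T := ⟨(x0, t0), ⟨h.mem, Metric.mem_closedBall_self (by linarith), le_rfl,
    by simp only; linarith⟩, rfl⟩
  rcases exists_gap hTc h0 hs hsτ with h1 | ⟨a, b, h1, h2, h3, h4, h5, h6, h7⟩
  · exact Or.inl (hmem s h1)
  · refine Or.inr ⟨a, b, h1, h2, h3, h4, hmem a h5, h6.imp (hmem b) id, ?_⟩
    intro x σ hx h8 h9
    refine h.rc x σ (by linarith) (by rw [abs_of_nonneg (by linarith)]; linarith) fun hz => ?_
    refine h7 σ h8 h9 ⟨(x, σ), ⟨hz, ?_, ?_, ?_⟩, rfl⟩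
    · rw [Metric.mem_closedBall, dist_eq_norm]; exact hx.le
    · simp only; linarith
    · simp only; linarith

lemma exists_sq {X : ℝ} (hX : 0 < X) : ∃ r > (0 : ℝ), r ^ 2 = X :=
  ⟨√X, Real.sqrt_pos.2 hX, Real.sq_sqrt hX.le⟩

lemma norm_sub_lt {x y : Euc n} {a b c : ℝ} (hx : ‖x - y‖ < a) (hy : ‖y - x0‖ ≤ b)
    (h : a + b ≤ c) : ‖x - x0‖ < c := by
  have : x - x0 = (x - y) + (y - x0) := by abel
  rw [this]
  exact (norm_add_le _ _).trans_lt (by linarith)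

/-- Lower bound in a box. -/
lemma lower_bound (h : ZBox lam Lam v Z x0 t0 ρ k) {C c V : ℝ} (hC : 1 < C)
    (hH : HarnackInterior n lam Lam C) (hB : BumpBound n lam Lam c) (hV : 0 < V)
    (hv : ∀ x t, ‖x - x0‖ < ρ → t0 ≤ t → t < t0 + ρ → 0 ≤ v x t)
    (hV0 : V + 10 * k * ρ ≤ v x0 t0) {y : Euc n} {s : ℝ} (hy : ‖y - x0‖ ≤ ρ / 2)
    (hs : t0 ≤ s) (hs2 : s < t0 + (ρ / 20) ^ 2) :
    min c (1 / (2 * C)) * V ≤ v y s := by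
  have hρ := h.pos
  have hρ1 := h.le_one
  have hcV : min c (1 / (2 * C)) * V ≤ c * V := mul_le_mul_of_nonneg_right (min_le_left _ _) hV.le
  have hCV : min c (1 / (2 * C)) * V ≤ V / (2 * C) := by
    have := mul_le_mul_of_nonneg_right (min_le_right c (1 / (2 * C))) hV.le
    rwa [one_div_mul_eq_div] at this
  have hCV2 : V / (2 * C) ≤ V := div_le_self hV.le (by linarith)
  have hτ : (ρ / 20) ^ 2 < ρ := by nlinarith
  rcases h.gap hτ hs hs2 with ⟨x, hx, hz⟩ | ⟨a, b, h1, h2, h3, h4, ⟨x, hx, hz⟩, -, hrc⟩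
  · have := h.slice hx (by rw [abs_of_nonneg (by linarith)]; linarith) hz
      (show ‖y - x0‖ < ρ by linarith)
    rw [abs_le] at this
    linarith
  have habs : ∀ σ, t0 ≤ σ → σ ≤ t0 + (ρ / 20) ^ 2 → |σ - t0| < ρ := fun σ h5 h6 => by
    rw [abs_of_nonneg (by linarith)]; linarith
  obtain ⟨r, hr, hr2⟩ := exists_sq (show 0 < (s - a) / 21 by linarith)
  have hrρ : r ≤ ρ / 80 := by
    by_contra! hcon
    nlinarith
  by_cases hF : ∃ y', ‖y' - y‖ ≤ 2 * r ∧ (y', a) ∈ Z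
  · obtain ⟨y', hy', hz'⟩ := hF
    have hy0 : ‖y' - x0‖ < ρ * (11 / 20) :=
      norm_sub_lt (a := ρ / 30) (by linarith) hy (by linarith)
    have hcol := h.column (s := a + r ^ 2) (show ‖y' - x0‖ < ρ by linarith)
      (habs a h1 (by linarith)) hz' (habs _ (by nlinarith) (by nlinarith))
    rw [abs_le] at hcol
    by_contra! hcon
    have hκ : 0 < V / (2 * C) := by positivity
    have := hH v y' y (a + r ^ 2) r (V / (2 * C)) hr hκ
      (by
        intro x σ h5 h6 h7
        have h8 : ‖x - x0‖ < 3 / 4 * ρ := norm_sub_lt h5 hy0.le (by linarith)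
        have h9 : a < σ := by nlinarith
        have h10 : σ ≤ s := by linarith
        refine ⟨hv x σ (by linarith) (by linarith) (by linarith),
          h.sol x σ (by linarith) (habs _ (by linarith) (by linarith)), fun h11 => ?_⟩
        exact hrc x σ h8 h9 (by linarith))
      (by rw [norm_sub_rev]; exact hy')
      (by rw [show a + r ^ 2 + 20 * r ^ 2 = s by linarith]; linarith)
    rw [show C * (V / (2 * C)) = V / 2 by field_simp] at this
    linarith
  · push Not at hF
    refine hcV.trans ?_
    obtain ⟨d, hd, hd2⟩ := exists_sq (show 0 < (s - a) / 6 by linarith)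
    have hdr : d < 2 * r := by
      by_contra! hcon
      nlinarith
    have hsub : ∀ x, ‖x - y‖ ≤ d → ‖x - x0‖ < 3 / 4 * ρ := fun x hx =>
      norm_sub_lt (hx.trans_lt hdr) hy (by linarith)
    refine hB v y a d s V hd h2 (by linarith) hV ?_ ?_
    · intro x' σ h5 h6 h7
      have h8 := hsub x' h5
      refine ⟨hv x' σ (by linarith) (by linarith) (by linarith), fun h9 => ?_, fun _ =>
        (h.sol x' σ (by linarith) (habs _ (by linarith) (by linarith))).superAt⟩
      rcases h6.eq_or_lt with h10 | h10
      · rw [← h10]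
        exact (h.rc x' a (by linarith) (habs _ h1 (by linarith)) fun hz'' =>
          hF x' (by linarith) hz'').rlsc
      · exact (hrc x' σ h8 h10 (by linarith)).rlsc
    · intro x' hx'
      have := h.slice hx (habs a h1 (by linarith)) hz (show ‖x' - x0‖ < ρ by
        have := hsub x' hx'
        linarith)
      rw [abs_le] at this
      linarith

set_option maxHeartbeats 800000 in
/-- Upper bound in a box. -/
lemma upper_bound (h : ZBox lam Lam v Z x0 t0 ρ k) {C κ : ℝ} (hC : 1 < C)
    (hH : HarnackInterior n lam Lam C) (hB : HarnackBottom n lam Lam C) (hκ : 0 < κ)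
    (hv : ∀ x t, ‖x - x0‖ < ρ → t0 ≤ t → t < t0 + ρ → 0 ≤ v x t)
    (hκ0 : v x0 t0 + 10 * k * ρ ≤ κ) {y : Euc n} {s : ℝ} (hy : ‖y - x0‖ ≤ ρ / 100)
    (hs : t0 ≤ s) (hs2 : s < t0 + (ρ / 20) ^ 2 / 2) :
    v y s ≤ C * κ := by
  have hρ := h.pos
  have hρ1 := h.le_one
  have hτ : (ρ / 20) ^ 2 < ρ := by nlinarith
  have hτ0 : 0 < (ρ / 20) ^ 2 := by positivity
  have habs : ∀ σ, t0 ≤ σ → σ ≤ t0 + (ρ / 20) ^ 2 → |σ - t0| < ρ := fun σ h5 h6 => by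
    rw [abs_of_nonneg (by linarith)]; linarith
  have hslice : ∀ x σ y', ‖x - x0‖ < ρ → t0 ≤ σ → σ ≤ t0 + (ρ / 20) ^ 2 → (x, σ) ∈ Z →
      ‖y' - x0‖ < ρ → v y' σ ≤ κ := by
    intro x σ y' hx h1 h2 hz hy'
    have := (abs_le.1 (h.slice hx (habs σ h1 h2) hz hy')).2
    linarith
  rcases h.gap hτ hs (show s < t0 + (ρ / 20) ^ 2 by linarith) with
    ⟨x, hx, hz⟩ | ⟨a, b, h1, h2, h3, h4, ⟨x, hx, hz⟩, hb, hrc⟩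
  · have := hslice x s y hx hs (by linarith) hz (by linarith)
    nlinarith
  obtain ⟨z, hzy, hzb⟩ : ∃ z, (‖z - y‖ ^ 2 ≤ (b - s) / 6) ∧ v z b ≤ κ := by
    rcases hb with ⟨x', hx', hz'⟩ | hb
    · refine ⟨y, by simp; linarith, hslice x' b y hx' (by linarith) h4 hz' (by linarith)⟩
    · refine ⟨x0, ?_, ?_⟩
      · rw [norm_sub_rev]
        nlinarith [norm_nonneg (y - x0)]
      · have := (abs_le.1 (h.column (s := b) (x := x0) (t := t0) (by simpa using hρ)
          (by simpa using hρ) h.mem (habs b (by linarith) h4))).2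
        linarith
  have hbox : ∀ x σ, ‖x - x0‖ < 3 / 4 * ρ → a < σ → σ ≤ b →
      0 ≤ v x σ ∧ SolAt lam Lam v x σ ∧ (σ < b → RightCont v x σ) := by
    intro x σ h5 h6 h7
    exact ⟨hv x σ (by linarith) (by linarith) (by linarith),
      h.sol x σ (by linarith) (habs _ (by linarith) (by linarith)), hrc x σ h5 h6⟩
  rcases le_or_gt (b - s) (40 * (s - a)) with hcase | hcase
  · obtain ⟨r, hr, hr2⟩ := exists_sq (show 0 < (b - s) / 20 by linarith)
    have hrρ : r ≤ ρ / 80 := by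
      by_contra! hcon
      nlinarith
    refine hH v y z s r κ hr hκ ?_ ?_ ?_
    · intro x σ h5 h6 h7
      obtain ⟨k1, k2, k3⟩ := hbox x σ (norm_sub_lt h5 hy (by linarith)) (by linarith) (by linarith)
      exact ⟨k1, k2, fun h8 => k3 (by linarith)⟩
    · by_contra! hcon
      nlinarith
    · rw [show s + 20 * r ^ 2 = b by linarith]
      exact hzb
  obtain ⟨r, hr, hr2⟩ := exists_sq (show 0 < 2 * (s - a) by linarith)
  have hrρ : r ≤ ρ / 80 := by
    by_contra! hcon
    nlinarith
  by_cases hF : ∃ y', ‖y' - y‖ ≤ 2 * r ∧ (y', a) ∈ Z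
  · obtain ⟨y', hy', hz'⟩ := hF
    have hy0 : ‖y' - x0‖ < ρ * (11 / 20) :=
      norm_sub_lt (a := ρ / 30) (by linarith) hy (by linarith)
    have hcol := h.column (s := s + 20 * r ^ 2) (show ‖y' - x0‖ < ρ by linarith)
      (habs a h1 (by linarith)) hz' (habs _ (by nlinarith) (by nlinarith))
    refine hH v y y' s r κ hr hκ ?_ hy' (by linarith [(abs_le.1 hcol).2])
    intro x σ h5 h6 h7
    obtain ⟨k1, k2, k3⟩ := hbox x σ (norm_sub_lt h5 hy (by linarith)) (by linarith) (by linarith)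
    exact ⟨k1, k2, fun h8 => k3 (by linarith)⟩
  push Not at hF
  have hbottom : ∀ R, R ≤ ρ / 80 → (∀ x, ‖x - y‖ < R → (x, a) ∉ Z) → ∀ x, ‖x - y‖ < R →
      0 ≤ v x a ∧ v x a ≤ κ ∧ RightCont v x a := by
    intro R hR hR2 x' hx'
    have h5 : ‖x' - x0‖ < 3 / 4 * ρ := norm_sub_lt hx' hy (by linarith)
    exact ⟨hv x' a (by linarith) h1 (by linarith),
      hslice x a x' hx h1 (by linarith) hz (by linarith),
      h.rc x' a (by linarith) (habs a h1 (by linarith)) (hR2 x' hx')⟩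
  obtain ⟨R, hR, hR2⟩ := exists_sq (show 0 < (b - a) / (41 / 2) by
    have : 0 < b - a := by linarith
    positivity)
  rw [eq_div_iff (by norm_num)] at hR2
  have hRρ : R ≤ ρ / 80 := by
    by_contra! hcon
    nlinarith
  by_cases hFR : ∃ y', ‖y' - y‖ < R ∧ (y', a) ∈ Z
  · obtain ⟨y₁, hy₁, hz₁⟩ := hFR
    set F : Set (Euc n) := {x | (x, a) ∈ Z} with hFdef
    have hFne : F.Nonempty := ⟨y₁, hz₁⟩
    have hd1 : Metric.infDist y F < R :=
      (Metric.infDist_le_dist_of_mem (x := y) (y := y₁) (s := F) hz₁).trans_lt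
        (by rwa [dist_comm, dist_eq_norm])
    have hd2 : 2 * r ≤ Metric.infDist y F := by
      rw [Metric.le_infDist hFne]
      intro x' hx'
      rw [dist_comm, dist_eq_norm]
      by_contra! hcon
      exact hF x' hcon.le hx'
    obtain ⟨y', hy', hyd⟩ := (Metric.infDist_lt_iff hFne).1
      (show Metric.infDist y F < 2 * Metric.infDist y F by linarith)
    rw [dist_comm, dist_eq_norm] at hyd
    have hFd : ∀ x', ‖x' - y‖ < Metric.infDist y F → (x', a) ∉ Z := by
      intro x' hx' hzx
      have := Metric.infDist_le_dist_of_mem (x := y) (y := x') (s := F) hzx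
      rw [dist_comm, dist_eq_norm] at this
      linarith
    generalize Metric.infDist y F = d at hd1 hd2 hyd hFd
    have hd0 : 0 < d := by linarith
    have hdR : d ^ 2 < R ^ 2 := by nlinarith
    have hy0 : ‖y' - x0‖ < ρ := norm_sub_lt hyd hy (by linarith)
    have hcol := h.column (s := a + 41 / 2 * d ^ 2) hy0 (habs a h1 (by linarith)) hy'
      (habs _ (by nlinarith) (by nlinarith))
    refine hB v y y' a d κ hd0 hκ ?_ (hbottom d (by linarith) hFd) hyd.le
      (by linarith [(abs_le.1 hcol).2]) s h2.le (by nlinarith)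
    intro x' σ h5 h6 h7
    obtain ⟨k1, k2, k3⟩ := hbox x' σ (norm_sub_lt h5 hy (by linarith)) (by linarith) (by linarith)
    exact ⟨k1, k2, fun h8 => k3 (by linarith)⟩
  · push Not at hFR
    refine hB v y z a R κ hR hκ ?_ (hbottom R hRρ hFR) ?_
      (by rw [show a + 41 / 2 * R ^ 2 = b by linarith]; exact hzb) s h2.le (by linarith)
    · intro x' σ h5 h6 h7
      obtain ⟨k1, k2, k3⟩ := hbox x' σ (norm_sub_lt h5 hy (by linarith)) (by linarith) (by linarith)
      exact ⟨k1, k2, fun h8 => k3 (by linarith)⟩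
    · by_contra! hcon
      nlinarith

end ZBox

lemma eventually_right_iff {n : ℕ} {x0 : Euc n} {t0 : ℝ} {P : Euc n → ℝ → Prop} :
    (∀ᶠ p : Euc n × ℝ in nhds (x0, t0), t0 ≤ p.2 → P p.1 p.2) ↔
      ∃ δ > (0 : ℝ), ∀ x t, ‖x - x0‖ < δ → t0 ≤ t → t < t0 + δ → P x t := by
  rw [Metric.eventually_nhds_iff_ball]
  constructor
  · rintro ⟨δ, hδ, h⟩
    refine ⟨δ, hδ, fun x t hx ht0 ht => h (x, t) ?_ ht0⟩
    rw [← ball_prod_same]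
    refine ⟨by rwa [Metric.mem_ball, dist_eq_norm], ?_⟩
    rw [Metric.mem_ball, Real.dist_eq, abs_of_nonneg (by simp only; linarith)]
    simp only; linarith
  · rintro ⟨δ, hδ, h⟩
    refine ⟨δ, hδ, fun p hp ht0 => ?_⟩
    rw [← ball_prod_same] at hp
    obtain ⟨h1, h2⟩ := hp
    rw [Metric.mem_ball, dist_eq_norm] at h1
    rw [Metric.mem_ball, Real.dist_eq] at h2
    exact h _ _ h1 ht0 (by linarith [(abs_lt.1 h2).2])

namespace ZBox
variable {n : ℕ} {lam Lam : ℝ} {v : Euc n → ℝ → ℝ} {Z : Set (Euc n × ℝ)} {x0 : Euc n}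
  {t0 ρ k : ℝ}

/-- Improvement of a one-sided oscillation bound. -/
lemma lower_improve (h : ZBox lam Lam v Z x0 t0 ρ k) {C c θ : ℝ} (hC : 1 < C)
    (hH : HarnackInterior n lam Lam C) (hB : BumpBound n lam Lam c) (hθ : 0 < θ)
    (hv : ∀ᶠ p : Euc n × ℝ in nhds (x0, t0), t0 ≤ p.2 → v x0 t0 - θ ≤ v p.1 p.2) :
    ∀ᶠ p : Euc n × ℝ in nhds (x0, t0), t0 ≤ p.2 →
      v x0 t0 - (1 - min c (1 / (2 * C)) / 2) * θ ≤ v p.1 p.2 := by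
  obtain ⟨δ, hδ, hv⟩ := (eventually_right_iff (P := fun x t => v x0 t0 - θ ≤ v x t)).1 hv
  have hk := h.nonneg
  set ρ' := min (min ρ δ) (θ / (20 * (k + 1))) with hρ'
  have hρ0 : 0 < ρ' := lt_min (lt_min h.pos hδ) (by positivity)
  have hρρ : ρ' ≤ ρ := (min_le_left _ _).trans (min_le_left _ _)
  have hρδ : ρ' ≤ δ := (min_le_left _ _).trans (min_le_right _ _)
  have hρk : 10 * k * ρ' ≤ θ / 2 := by
    have h1 : ρ' ≤ θ / (20 * (k + 1)) := min_le_right _ _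
    rw [le_div_iff₀ (by positivity)] at h1
    nlinarith
  have hbox := (h.mono hρ0 hρρ).affine (c := 1) (by simp) (θ - v x0 t0)
  refine (eventually_right_iff
    (P := fun x t => v x0 t0 - (1 - min c (1 / (2 * C)) / 2) * θ ≤ v x t)).2
    ⟨min (ρ' / 2) ((ρ' / 20) ^ 2), by positivity, fun y s hy hs hs2 => ?_⟩
  have := hbox.lower_bound hC hH hB (show 0 < θ / 2 by linarith)
    (fun x t hx h0 h1 => by
      have := hv x t (by linarith) h0 (by linarith)
      linarith) (by linarith) (y := y) (s := s) (hy.le.trans (min_le_left _ _)) hs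
    (by linarith [min_le_right (ρ' / 2) ((ρ' / 20) ^ 2)])
  linarith

lemma lower_semicontinuous (h : ZBox lam Lam v Z x0 t0 ρ k) {C c θ : ℝ} (hC : 1 < C) (hc : 0 < c)
    (hH : HarnackInterior n lam Lam C) (hB : BumpBound n lam Lam c) (hθ : 0 < θ)
    (hv : ∀ᶠ p : Euc n × ℝ in nhds (x0, t0), t0 ≤ p.2 → v x0 t0 - θ ≤ v p.1 p.2)
    {ε : ℝ} (hε : 0 < ε) :
    ∀ᶠ p : Euc n × ℝ in nhds (x0, t0), t0 ≤ p.2 → v x0 t0 - ε < v p.1 p.2 := by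
  set q := 1 - min c (1 / (2 * C)) / 2 with hq
  have hC' : 1 / (2 * C) ≤ 1 := by rw [div_le_one (by linarith)]; linarith
  have hmin : 0 < min c (1 / (2 * C)) := lt_min hc (by positivity)
  have hmin1 : min c (1 / (2 * C)) ≤ 1 := (min_le_right _ _).trans hC'
  have hq0 : 0 < q := by linarith
  have hq1 : q < 1 := by linarith
  have hj : ∀ j : ℕ, ∀ᶠ p : Euc n × ℝ in nhds (x0, t0), t0 ≤ p.2 →
      v x0 t0 - q ^ j * θ ≤ v p.1 p.2 := by
    intro j
    induction j with
    | zero => simpa using hv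
    | succ j ih =>
      have := h.lower_improve hC hH hB (show 0 < q ^ j * θ by positivity) ih
      filter_upwards [this] with p hp ht
      have h2 := hp ht
      rw [← hq, ← mul_assoc, ← pow_succ'] at h2
      exact h2
  obtain ⟨j, hj2⟩ := exists_pow_lt_of_lt_one (show 0 < ε / θ by positivity) hq1
  rw [lt_div_iff₀ hθ] at hj2
  filter_upwards [hj j] with p hp ht
  linarith [hp ht]

lemma rightCont (h : ZBox lam Lam v Z x0 t0 ρ k) {C c : ℝ} (hC : 1 < C) (hc : 0 < c)
    (hH : HarnackInterior n lam Lam C) (hB : BumpBound n lam Lam c)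
    (hHB : HarnackBottom n lam Lam C)
    (hv : ∀ x t, ‖x - x0‖ < ρ → t0 ≤ t → t < t0 + ρ → 0 ≤ v x t) : RightCont v x0 t0 := by
  have hρ := h.pos
  have hk := h.nonneg
  have hv0 : 0 ≤ v x0 t0 := hv x0 t0 (by simpa using hρ) le_rfl (by linarith)
  have hlow : ∀ᶠ p : Euc n × ℝ in nhds (x0, t0), t0 ≤ p.2 →
      v x0 t0 - (v x0 t0 + 1) ≤ v p.1 p.2 := by
    refine (eventually_right_iff (P := fun x t => v x0 t0 - (v x0 t0 + 1) ≤ v x t)).2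
      ⟨ρ, hρ, fun x t hx h0 h1 => ?_⟩
    have := hv x t hx h0 h1
    linarith
  set κ := v x0 t0 + 10 * k * ρ + 1 with hκ
  have hκ0 : 0 < κ := by positivity
  have hup : ∀ᶠ p : Euc n × ℝ in nhds (x0, t0), t0 ≤ p.2 →
      (-1 * v x0 t0 + 0) - C * κ ≤ -1 * v p.1 p.2 + 0 := by
    refine (eventually_right_iff (P := fun x t => (-1 * v x0 t0 + 0) - C * κ ≤ -1 * v x t + 0)).2
      ⟨min (ρ / 100) ((ρ / 20) ^ 2 / 2), by positivity, fun x t hx h0 h1 => ?_⟩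
    have := h.upper_bound hC hH hHB hκ0 hv (by linarith) (hx.le.trans (min_le_left _ _)) h0
      (by linarith [min_le_right (ρ / 100) ((ρ / 20) ^ 2 / 2)])
    linarith
  intro ε hε
  filter_upwards [h.lower_semicontinuous hC hc hH hB (by linarith) hlow hε,
    (h.affine (c := -1) (by simp) 0).lower_semicontinuous hC hc hH hB (by positivity) hup hε]
    with p h1 h2 ht
  rw [abs_lt]
  constructor <;> linarith [h1 ht, h2 ht]

end ZBox

/-- Quantitative regularity at `z`: Lipschitz on a slice, pointwise Lipschitz on a column. -/
def LipPoint {n : ℕ} (u : Euc n → ℝ → ℝ) (k ε : ℝ) (z : Euc n × ℝ) : Prop :=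
  (∀ y y', ‖y - z.1‖ < ε → ‖y' - z.1‖ < ε → |u y z.2 - u y' z.2| ≤ k * ‖y - y'‖) ∧
    ∀ s, |s - z.2| < ε → |u z.1 s - u z.1 z.2| ≤ k * |s - z.2|

lemma LipPoint.mono {n : ℕ} {u : Euc n → ℝ → ℝ} {k ε k' ε' : ℝ} {z : Euc n × ℝ}
    (h : LipPoint u k ε z) (hk : k ≤ k') (hε : ε' ≤ ε) : LipPoint u k' ε' z :=
  ⟨fun y y' hy hy' => (h.1 y y' (hy.trans_le hε) (hy'.trans_le hε)).trans
    (mul_le_mul_of_nonneg_right hk (norm_nonneg _)),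
  fun s hs => (h.2 s (hs.trans_le hε)).trans (mul_le_mul_of_nonneg_right hk (abs_nonneg _))⟩

lemma SolAt.exists_lipPoint {n : ℕ} {lam Lam : ℝ} {u : Euc n → ℝ → ℝ} {x : Euc n} {t : ℝ}
    (h : SolAt lam Lam u x t) : ∃ k ε : ℝ, 0 < ε ∧ LipPoint u k ε (x, t) := by
  obtain ⟨h1, d, hd, -⟩ := h
  obtain ⟨L, s, hs, hL⟩ := (h1.of_le (m := 1) (by norm_num)).exists_lipschitzOnWith
  obtain ⟨ε₁, hε₁, hsub⟩ := Metric.mem_nhds_iff.1 hs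
  obtain ⟨c, hc⟩ := hd.differentiableAt.isBigO_sub.bound
  obtain ⟨ε₂, hε₂, hsub₂⟩ := Metric.eventually_nhds_iff_ball.1 hc
  refine ⟨max L c, min ε₁ ε₂, lt_min hε₁ hε₂, ?_, ?_⟩
  · intro y y' hy hy'
    have hm : ∀ y : Euc n, ‖y - x‖ < min ε₁ ε₂ → y ∈ s := fun y hy => hsub (by
      rw [Metric.mem_ball, dist_eq_norm]; exact hy.trans_le (min_le_left _ _))
    have := hL.dist_le_mul y (hm y hy) y' (hm y' hy')
    rw [Real.dist_eq, dist_eq_norm] at this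
    exact this.trans (mul_le_mul_of_nonneg_right (le_max_left _ _) (norm_nonneg _))
  · intro s hs
    have := hsub₂ s (by rw [Metric.mem_ball, Real.dist_eq]; exact hs.trans_le (min_le_right _ _))
    rw [Real.norm_eq_abs, Real.norm_eq_abs] at this
    exact this.trans (mul_le_mul_of_nonneg_right (le_max_right _ _) (abs_nonneg _))

lemma LipPoint.of_tendsto {n : ℕ} {u : Euc n → ℝ → ℝ} {k ε : ℝ} {z : Euc n × ℝ}
    {w : ℕ → Euc n × ℝ} (hw : Filter.Tendsto w Filter.atTop (nhds z))
    (h : ∀ j, LipPoint u k ε (w j)) (hε : 0 < ε)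
    (hsp : ∀ s, |s - z.2| < ε → ContinuousAt (fun y => u y s) z.1)
    (htm : ∀ y, ‖y - z.1‖ < ε → ContinuousAt (u y) z.2) : LipPoint u k ε z := by
  have hw1 : Filter.Tendsto (fun j => (w j).1) Filter.atTop (nhds z.1) :=
    (continuous_fst.tendsto z).comp hw
  have hw2 : Filter.Tendsto (fun j => (w j).2) Filter.atTop (nhds z.2) :=
    (continuous_snd.tendsto z).comp hw
  constructor
  · intro y y' hy hy'
    have ev : ∀ y : Euc n, ‖y - z.1‖ < ε → ∀ᶠ j in Filter.atTop, ‖y - (w j).1‖ < ε := fun y hy =>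
      ((tendsto_const_nhds.sub hw1).norm).eventually (gt_mem_nhds hy)
    refine le_of_tendsto ((((htm y hy).tendsto.comp hw2).sub ((htm y' hy').tendsto.comp hw2)).abs) ?_
    filter_upwards [ev y hy, ev y' hy'] with j h1 h2
    exact (h j).1 y y' h1 h2
  · intro s hs
    have ev : ∀ s : ℝ, |s - z.2| < ε → ∀ᶠ j in Filter.atTop, |s - (w j).2| < ε := fun s hs =>
      ((tendsto_const_nhds.sub hw2).abs).eventually (gt_mem_nhds hs)
    have h0 : |z.2 - z.2| < ε := by simpa using hε
    have hl : Filter.Tendsto (fun j => |u (w j).1 s - u (w j).1 z.2|) Filter.atTop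
        (nhds |u z.1 s - u z.1 z.2|) :=
      (((hsp s hs).tendsto.comp hw1).sub ((hsp z.2 h0).tendsto.comp hw1)).abs
    have hr : Filter.Tendsto (fun j => k * |s - (w j).2| + k * |z.2 - (w j).2|) Filter.atTop
        (nhds (k * |s - z.2| + k * |z.2 - z.2|)) :=
      (((tendsto_const_nhds.sub hw2).abs).const_mul k).add
        (((tendsto_const_nhds.sub hw2).abs).const_mul k)
    rw [sub_self, abs_zero, mul_zero, add_zero] at hr
    refine le_of_tendsto_of_tendsto hl hr ?_
    filter_upwards [ev s hs, ev z.2 h0] with j h1 h2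
    have h3 := (h j).2 s h1
    have h4 := (h j).2 z.2 h2
    calc _ = |(u (w j).1 s - u (w j).1 (w j).2) - (u (w j).1 z.2 - u (w j).1 (w j).2)| := by
          congr 1; ring
      _ ≤ _ := (abs_sub _ _).trans (add_le_add h3 h4)

/-- Nonnegative pointwise solutions are forward continuous in all variables jointly. -/
lemma rightCont_of_solAt {n : ℕ} {lam Lam : ℝ} (hlam : 0 < lam) (hLam : lam ≤ Lam)
    {u : Euc n → ℝ → ℝ} {Ω : Set (Euc n × ℝ)} (hΩ : IsOpen Ω)
    (hu : ∀ p ∈ Ω, SolAt lam Lam u p.1 p.2 ∧ 0 ≤ u p.1 p.2) {p : Euc n × ℝ} (hp : p ∈ Ω) :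
    RightCont u p.1 p.2 := by
  obtain ⟨C, hC, hH, hHB⟩ := exists_harnack n hlam hLam
  obtain ⟨c, hc, hB⟩ := exists_bumpBound n hlam hLam
  by_contra hnot
  obtain ⟨r₀, hr₀, hsub₀⟩ := Metric.isOpen_iff.1 hΩ p hp
  obtain ⟨r, hr, hsub⟩ : ∃ r > (0 : ℝ), Metric.ball p (3 * r) ⊆ Ω :=
    ⟨r₀ / 3, by positivity, by rwa [mul_div_cancel₀ _ (by norm_num)]⟩
  set D : Set (Euc n × ℝ) := {q | q ∈ Metric.ball p r ∧ ¬ RightCont u q.1 q.2} with hD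
  have hpD : p ∈ D := ⟨Metric.mem_ball_self hr, hnot⟩
  have hZr : closure D ⊆ Metric.closedBall p r :=
    closure_minimal (fun q hq => Metric.ball_subset_closedBall hq.1) Metric.isClosed_closedBall
  have hdom : ∀ z ∈ closure D, ∀ q, dist q z < r → q ∈ Ω := by
    intro z hz q hq
    refine hsub ?_
    rw [Metric.mem_ball]
    have := Metric.mem_closedBall.1 (hZr hz)
    linarith [dist_triangle q z p]
  have hdomx : ∀ z ∈ closure D, ∀ y, ‖y - z.1‖ < r → (y, z.2) ∈ Ω := fun z hz y hy =>
    hdom z hz _ (by rw [Prod.dist_eq, dist_eq_norm, dist_self]; exact max_lt hy hr)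
  have hdomt : ∀ z ∈ closure D, ∀ s, |s - z.2| < r → (z.1, s) ∈ Ω := fun z hz s hs =>
    hdom z hz _ (by rw [Prod.dist_eq, dist_self, Real.dist_eq]; exact max_lt hr hs)
  have : CompleteSpace (closure D) := isClosed_closure.completeSpace_coe
  have : Nonempty (closure D) := ⟨⟨p, subset_closure hpD⟩⟩
  set f : ℕ → Set (closure D) := fun k => {z | LipPoint u k (r / (k + 1)) z.1} with hf
  have hrk : ∀ k : ℕ, 0 < r / ((k : ℝ) + 1) ∧ r / ((k : ℝ) + 1) ≤ r := fun k =>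
    ⟨by positivity, div_le_self hr.le (by linarith [(Nat.cast_nonneg k : (0 : ℝ) ≤ k)])⟩
  have hclosed : ∀ k, IsClosed (f k) := by
    intro k
    refine IsSeqClosed.isClosed fun w z hw hwz => ?_
    have hwz' : Filter.Tendsto (fun j => (w j).1) Filter.atTop (nhds z.1) :=
      (continuous_subtype_val.tendsto z).comp hwz
    refine LipPoint.of_tendsto hwz' hw (hrk k).1 (fun s hs => ?_) (fun y hy => ?_)
    · exact (hu _ (hdomt z.1 z.2 s (hs.trans_le (hrk k).2))).1.continuousAt_space
    · exact (hu _ (hdomx z.1 z.2 y (hy.trans_le (hrk k).2))).1.continuousAt_time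
  have hcover : ⋃ k, f k = Set.univ := by
    rw [Set.eq_univ_iff_forall]
    intro z
    obtain ⟨k, ε, hε, h⟩ := (hu _ (hdom z.1 z.2 z.1 (by rwa [dist_self]))).1.exists_lipPoint
    obtain ⟨K, hK⟩ := exists_nat_ge (max k (r / ε))
    rw [Set.mem_iUnion]
    refine ⟨K, h.mono ((le_max_left _ _).trans hK) ?_⟩
    have := (le_max_right _ _).trans hK
    rw [div_le_iff₀ hε] at this
    rw [div_le_iff₀ (by positivity)]
    linarith
  obtain ⟨k, ⟨z, hz⟩⟩ := nonempty_interior_of_iUnion_of_closed hclosed hcover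
  obtain ⟨U, hU, hUz⟩ := isOpen_induced_iff.1 (isOpen_interior (s := f k))
  have hzU : z.1 ∈ U := by
    have : z ∈ Subtype.val ⁻¹' U := hUz ▸ hz
    exact this
  obtain ⟨z0, hz0U, hz0D⟩ := mem_closure_iff.1 z.2 U hU hzU
  have hO : IsOpen (U ∩ Metric.ball p r) := hU.inter Metric.isOpen_ball
  obtain ⟨ρ₀, hρ₀, hsubρ⟩ := Metric.isOpen_iff.1 hO z0 ⟨hz0U, hz0D.1⟩
  set ρ := min (min ρ₀ 1) (r / ((k : ℝ) + 1) / 2) with hρ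
  have hρpos : 0 < ρ := lt_min (lt_min hρ₀ one_pos) (by have := (hrk k).1; linarith)
  have hρ1 : ρ ≤ ρ₀ := (min_le_left _ _).trans (min_le_left _ _)
  have hρ2 : ρ ≤ 1 := (min_le_left _ _).trans (min_le_right _ _)
  have hρ3 : ρ ≤ r / ((k : ℝ) + 1) / 2 := min_le_right _ _
  clear_value ρ
  have hbox : ∀ x t, ‖x - z0.1‖ < ρ → |t - z0.2| < ρ → (x, t) ∈ U ∩ Metric.ball p r := by
    intro x t hx ht
    refine hsubρ ?_
    rw [Metric.mem_ball, Prod.dist_eq, dist_eq_norm, Real.dist_eq]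
    exact (max_lt hx ht).trans_le hρ1
  have hboxΩ : ∀ x t, ‖x - z0.1‖ < ρ → |t - z0.2| < ρ → (x, t) ∈ Ω := fun x t hx ht =>
    hsub (Metric.ball_subset_ball (by linarith) (hbox x t hx ht).2)
  have hlip : ∀ x t, ‖x - z0.1‖ < ρ → |t - z0.2| < ρ → (x, t) ∈ closure D →
      LipPoint u k (r / (k + 1)) (x, t) := by
    intro x t hx ht hxt
    have : (⟨(x, t), hxt⟩ : closure D) ∈ interior (f k) := by
      rw [← hUz]
      exact (hbox x t hx ht).1
    have hmem : (⟨(x, t), hxt⟩ : closure D) ∈ f k := interior_subset this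
    exact hmem
  have hk0 : (0 : ℝ) ≤ k := Nat.cast_nonneg k
  have hZB : ZBox lam Lam u (closure D) z0.1 z0.2 ρ k := by
    refine ⟨hρpos, hρ2, hk0, isClosed_closure, subset_closure hz0D, ?_, ?_, ?_, ?_⟩
    · intro x t hx ht
      exact (hu _ (hboxΩ x t hx ht)).1
    · intro x t hx ht hxt
      by_contra hcon
      exact hxt (subset_closure ⟨(hbox x t hx ht).2, hcon⟩)
    · intro x t y hx ht hxt hy
      refine (hlip x t hx ht hxt).1 y x ?_ (by simpa using (hrk k).1)
      have : y - x = (y - z0.1) - (x - z0.1) := by abel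
      simp only
      rw [this]
      exact (norm_sub_le _ _).trans_lt (by linarith)
    · intro x t s hx ht hxt hs
      refine (hlip x t hx ht hxt).2 s ?_
      have : s - t = (s - z0.2) - (t - z0.2) := by ring
      simp only
      rw [this]
      exact (abs_sub _ _).trans_lt (by linarith)
  refine hz0D.2 (hZB.rightCont hC hc hH hB hHB fun x t hx h0 h1 => ?_)
  exact (hu _ (hboxΩ x t hx (by rw [abs_of_nonneg (by linarith)]; linarith))).2

/-- The functional `H ↦ tr(M H)`. -/
def traceF {m : ℕ} (M : Matrix (Fin (m + 1)) (Fin (m + 1)) ℝ) : Bil (m + 1) →ₗ[ℝ] ℝ where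
  toFun H := ∑ i, ∑ j, M i j * H (eVec m j) (eVec m i)
  map_add' H₁ H₂ := by
    simp only [add_apply, mul_add, Finset.sum_add_distrib]
  map_smul' c H := by
    simp only [smul_apply, smul_eq_mul, RingHom.id_apply, Finset.mul_sum]
    refine Finset.sum_congr rfl fun i _ => Finset.sum_congr rfl fun j _ => by ring

lemma apply_eq_sum {m : ℕ} (H : Bil (m + 1)) (x : Spc m) :
    H x x = ∑ i, ∑ j, x i * x j * H (eVec m i) (eVec m j) := by
  have hx : x = ∑ i, x i • eVec m i := by
    ext k
    simp [eVec, Pi.single_apply]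
  conv_lhs => rw [hx]
  simp only [map_sum, map_smul, sum_apply, smul_apply,
    smul_eq_mul, Finset.mul_sum]
  rw [Finset.sum_comm]
  refine Finset.sum_congr rfl fun i _ => Finset.sum_congr rfl fun j _ => by ring

lemma PSD.exists_factor {m : ℕ} {H : Bil (m + 1)} (h : PSD H) :
    ∃ (N : ℕ) (b : Fin N → Spc m), ∀ i j, H (eVec m i) (eVec m j) = ∑ k, b k i * b k j := by
  have hP : (Matrix.of fun i j => H (eVec m i) (eVec m j)).PosSemidef := by
    refine Matrix.PosSemidef.of_dotProduct_mulVec_nonneg ?_ fun x => ?_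
    · ext i j
      simp [h.1 (eVec m j) (eVec m i)]
    · have := h.2 (WithLp.toLp 2 x)
      rw [apply_eq_sum] at this
      simp only [star_trivial, dotProduct, Matrix.mulVec, Matrix.of_apply, Finset.mul_sum]
      refine this.trans_eq (Finset.sum_congr rfl fun i _ => Finset.sum_congr rfl fun j _ => ?_)
      ring
  obtain ⟨N, v, hv⟩ := Matrix.posSemidef_iff_eq_sum_vecMulVec.1 hP
  refine ⟨N, fun k => WithLp.toLp 2 (v k), fun i j => ?_⟩
  have := congrFun (congrFun hv i) j
  simpa [Matrix.sum_apply, Matrix.vecMulVec_apply] using this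

lemma IsElliptic.ellF {m : ℕ} {lam Lam : ℝ} {A : Spc m → Matrix (Fin (m + 1)) (Fin (m + 1)) ℝ}
    (hA : IsElliptic lam Lam A) (x : Spc m) : EllF lam Lam (traceF (A x)) := by
  intro H hH
  obtain ⟨N, b, hb⟩ := hH.exists_factor
  have h1 : trc H = ∑ k, ‖b k‖ ^ 2 := by
    have : trc H = ∑ i, H (eVec m i) (eVec m i) := rfl
    rw [this]
    simp only [hb]
    rw [Finset.sum_comm]
    refine Finset.sum_congr rfl fun k _ => ?_
    rw [EuclideanSpace.real_norm_sq_eq]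
    exact Finset.sum_congr rfl fun i _ => (sq _).symm
  have h2 : traceF (A x) H = ∑ k, ∑ i, ∑ j, b k i * A x i j * b k j := by
    have : traceF (A x) H = ∑ i, ∑ j, A x i j * H (eVec m j) (eVec m i) := rfl
    rw [this]
    calc ∑ i, ∑ j, A x i j * H (eVec m j) (eVec m i)
        = ∑ i, ∑ k, ∑ j, b k i * A x i j * b k j := Finset.sum_congr rfl fun i _ => by
          rw [Finset.sum_comm]
          refine Finset.sum_congr rfl fun j _ => ?_
          rw [hb, Finset.mul_sum]
          exact Finset.sum_congr rfl fun k _ => by ring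
      _ = _ := Finset.sum_comm
  rw [h1, h2, Finset.mul_sum, Finset.mul_sum]
  exact ⟨Finset.sum_le_sum fun k _ => (hA.2 x (b k)).1,
    Finset.sum_le_sum fun k _ => (hA.2 x (b k)).2⟩

lemma sHess_eq_hess {m : ℕ} {u : Spc m × ℝ → ℝ} {p : Spc m × ℝ}
    (h : ContDiffAt ℝ 2 (fun y => u (y, p.2)) p.1) (i j : Fin (m + 1)) :
    sHess u p i j = hess (fun y => u (y, p.2)) p.1 (eVec m i) (eVec m j) := by
  have h1 : HasFDerivAt (fderiv ℝ fun y => u (y, p.2)) (hess (fun y => u (y, p.2)) p.1) p.1 :=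
    h.differentiableAt_fderiv.hasFDerivAt
  have h2 := h1.clm_apply (hasFDerivAt_const (eVec m j) p.1)
  unfold sHess
  rw [h2.fderiv]
  simp

lemma SolvesL.solAt {m : ℕ} {lam Lam : ℝ} {A : Spc m → Matrix (Fin (m + 1)) (Fin (m + 1)) ℝ}
    (hA : IsElliptic lam Lam A) {u : Spc m × ℝ → ℝ} {Ω : Set (Spc m × ℝ)} (h : SolvesL A u Ω)
    {p : Spc m × ℝ} (hp : p ∈ Ω) : SolAt lam Lam (fun y s => u (y, s)) p.1 p.2 := by
  obtain ⟨h1, h2⟩ := h p hp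
  refine ⟨h1, _, h2, traceF (A p.1), hA.ellF p.1, ?_⟩
  unfold Lop
  simp only [sHess_eq_hess h1]
  rfl

lemma xprime_sub_norm_le {m : ℕ} (x y : Spc m) : ‖xprime x - xprime y‖ ≤ ‖x - y‖ := by
  rw [← sq_le_sq₀ (norm_nonneg _) (norm_nonneg _), EuclideanSpace.real_norm_sq_eq,
    EuclideanSpace.real_norm_sq_eq, Fin.sum_univ_castSucc (n := m)]
  have : ∀ i, (xprime x - xprime y) i = (x - y) i.castSucc := fun i => by simp [xprime]
  simp only [this]
  nlinarith [sq_nonneg ((x - y) (Fin.last m))]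

lemma xlast_sub_abs_le {m : ℕ} (x y : Spc m) : |xlast x - xlast y| ≤ ‖x - y‖ :=
  (PiLp.norm_apply_le (x - y) (Fin.last m))

lemma norm_sub_le_xprime_xlast {m : ℕ} (x y : Spc m) :
    ‖x - y‖ ≤ ‖xprime x - xprime y‖ + |xlast x - xlast y| := by
  rw [← sq_le_sq₀ (norm_nonneg _) (by positivity), EuclideanSpace.real_norm_sq_eq,
    Fin.sum_univ_castSucc (n := m)]
  have h : ∀ i, (x - y) (Fin.castSucc i) = (xprime x - xprime y) i := fun i => by simp [xprime]
  have h2 : (x - y) (Fin.last m) = xlast x - xlast y := rfl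
  simp only [h]
  rw [← EuclideanSpace.real_norm_sq_eq, h2, ← sq_abs (xlast x - xlast y)]
  have : 0 ≤ ‖xprime x - xprime y‖ * |xlast x - xlast y| := by positivity
  nlinarith

lemma xprime_mkPt {m : ℕ} (x' : Spc' m) (a : ℝ) : xprime (mkPt x' a) = x' := by
  ext i; simp [xprime, mkPt]

lemma xlast_mkPt {m : ℕ} (x' : Spc' m) (a : ℝ) : xlast (mkPt x' a) = a := by
  simp [xlast, mkPt]

lemma continuous_xprime {m : ℕ} : Continuous (xprime : Spc m → Spc' m) := by
  unfold xprime
  refine (PiLp.continuous_toLp 2 _).comp (continuous_pi fun i => ?_)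
  fun_prop

lemma continuous_xlast {m : ℕ} : Continuous (xlast : Spc m → ℝ) := by
  unfold xlast; fun_prop

lemma isOpen_cyl {m : ℕ} {g : Spc' m → ℝ → ℝ} (hg : Continuous fun q : Spc' m × ℝ => g q.1 q.2)
    (r : ℝ) : IsOpen (Cyl g r) := by
  have h1 : Continuous fun p : Spc m × ℝ => xprime p.1 := continuous_xprime.comp continuous_fst
  have h2 : Continuous fun p : Spc m × ℝ => xlast p.1 := continuous_xlast.comp continuous_fst
  have h3 : Continuous fun p : Spc m × ℝ => g (xprime p.1) p.2 :=
    hg.comp (h1.prodMk continuous_snd)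
  refine (isOpen_lt h1.norm continuous_const).inter ((isOpen_lt continuous_const continuous_snd).inter
    ((isOpen_lt continuous_snd continuous_const).inter ((isOpen_lt h3 h2).inter
      (isOpen_lt h2 (h3.add continuous_const)))))

/-- The parabolic box of size `r` about `(x,t)` fits into `Cyl g 1` with room `L r ^ α`
in the vertical direction. -/
def Roomy {m : ℕ} (g : Spc' m → ℝ → ℝ) (L α : ℝ) (x : Spc m) (t r : ℝ) : Prop :=
  L * r ^ α < hGamma g (x, t) ∧ L * r ^ α < 1 - hGamma g (x, t) ∧
    ‖xprime x‖ + 9 * r < 1 ∧ |t| + 20 * r ^ 2 < 1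

lemma HolderSemi.abs_sub_le {m : ℕ} {α β K : ℝ} {g : Spc' m → ℝ → ℝ} (hg : HolderSemi α β K g)
    (hK : 0 ≤ K) (hα : 0 ≤ α) (hβ : 0 ≤ β) {x' y' : Spc' m} {t s a b : ℝ}
    (h1 : ‖x' - y'‖ ≤ a) (h2 : |t - s| ≤ b) :
    |g x' t - g y' s| ≤ K * (a ^ α + b ^ β) := by
  refine (hg x' y' t s).trans (mul_le_mul_of_nonneg_left (add_le_add ?_ ?_) hK)
  · exact Real.rpow_le_rpow (norm_nonneg _) h1 hα
  · exact Real.rpow_le_rpow (abs_nonneg _) h2 hβ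

lemma HolderSemi.abs_hGamma_sub_le {m : ℕ} {α β K : ℝ} {g : Spc' m → ℝ → ℝ}
    (hg : HolderSemi α β K g) (hK : 0 ≤ K) (hα : 0 ≤ α) (hβ : 0 ≤ β) {x y : Spc m} {t s a b : ℝ}
    (h1 : ‖x - y‖ ≤ a) (h2 : |t - s| ≤ b) :
    |hGamma g (x, t) - hGamma g (y, s)| ≤ a + K * (a ^ α + b ^ β) := by
  have e1 := hg.abs_sub_le hK hα hβ ((xprime_sub_norm_le x y).trans h1) h2
  have e2 := (xlast_sub_abs_le x y).trans h1
  have e3 : hGamma g (x, t) - hGamma g (y, s) =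
      (xlast x - xlast y) - (g (xprime x) t - g (xprime y) s) := by
    simp only [hGamma]; ring
  rw [e3]
  exact (abs_sub _ _).trans (add_le_add e2 e1)

lemma room_bound {α β K r : ℝ} (hK : 0 ≤ K) (hα1 : α ≤ 1) (hβ1 : β ≤ 1)
    (hαβ : α ≤ 2 * β) (hr : 0 < r) (hr1 : r ≤ 1) :
    9 * r + K * ((9 * r) ^ α + (20 * r ^ 2) ^ β) ≤ (9 + 29 * K) * r ^ α := by
  have h1 : (9 * r) ^ α ≤ 9 * r ^ α := by
    rw [Real.mul_rpow (by norm_num) hr.le]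
    refine mul_le_mul_of_nonneg_right ?_ (by positivity)
    exact (Real.rpow_le_rpow_of_exponent_le (by norm_num) hα1).trans_eq (Real.rpow_one _)
  have h2 : (20 * r ^ 2) ^ β ≤ 20 * r ^ α := by
    rw [Real.mul_rpow (by norm_num) (by positivity)]
    refine mul_le_mul ?_ ?_ (by positivity) (by norm_num)
    · exact (Real.rpow_le_rpow_of_exponent_le (by norm_num) hβ1).trans_eq (Real.rpow_one _)
    · rw [← Real.rpow_natCast, ← Real.rpow_mul hr.le]
      exact Real.rpow_le_rpow_of_exponent_ge hr hr1 (by simpa using hαβ)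
  have h3 : r ≤ r ^ α := by
    conv_lhs => rw [← Real.rpow_one r]
    exact Real.rpow_le_rpow_of_exponent_ge hr hr1 hα1
  nlinarith [mul_le_mul_of_nonneg_left (add_le_add h1 h2) hK]

lemma Roomy.mem_cyl {m : ℕ} {α β K : ℝ} {g : Spc' m → ℝ → ℝ}
    (hg : HolderSemi α β K g) (hK : 0 ≤ K) (hα : 0 < α) (hα1 : α ≤ 1) (hβ : 0 ≤ β) (hβ1 : β ≤ 1)
    (hαβ : α ≤ 2 * β) {r : ℝ} (hr : 0 < r) (hr1 : r ≤ 1) {x : Spc m} {t : ℝ}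
    (h : Roomy g (9 + 29 * K) α x t r) {y : Spc m} {s : ℝ} (hy : ‖y - x‖ ≤ 9 * r)
    (hs : |s - t| ≤ 20 * r ^ 2) : (y, s) ∈ Cyl g 1 := by
  obtain ⟨h1, h2, h3, h4⟩ := h
  have hb := room_bound hK hα1 hβ1 hαβ hr hr1
  have e := abs_le.1 ((hg.abs_hGamma_sub_le hK hα.le hβ hy hs).trans hb)
  have e1 : ‖xprime y‖ < 1 := by
    have a1 := (xprime_sub_norm_le y x).trans hy
    have a2 := norm_le_norm_add_norm_sub' (xprime y) (xprime x)
    linarith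
  have e2 : |s| < 1 := by
    have a2 := abs_add_le (s - t) t
    rw [sub_add_cancel] at a2
    linarith
  have e3 : hGamma g (y, s) = xlast y - g (xprime y) s := rfl
  rw [abs_lt] at e2
  refine ⟨e1, by norm_num; exact e2.1, by norm_num; exact e2.2, ?_, ?_⟩
  · show g (xprime y) s < xlast y
    linarith
  · show xlast y < g (xprime y) s + 1
    linarith

/-- One Harnack step with constant `C` is available for `u` at every roomy point. -/
def HarnackSteps {m : ℕ} (g : Spc' m → ℝ → ℝ) (L α C : ℝ) (u : Spc m × ℝ → ℝ) : Prop :=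
  ∀ x₁ x₂ t r, 0 < r → r ≤ 1 → Roomy g L α x₁ t r → ‖x₂ - x₁‖ ≤ 2 * r →
    u (x₁, t) ≤ C * u (x₂, t + 20 * r ^ 2)

lemma harnackSteps_of_solvesL {m : ℕ} {lam Lam α β K C : ℝ} (hlam : 0 < lam) (hLam : lam ≤ Lam)
    {A : Spc m → Matrix (Fin (m + 1)) (Fin (m + 1)) ℝ} (hA : IsElliptic lam Lam A)
    {g : Spc' m → ℝ → ℝ} (hgc : Continuous fun q : Spc' m × ℝ => g q.1 q.2)
    (hg : HolderSemi α β K g) (hK : 0 ≤ K) (hα : 0 < α) (hα1 : α ≤ 1) (hβ : 0 ≤ β) (hβ1 : β ≤ 1)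
    (hαβ : α ≤ 2 * β) (hC : HarnackInterior (m + 1) lam Lam C) {u : Spc m × ℝ → ℝ}
    (hu : SolvesL A u (Cyl g 1)) (hpos : ∀ p ∈ Cyl g 1, 0 < u p) :
    HarnackSteps g (9 + 29 * K) α C u := by
  have hS : ∀ p ∈ Cyl g 1, SolAt lam Lam (fun y s => u (y, s)) p.1 p.2 ∧ 0 ≤ u (p.1, p.2) :=
    fun p hp => ⟨hu.solAt hA hp, (hpos p hp).le⟩
  intro x₁ x₂ t r hr hr1 hroom hx
  have hmem := fun {y s} => hroom.mem_cyl hg hK hα hα1 hβ hβ1 hαβ hr hr1 (y := y) (s := s)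
  have hr2 : 0 < r ^ 2 := by positivity
  have h2 : 0 < u (x₂, t + 20 * r ^ 2) := by
    refine hpos _ (hmem (by linarith) ?_)
    rw [add_sub_cancel_left, abs_of_nonneg (by positivity)]
  refine hC (fun y s => u (y, s)) x₁ x₂ t r _ hr h2 (fun x s h3 h4 h5 => ?_) hx le_rfl
  have h6 : (x, s) ∈ Cyl g 1 := hmem h3.le (abs_le.2 ⟨by linarith, by linarith⟩)
  exact ⟨(hS _ h6).2, (hS _ h6).1, fun _ => rightCont_of_solAt hlam hLam (isOpen_cyl hgc 1) hS h6⟩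

lemma HarnackSteps.chain {m : ℕ} {g : Spc' m → ℝ → ℝ} {L α C : ℝ} {u : Spc m × ℝ → ℝ}
    (h : HarnackSteps g L α C u) (hC : 0 ≤ C) {r : ℝ} (hr : 0 < r) (hr1 : r ≤ 1) (x : ℕ → Spc m)
    (t : ℝ) (N : ℕ) (hroom : ∀ i < N, Roomy g L α (x i) (t + 20 * r ^ 2 * i) r)
    (hx : ∀ i < N, ‖x (i + 1) - x i‖ ≤ 2 * r) :
    u (x 0, t) ≤ C ^ N * u (x N, t + 20 * r ^ 2 * N) := by
  induction N with
  | zero => simp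
  | succ N ih =>
    have h1 := ih (fun i hi => hroom i (by omega)) (fun i hi => hx i (by omega))
    have h2 := h _ (x (N + 1)) _ r hr hr1 (hroom N (by omega)) (hx N (by omega))
    have h3 : t + 20 * r ^ 2 * N + 20 * r ^ 2 = t + 20 * r ^ 2 * (N + 1 : ℕ) := by push_cast; ring
    rw [h3] at h2
    calc _ ≤ _ := h1
      _ ≤ C ^ N * (C * u (x (N + 1), t + 20 * r ^ 2 * (N + 1 : ℕ))) :=
        mul_le_mul_of_nonneg_left h2 (by positivity)
      _ = _ := by rw [pow_succ]; ring

lemma HarnackSteps.segment {m : ℕ} {g : Spc' m → ℝ → ℝ} {L α C : ℝ} {u : Spc m × ℝ → ℝ}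
    (h : HarnackSteps g L α C u) (hC : 0 ≤ C) {r : ℝ} (hr : 0 < r) (hr1 : r ≤ 1) (x y : Spc m)
    (t : ℝ) {N : ℕ} (hN : 0 < N)
    (hroom : ∀ θ : ℝ, 0 ≤ θ → θ ≤ 1 → Roomy g L α (x + θ • (y - x)) (t + 20 * r ^ 2 * N * θ) r)
    (hx : ‖y - x‖ ≤ 2 * r * N) :
    u (x, t) ≤ C ^ N * u (y, t + 20 * r ^ 2 * N) := by
  have hN' : (0 : ℝ) < N := by exact_mod_cast hN
  have := h.chain hC hr hr1 (fun i => x + ((i : ℝ) / N) • (y - x)) t N (fun i hi => ?_)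
    (fun i hi => ?_)
  · simpa [hN'.ne'] using this
  · have hi' : (i : ℝ) ≤ N := by exact_mod_cast hi.le
    have := hroom ((i : ℝ) / N) (by positivity) ((div_le_one hN').2 hi')
    have e : t + 20 * r ^ 2 * N * ((i : ℝ) / N) = t + 20 * r ^ 2 * i := by field_simp
    rwa [e] at this
  · have e : x + (((i + 1 : ℕ) : ℝ) / N) • (y - x) - (x + ((i : ℝ) / N) • (y - x)) =
        (1 / (N : ℝ)) • (y - x) := by
      rw [add_sub_add_left_eq_sub, ← sub_smul]
      congr 1
      push_cast; ring
    rw [e, norm_smul, Real.norm_of_nonneg (by positivity), one_div, inv_mul_le_iff₀ hN']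
    linarith

lemma xprime_add_smul_eVec_last {m : ℕ} (x : Spc m) (a : ℝ) :
    xprime (x + a • eVec m (Fin.last m)) = xprime x := by
  ext i
  simp [xprime, eVec, Fin.castSucc_ne_last]

lemma xlast_add_smul_eVec_last {m : ℕ} (x : Spc m) (a : ℝ) :
    xlast (x + a • eVec m (Fin.last m)) = xlast x + a := by
  simp [xlast, eVec]

lemma norm_eVec {m : ℕ} (i : Fin (m + 1)) : ‖eVec m i‖ = 1 := by
  simp [eVec]

lemma mem_cyl_one {m : ℕ} {g : Spc' m → ℝ → ℝ} {x : Spc m} {t : ℝ} (h1 : ‖xprime x‖ < 1)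
    (h2 : -1 < t) (h3 : t < 1) (h4 : 0 < hGamma g (x, t)) (h5 : hGamma g (x, t) < 1) :
    (x, t) ∈ Cyl g 1 := by
  have e : hGamma g (x, t) = xlast x - g (xprime x) t := rfl
  refine ⟨h1, by norm_num; exact h2, by norm_num; exact h3, ?_, ?_⟩
  · show g (xprime x) t < xlast x
    linarith
  · show xlast x < g (xprime x) t + 1
    linarith

lemma exists_doubling_steps {α β K L H c : ℝ} (hK : 0 ≤ K) (hα : 0 < α) (hα1 : α ≤ 1)
    (hβ : 0 ≤ β) (hαβ : (1 + 1 / α) * β = 1) (hc : 0 < c) (hc1 : c ≤ 1 / 4000)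
    (hLc : L * c ^ α ≤ 1 / 2) (hKc : K * (40 * c) ^ β ≤ 1 / 10) (h0 : 0 < H) (h1 : H < 1 / 16) :
    ∃ (r : ℝ) (N : ℕ), 0 < r ∧ r ≤ 1 / 4000 * H ∧ L * r ^ α ≤ H / 2 ∧ 0 < N ∧ H ≤ r * N ∧
      N ≤ 2 / c * H ^ (1 - 1 / α) ∧ 20 * r ^ 2 * N ≤ 40 * c * H ∧
      K * (20 * r ^ 2 * N) ^ β ≤ H / 10 := by
  have hinv : 1 ≤ 1 / α := (one_le_div hα).2 hα1
  have hp : H ^ (1 / α) ≤ H :=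
    (Real.rpow_le_rpow_of_exponent_ge h0 (by linarith) hinv).trans_eq (Real.rpow_one _)
  have hp0 : 0 < H ^ (1 / α) := by positivity
  obtain ⟨r, hr⟩ : ∃ r, r = c * H ^ (1 / α) := ⟨_, rfl⟩
  have hr0 : 0 < r := hr ▸ by positivity
  have hrH : r ≤ c * H := hr ▸ mul_le_mul_of_nonneg_left hp hc.le
  have hrH' : r ≤ 1 / 4000 * H := hrH.trans (by nlinarith)
  have hLr : L * r ^ α ≤ H / 2 := by
    rw [hr, Real.mul_rpow hc.le hp0.le, ← Real.rpow_mul h0.le, one_div_mul_cancel hα.ne',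
      Real.rpow_one]
    nlinarith
  obtain ⟨N, hN⟩ : ∃ N, N = ⌈H / r⌉₊ := ⟨_, rfl⟩
  have hN0 : 0 < N := hN ▸ Nat.ceil_pos.2 (by positivity)
  have hN1 : H ≤ r * N := by
    have := Nat.le_ceil (H / r)
    rw [← hN, div_le_iff₀ hr0] at this
    linarith
  have hN2 : r * N ≤ H + r := by
    have := (Nat.ceil_lt_add_one (a := H / r) (by positivity)).le
    rw [← hN] at this
    calc r * N ≤ r * (H / r + 1) := mul_le_mul_of_nonneg_left this hr0.le
      _ = H + r := by field_simp
  have hN3 : (N : ℝ) ≤ 2 / c * H ^ (1 - 1 / α) := by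
    have e : 2 / c * H ^ (1 - 1 / α) = 2 * H / r := by
      rw [hr, Real.rpow_sub h0, Real.rpow_one]; field_simp
    rw [e, le_div_iff₀ hr0]
    linarith
  have hel : 20 * r ^ 2 * N ≤ 40 * (r * H) := by nlinarith
  have hel' : 20 * r ^ 2 * N ≤ 40 * c * H := hel.trans (by nlinarith)
  have hel0 : 0 ≤ 20 * r ^ 2 * N := by positivity
  have hKT : K * (20 * r ^ 2 * N) ^ β ≤ H / 10 := by
    have e1 : 40 * (r * H) = 40 * c * H ^ (1 + 1 / α) := by
      rw [hr, Real.rpow_add h0, Real.rpow_one]; ring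
    have e2 : (20 * r ^ 2 * N) ^ β ≤ (40 * c) ^ β * H := by
      refine (Real.rpow_le_rpow hel0 hel hβ).trans_eq ?_
      rw [e1, Real.mul_rpow (by positivity) (by positivity), ← Real.rpow_mul h0.le, hαβ,
        Real.rpow_one]
    nlinarith [mul_le_mul_of_nonneg_left e2 hK]
  exact ⟨r, N, hr0, hrH', hLr, hN0, hN1, hN3, hel', hKT⟩

lemma HarnackSteps.double {m : ℕ} {g : Spc' m → ℝ → ℝ} {L α β K C c : ℝ} {u : Spc m × ℝ → ℝ}
    (h : HarnackSteps g L α C u) (hC : 1 ≤ C) (hg : HolderSemi α β K g) (hK : 0 ≤ K)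
    (hα : 0 < α) (hα1 : α ≤ 1) (hβ : 0 ≤ β) (hαβ : (1 + 1 / α) * β = 1) (hc : 0 < c)
    (hc1 : c ≤ 1 / 4000) (hLc : L * c ^ α ≤ 1 / 2) (hKc : K * (40 * c) ^ β ≤ 1 / 10)
    (hpos : ∀ p ∈ Cyl g 1, 0 < u p) {x : Spc m} {t : ℝ} (hx : ‖xprime x‖ < 2 / 3) (ht : -(4 / 9) < t)
    (h0 : 0 < hGamma g (x, t)) (h1 : hGamma g (x, t) < 1 / 16)
    (ht1 : t ≤ 4 / 9 + 40 * c * hGamma g (x, t)) :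
    ∃ y s, xprime y = xprime x ∧ t ≤ s ∧ s ≤ t + 40 * c * (hGamma g (y, s) - hGamma g (x, t)) ∧
      2 * hGamma g (x, t) ≤ hGamma g (y, s) ∧ hGamma g (y, s) ≤ 4 * hGamma g (x, t) ∧
      u (x, t) ≤ Real.exp (2 * Real.log C / c * hGamma g (x, t) ^ (1 - 1 / α)) * u (y, s) := by
  have hH : hGamma g (x, t) = xlast x - g (xprime x) t := rfl
  generalize hGamma g (x, t) = H at *
  obtain ⟨r, N, hr0, hrH', hLr, hN0, hN1, hN3, hel', hKT⟩ :=
    exists_doubling_steps hK hα hα1 hβ hαβ hc hc1 hLc hKc h0 h1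
  have hel0 : 0 ≤ 20 * r ^ 2 * N := by positivity
  have hpt : ∀ θ : ℝ, 0 ≤ θ → θ ≤ 1 →
      |hGamma g (x + (θ * (2 * H)) • eVec m (Fin.last m), t + 20 * r ^ 2 * N * θ) -
        (H + θ * (2 * H))| ≤ H / 10 := by
    intro θ hθ hθ1
    have e := hg.abs_sub_le (x' := xprime x) (y' := xprime x) (t := t)
      (s := t + 20 * r ^ 2 * N * θ) (a := 0) (b := 20 * r ^ 2 * N) hK hα.le hβ (by simp) (by
        rw [sub_add_cancel_left, abs_neg, abs_of_nonneg (by positivity)]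
        exact mul_le_of_le_one_right hel0 hθ1)
    rw [Real.zero_rpow hα.ne', zero_add] at e
    refine le_trans (le_of_eq ?_) (e.trans hKT)
    simp only [hGamma, xprime_add_smul_eVec_last, xlast_add_smul_eVec_last]
    rw [hH]
    congr 1
    ring
  have hend := hpt 1 zero_le_one le_rfl
  rw [one_mul, mul_one] at hend
  have hseg := h.segment (by linarith) hr0 (by linarith) x (x + (2 * H) • eVec m (Fin.last m)) t hN0
    (fun θ hθ hθ1 => ?_) ?_
  · rw [abs_le] at hend
    refine ⟨x + (2 * H) • eVec m (Fin.last m), t + 20 * r ^ 2 * N, xprime_add_smul_eVec_last _ _,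
      by linarith, ?_, by linarith, by linarith, hseg.trans ?_⟩
    · refine (add_le_add_right hel' t).trans (add_le_add_right ?_ t)
      exact mul_le_mul_of_nonneg_left (by linarith) (by positivity)
    · have e5 : 40 * c * H ≤ 1 / 100 * (1 / 16) :=
        mul_le_mul (by linarith) h1.le h0.le (by norm_num)
      refine mul_le_mul_of_nonneg_right ?_ (hpos _ (mem_cyl_one ?_ ?_ ?_ ?_ ?_)).le
      · rw [← Real.exp_log (show 0 < C by linarith), ← Real.exp_nat_mul, Real.log_exp,
          Real.exp_le_exp]
        refine (mul_le_mul_of_nonneg_right hN3 (Real.log_nonneg hC)).trans_eq (by ring)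
      · rw [xprime_add_smul_eVec_last]
        linarith
      all_goals linarith
  · rw [add_sub_cancel_left, smul_smul]
    have e := abs_le.1 (hpt θ hθ hθ1)
    have e1 : 0 ≤ θ * (2 * H) := by positivity
    have e2 : θ * (2 * H) ≤ 2 * H := mul_le_of_le_one_left (by linarith) hθ1
    have e3 : 0 ≤ 20 * r ^ 2 * N * θ := by positivity
    have e4 : 20 * r ^ 2 * N * θ ≤ 40 * c * H := (mul_le_of_le_one_right hel0 hθ1).trans hel'
    have e5 : 40 * c * H ≤ 1 / 100 * (1 / 16) :=
      mul_le_mul (by linarith) h1.le h0.le (by norm_num)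
    have e6 : r * r ≤ 1 * (1 / 4000) := mul_le_mul (by linarith) (by linarith) hr0.le (by norm_num)
    refine ⟨by linarith, by linarith, ?_, ?_⟩
    · rw [xprime_add_smul_eVec_last]
      linarith
    · have : |t + 20 * r ^ 2 * N * θ| ≤ 1 / 2 := abs_le.2 ⟨by linarith, by linarith⟩
      have e7 : 20 * r ^ 2 ≤ 1 / 100 := by rw [sq]; linarith
      linarith
  · rw [add_sub_cancel_left, norm_smul, norm_eVec, mul_one, Real.norm_of_nonneg (by linarith)]
    linarith

lemma HarnackSteps.climb {m : ℕ} {g : Spc' m → ℝ → ℝ} {L α β K C c : ℝ} {u : Spc m × ℝ → ℝ}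
    (h : HarnackSteps g L α C u) (hC : 1 ≤ C) (hg : HolderSemi α β K g) (hK : 0 ≤ K)
    (hα : 0 < α) (hα1 : α < 1) (hβ : 0 ≤ β) (hαβ : (1 + 1 / α) * β = 1) (hc : 0 < c)
    (hc1 : c ≤ 1 / 4000) (hLc : L * c ^ α ≤ 1 / 2) (hKc : K * (40 * c) ^ β ≤ 1 / 10)
    (hpos : ∀ p ∈ Cyl g 1, 0 < u p) (j : ℕ) :
    ∀ (x : Spc m) (t : ℝ), ‖xprime x‖ < 2 / 3 → -(4 / 9) < t → 0 < hGamma g (x, t) →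
    hGamma g (x, t) < 2 / 3 → t ≤ 4 / 9 + 40 * c * hGamma g (x, t) →
    1 / 16 ≤ 2 ^ j * hGamma g (x, t) →
    ∃ y s, xprime y = xprime x ∧ t ≤ s ∧ s ≤ 4 / 9 + 40 * c * hGamma g (y, s) ∧
      1 / 16 ≤ hGamma g (y, s) ∧ hGamma g (y, s) < 2 / 3 ∧
      u (x, t) ≤ Real.exp (2 * Real.log C / c / (1 - 2 ^ (1 - 1 / α)) *
        hGamma g (x, t) ^ (1 - 1 / α)) * u (y, s) := by
  have he : 1 - 1 / α < 0 := by
    have := (one_lt_div hα).2 hα1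
    linarith
  have h2e : (2 : ℝ) ^ (1 - 1 / α) < 1 := Real.rpow_lt_one_of_one_lt_of_neg (by norm_num) he
  have hD : 0 ≤ 2 * Real.log C / c := by
    have := Real.log_nonneg hC
    positivity
  obtain ⟨D, hDe⟩ : ∃ D, D = 2 * Real.log C / c := ⟨_, rfl⟩
  obtain ⟨B, hBe⟩ : ∃ B, B = D / (1 - 2 ^ (1 - 1 / α)) := ⟨_, rfl⟩
  have hB : 0 ≤ B := hBe ▸ div_nonneg (hDe ▸ hD) (by linarith)
  have hBD : B * (1 - 2 ^ (1 - 1 / α)) = D := by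
    rw [hBe]; exact div_mul_cancel₀ _ (by linarith)
  have hstep := fun x t => h.double hC hg hK hα hα1.le hβ hαβ hc hc1 hLc hKc hpos (x := x) (t := t)
  rw [← hDe, ← hBe]
  rw [← hDe] at hstep
  have hbig : ∀ (x : Spc m) (t : ℝ), ‖xprime x‖ < 2 / 3 → -(4 / 9) < t →
      hGamma g (x, t) < 2 / 3 → t ≤ 4 / 9 + 40 * c * hGamma g (x, t) →
      1 / 16 ≤ hGamma g (x, t) →
      ∃ y s, xprime y = xprime x ∧ t ≤ s ∧ s ≤ 4 / 9 + 40 * c * hGamma g (y, s) ∧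
      1 / 16 ≤ hGamma g (y, s) ∧ hGamma g (y, s) < 2 / 3 ∧
      u (x, t) ≤ Real.exp (B * hGamma g (x, t) ^ (1 - 1 / α)) * u (y, s) := by
    intro x t hx ht h1 ht1 h2
    refine ⟨x, t, rfl, le_rfl, ht1, h2, h1, ?_⟩
    have e2 : 40 * c * hGamma g (x, t) ≤ 1 / 100 * (2 / 3) :=
      mul_le_mul (by linarith) h1.le (by linarith) (by norm_num)
    have hmem : (x, t) ∈ Cyl g 1 :=
      mem_cyl_one (by linarith) (by linarith) (by linarith) (by linarith) (by linarith)
    refine le_mul_of_one_le_left (hpos _ hmem).le (Real.one_le_exp ?_)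
    have : 0 < hGamma g (x, t) := by linarith
    positivity
  induction j with
  | zero =>
    intro x t hx ht h0 h1 ht1 h2
    exact hbig x t hx ht h1 ht1 (by simpa using h2)
  | succ j ih =>
    intro x t hx ht h0 h1 ht1 h2
    rcases le_or_gt (1 / 16) (hGamma g (x, t)) with hc2 | hc2
    · exact hbig x t hx ht h1 ht1 hc2
    obtain ⟨y, s, k1, k2, k3, k4, k5, k6⟩ := hstep x t hx ht h0 hc2 ht1
    have h0' : 0 < hGamma g (y, s) := by linarith
    obtain ⟨z, w, l1, l2, l3, l4, l5, l6⟩ := ih y s (by rwa [k1]) (by linarith) h0' (by linarith)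
      (by linarith) (by
        rw [pow_succ] at h2
        have : (0 : ℝ) < 2 ^ j := by positivity
        nlinarith)
    refine ⟨z, w, l1.trans k1, k2.trans l2, l3, l4, l5, k6.trans ?_⟩
    calc _ ≤ Real.exp (D * hGamma g (x, t) ^ (1 - 1 / α)) *
          (Real.exp (B * hGamma g (y, s) ^ (1 - 1 / α)) * u (z, w)) :=
          mul_le_mul_of_nonneg_left l6 (Real.exp_pos _).le
      _ = Real.exp (D * hGamma g (x, t) ^ (1 - 1 / α) + B * hGamma g (y, s) ^ (1 - 1 / α)) *
          u (z, w) := by rw [Real.exp_add]; ring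
      _ ≤ _ := by
        refine mul_le_mul_of_nonneg_right (Real.exp_le_exp.2 ?_) ?_
        · have e1 : hGamma g (y, s) ^ (1 - 1 / α) ≤
              2 ^ (1 - 1 / α) * hGamma g (x, t) ^ (1 - 1 / α) := by
            rw [← Real.mul_rpow (by norm_num) h0.le]
            exact Real.rpow_le_rpow_of_nonpos (by linarith) k4 he.le
          have e2 := mul_le_mul_of_nonneg_left e1 hB
          rw [← hBD]
          nlinarith
        · have e2 : 40 * c * hGamma g (z, w) ≤ 1 / 100 * (2 / 3) :=
            mul_le_mul (by linarith) l5.le (by linarith) (by norm_num)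
          have e3 : ‖xprime z‖ < 2 / 3 := by rw [l1, k1]; exact hx
          exact (hpos _ (mem_cyl_one (by linarith) (by linarith) (by linarith) (by linarith)
            (by linarith))).le

lemma HarnackSteps.short_segment {m : ℕ} {g : Spc' m → ℝ → ℝ} {L α β K C δ τ η ρ : ℝ}
    {u : Spc m × ℝ → ℝ} (h : HarnackSteps g L α C u) (hC : 0 ≤ C) (hg : HolderSemi α β K g)
    (hK : 0 ≤ K) (hα : 0 < α) (hβ : 0 ≤ β) (hL : 0 ≤ L) {x y : Spc m} {t : ℝ}
    (hx : ‖xprime x‖ ≤ 2 / 3) (ht : -(4 / 9) ≤ t) (htτ : t + τ ≤ 1 / 2)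
    (h1 : 1 / 16 ≤ hGamma g (x, t)) (h2 : hGamma g (x, t) ≤ 2 / 3) (hxy : ‖y - x‖ ≤ δ)
    (hτ : 0 < τ) (hτη : τ ≤ η) (hδ : δ + K * (δ ^ α + η ^ β) ≤ 1 / 32) (hρ : 0 < ρ)
    (hρ1 : ρ ≤ 1 / 100) (hLρ : L * ρ ^ α < 1 / 32) {N : ℕ} (hN : 0 < N)
    (hτN : τ ≤ 20 * ρ ^ 2 * N) (hδN : 5 * δ ^ 2 ≤ τ * N) :
    u (x, t) ≤ C ^ N * u (y, t + τ) := by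
  have hN' : (0 : ℝ) < N := by exact_mod_cast hN
  have hδ0 : 0 ≤ δ := (norm_nonneg _).trans hxy
  have hη0 : 0 ≤ η := hτ.le.trans hτη
  obtain ⟨r, hr⟩ : ∃ r, r = Real.sqrt (τ / (20 * N)) := ⟨_, rfl⟩
  have hr2 : r ^ 2 = τ / (20 * N) := by rw [hr, Real.sq_sqrt (by positivity)]
  have hr0 : 0 < r := hr ▸ Real.sqrt_pos.2 (by positivity)
  have hrτ : 20 * r ^ 2 * N = τ := by rw [hr2]; field_simp
  have hrρ : r ≤ ρ := by
    rw [← sq_le_sq₀ hr0.le hρ.le, hr2, div_le_iff₀ (by positivity)]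
    linarith
  have hLr : L * r ^ α < 1 / 32 :=
    (mul_le_mul_of_nonneg_left (Real.rpow_le_rpow hr0.le hrρ hα.le) hL).trans_lt hLρ
  have hδ1 : δ ≤ 1 / 32 := by
    have : 0 ≤ K * (δ ^ α + η ^ β) := by positivity
    linarith
  have e7 : 20 * r ^ 2 ≤ 1 / 100 := by
    have : r * r ≤ 1 / 100 * (1 / 100) := mul_le_mul (hrρ.trans hρ1) (hrρ.trans hρ1) hr0.le
      (by norm_num)
    rw [sq]; linarith
  have := h.segment hC hr0 (by linarith) x y t hN (fun θ hθ hθ1 => ?_) ?_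
  · rwa [hrτ] at this
  · rw [hrτ]
    have a1 : ‖x + θ • (y - x) - x‖ ≤ δ := by
      rw [add_sub_cancel_left, norm_smul, Real.norm_of_nonneg hθ]
      exact (mul_le_of_le_one_left (norm_nonneg _) hθ1).trans hxy
    have a0 : τ * θ ≤ τ := mul_le_of_le_one_right hτ.le hθ1
    have a00 : 0 ≤ τ * θ := by positivity
    have a2 : |t + τ * θ - t| ≤ η := by
      rw [add_sub_cancel_left, abs_of_nonneg a00]
      linarith
    have a3 := abs_le.1 ((hg.abs_hGamma_sub_le hK hα.le hβ a1 a2).trans hδ)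
    have a4 := (xprime_sub_norm_le (x + θ • (y - x)) x).trans a1
    have a5 := norm_le_norm_add_norm_sub' (xprime (x + θ • (y - x))) (xprime x)
    refine ⟨by linarith, by linarith, by linarith, ?_⟩
    have : |t + τ * θ| ≤ 1 / 2 := abs_le.2 ⟨by linarith, by linarith⟩
    linarith
  · refine hxy.trans ?_
    rw [← sq_le_sq₀ hδ0 (by positivity), mul_pow, mul_pow, hr2]
    have : 2 ^ 2 * (τ / (20 * N)) * (N : ℝ) ^ 2 = τ * N / 5 := by field_simp; norm_num
    rw [this]
    linarith

lemma mkPt_xprime_xlast {m : ℕ} (x : Spc m) : mkPt (xprime x) (xlast x) = x := by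
  ext i
  refine Fin.lastCases ?_ (fun i => ?_) i
  · simp [mkPt, xlast]
  · simp [mkPt, xprime, Fin.castSucc_ne_last]

lemma exists_mesh {α β K : ℝ} (hα : 0 < α) (hβ : 0 < β) :
    ∃ J : ℕ, 0 < J ∧ (2 + 2 * K) * (1 / (J : ℝ)) ^ β +
      K * (((2 + 2 * K) * (1 / (J : ℝ)) ^ β) ^ α + (1 / (J : ℝ)) ^ β) ≤ 1 / 32 := by
  have hc : Continuous fun w : ℝ => (2 + 2 * K) * w ^ β +
      K * (((2 + 2 * K) * w ^ β) ^ α + w ^ β) := by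
    have h1 : Continuous fun w : ℝ => w ^ β := Real.continuous_rpow_const hβ.le
    have h2 : Continuous fun w : ℝ => ((2 + 2 * K) * w ^ β) ^ α :=
      (continuous_const.mul h1).rpow_const fun _ => Or.inr hα.le
    fun_prop
  have h0 := (hc.tendsto 0).comp tendsto_one_div_atTop_nhds_zero_nat
  simp only [Real.zero_rpow hβ.ne', mul_zero, Real.zero_rpow hα.ne', add_zero] at h0
  obtain ⟨J, hJ, hJ0⟩ := ((h0.eventually (gt_mem_nhds (show (0 : ℝ) < 1 / 32 by norm_num))).and
    (Filter.eventually_gt_atTop 0)).exists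
  exact ⟨J, hJ0, hJ.le⟩

lemma exists_small_rpow {L α b ε : ℝ} (hα : 0 < α) (hb : 0 < b) (hε : 0 < ε) :
    ∃ ρ, 0 < ρ ∧ ρ ≤ b ∧ L * ρ ^ α < ε := by
  have hc : Continuous fun w : ℝ => L * w ^ α :=
    continuous_const.mul (Real.continuous_rpow_const hα.le)
  have h0 := hc.tendsto 0
  simp only [Real.zero_rpow hα.ne', mul_zero] at h0
  have h1 : ∀ᶠ w in nhdsWithin (0 : ℝ) (Set.Ioi 0), L * w ^ α < ε :=
    (h0.mono_left nhdsWithin_le_nhds).eventually (gt_mem_nhds hε)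
  obtain ⟨ρ, h2, h3⟩ := (h1.and (Ioo_mem_nhdsGT hb)).exists
  exact ⟨ρ, h3.1, h3.2.le, h2⟩

/-- A path from `(x,t)` (at `θ = 0`) to `Ebar g` (at `θ = 1`); its spatial part. -/
def ebarPath {m : ℕ} (g : Spc' m → ℝ → ℝ) (x : Spc m) (t θ : ℝ) : Spc m :=
  mkPt ((1 - θ) • xprime x)
    ((1 - θ) * hGamma g (x, t) + θ * (1 / 2) + g ((1 - θ) • xprime x) (t + θ * (1 / 2 - t)))

lemma norm_ebarPath_sub_le {m : ℕ} {g : Spc' m → ℝ → ℝ} {α β K w : ℝ} (hg : HolderSemi α β K g)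
    (hK : 0 ≤ K) (hβ : 0 ≤ β) (hαβ : β ≤ α) (hα1 : α ≤ 1) {x : Spc m} {t : ℝ}
    (hx : ‖xprime x‖ ≤ 2 / 3) (ht : -(4 / 9) ≤ t) (ht1 : t ≤ 1 / 2)
    (h1 : 0 ≤ hGamma g (x, t)) (h2 : hGamma g (x, t) ≤ 2 / 3) (θ : ℝ) (hw : 0 < w)
    (hw1 : w ≤ 1) :
    ‖ebarPath g x t (θ + w) - ebarPath g x t θ‖ ≤ (2 + 2 * K) * w ^ β := by
  have e0 : (1 - (θ + w)) • xprime x - (1 - θ) • xprime x = (-w) • xprime x := by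
    rw [← sub_smul]; congr 1; ring
  have e1 : ‖(1 - (θ + w)) • xprime x - (1 - θ) • xprime x‖ ≤ w * (2 / 3) := by
    rw [e0, norm_smul, norm_neg, Real.norm_of_nonneg hw.le]
    exact mul_le_mul_of_nonneg_left hx hw.le
  have e2 : |t + (θ + w) * (1 / 2 - t) - (t + θ * (1 / 2 - t))| ≤ w := by
    have : t + (θ + w) * (1 / 2 - t) - (t + θ * (1 / 2 - t)) = w * (1 / 2 - t) := by ring
    rw [this, abs_of_nonneg (mul_nonneg hw.le (by linarith))]
    exact mul_le_of_le_one_right hw.le (by linarith)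
  have e3 := hg.abs_sub_le hK (hβ.trans hαβ) hβ (e1.trans (by linarith : w * (2 / 3) ≤ w)) e2
  have e4 : w ^ α ≤ w ^ β := Real.rpow_le_rpow_of_exponent_ge hw hw1 hαβ
  have e5 : w ≤ w ^ β := by
    conv_lhs => rw [← Real.rpow_one w]
    exact Real.rpow_le_rpow_of_exponent_ge hw hw1 (hαβ.trans hα1)
  have e6 : |w * (1 / 2 - hGamma g (x, t))| ≤ w := by
    rw [abs_mul, abs_of_pos hw]
    exact mul_le_of_le_one_right hw.le (abs_le.2 ⟨by linarith, by linarith⟩)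
  refine (norm_sub_le_xprime_xlast _ _).trans ?_
  unfold ebarPath
  rw [xprime_mkPt, xprime_mkPt, xlast_mkPt, xlast_mkPt]
  generalize g ((1 - (θ + w)) • xprime x) (t + (θ + w) * (1 / 2 - t)) = G₁ at *
  generalize g ((1 - θ) • xprime x) (t + θ * (1 / 2 - t)) = G₂ at *
  have e7 : (1 - (θ + w)) * hGamma g (x, t) + (θ + w) * (1 / 2) + G₁ -
      ((1 - θ) * hGamma g (x, t) + θ * (1 / 2) + G₂) =
      w * (1 / 2 - hGamma g (x, t)) + (G₁ - G₂) := by ring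
  rw [e7]
  have e8 := abs_add_le (w * (1 / 2 - hGamma g (x, t))) (G₁ - G₂)
  have e9 := mul_le_mul_of_nonneg_left e4 hK
  linarith

lemma exists_ebar_bound (m : ℕ) {α β K L C : ℝ} (hK : 0 ≤ K) (hα : 0 < α) (hα1 : α ≤ 1)
    (hβ : 0 < β) (hαβ : β ≤ α) (hL : 0 ≤ L) (hC : 0 ≤ C) :
    ∃ M : ℕ, ∀ (g : Spc' m → ℝ → ℝ) (u : Spc m × ℝ → ℝ), HolderSemi α β K g →
      HarnackSteps g L α C u → ∀ (x : Spc m) (t : ℝ), ‖xprime x‖ ≤ 2 / 3 → -(4 / 9) ≤ t →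
      t ≤ 23 / 50 → 1 / 16 ≤ hGamma g (x, t) → hGamma g (x, t) ≤ 2 / 3 →
      u (x, t) ≤ C ^ M * u (Ebar g) := by
  obtain ⟨J, hJ0, hJ⟩ := exists_mesh (K := K) hα hβ
  obtain ⟨ρ, hρ, hρ1, hLρ⟩ := exists_small_rpow (L := L) hα (b := 1 / 100) (ε := 1 / 32)
    (by norm_num) (by norm_num)
  have hJ' : (0 : ℝ) < J := by exact_mod_cast hJ0
  obtain ⟨w, hw⟩ : ∃ w : ℝ, w = 1 / J := ⟨_, rfl⟩
  have hw0 : 0 < w := hw ▸ by positivity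
  have hw1 : w ≤ 1 := hw ▸ (div_le_one hJ').2 (by exact_mod_cast hJ0)
  rw [← hw] at hJ
  obtain ⟨δ, hδ⟩ : ∃ δ, δ = (2 + 2 * K) * w ^ β := ⟨_, rfl⟩
  rw [← hδ] at hJ
  obtain ⟨N, hN⟩ := exists_nat_ge (max 1 (max (1 / (20 * ρ ^ 2)) (125 * J * δ ^ 2)))
  rw [max_le_iff, max_le_iff] at hN
  obtain ⟨hN1, hN2, hN3⟩ := hN
  rw [div_le_iff₀ (by positivity)] at hN2
  refine ⟨N * J, fun g u hg hu x t hx ht ht1 h1 h2 => ?_⟩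
  have key : ∀ j : ℕ, j ≤ J → u (ebarPath g x t 0, t + 0 * (1 / 2 - t)) ≤
      C ^ (N * j) * u (ebarPath g x t (j * w), t + j * w * (1 / 2 - t)) := by
    intro j
    induction j with
    | zero => intro _; simp
    | succ j ih =>
      intro hj
      have hθ : (j : ℝ) * w + w ≤ 1 := by
        have : ((j + 1 : ℕ) : ℝ) ≤ J := by exact_mod_cast hj
        rw [hw]
        push_cast at this
        have e : (j : ℝ) * (1 / J) + 1 / J = (j + 1) / J := by ring
        rw [e]
        exact (div_le_one hJ').2 this
      have hθ0 : 0 ≤ (j : ℝ) * w := by positivity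
      have hsplit : ((j + 1 : ℕ) : ℝ) * w = j * w + w := by push_cast; ring
      rw [hsplit]
      generalize (j : ℝ) * w = θ at *
      have hh : hGamma g (ebarPath g x t θ, t + θ * (1 / 2 - t)) =
          (1 - θ) * hGamma g (x, t) + θ * (1 / 2) := by
        have : ∀ p : Spc m × ℝ, hGamma g p = xlast p.1 - g (xprime p.1) p.2 := fun _ => rfl
        rw [this (ebarPath g x t θ, _)]
        unfold ebarPath
        simp only [xprime_mkPt, xlast_mkPt]
        ring
      have hτ1 : 1 / 25 * w ≤ w * (1 / 2 - t) := by
        rw [mul_comm]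
        exact mul_le_mul_of_nonneg_left (by linarith) hw0.le
      have hθ1 : 0 ≤ 1 - θ := by linarith
      have hθt : θ * (1 / 2 - t) + w * (1 / 2 - t) ≤ 1 / 2 - t := by
        rw [← add_mul]
        exact mul_le_of_le_one_left (by linarith) hθ
      have hτ2 : w * (1 / 2 - t) ≤ w := mul_le_of_le_one_right hw0.le (by linarith)
      have hs := hu.short_segment hC hg hK hα hβ.le hL (x := ebarPath g x t θ)
        (y := ebarPath g x t (θ + w)) (t := t + θ * (1 / 2 - t)) (δ := δ)
        (τ := w * (1 / 2 - t)) (η := w) (ρ := ρ) (N := N) ?_ ?_ ?_ ?_ ?_ ?_ ?_ hτ2 hJ hρ hρ1 hLρ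
        ?_ ?_ ?_
      · have e : t + θ * (1 / 2 - t) + w * (1 / 2 - t) = t + (θ + w) * (1 / 2 - t) := by ring
        rw [e] at hs
        refine (ih (by omega)).trans ?_
        rw [mul_add, mul_one, pow_add, mul_assoc]
        exact mul_le_mul_of_nonneg_left hs (by positivity)
      · unfold ebarPath
        rw [xprime_mkPt, norm_smul, Real.norm_of_nonneg (by linarith)]
        exact (mul_le_of_le_one_left (norm_nonneg _) (by linarith)).trans hx
      · linarith [mul_nonneg hθ0 (show 0 ≤ 1 / 2 - t by linarith)]
      · linarith
      · rw [hh]; linarith [mul_le_mul_of_nonneg_left h1 hθ1]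
      · rw [hh]; linarith [mul_le_mul_of_nonneg_left h2 hθ1]
      · rw [hδ]
        exact norm_ebarPath_sub_le hg hK hβ.le hαβ hα1 hx ht (by linarith) (by linarith) h2 θ
          hw0 hw1
      · exact mul_pos hw0 (by linarith)
      · have : (1 : ℝ) ≤ N := hN1
        exact_mod_cast this
      · linarith
      · have e1 : 5 * δ ^ 2 = 1 / 25 * w * (125 * J * δ ^ 2) := by rw [hw]; field_simp; ring
        rw [e1]
        exact mul_le_mul hτ1 hN3 (by positivity) (mul_nonneg hw0.le (by linarith))
  have hfin := key J le_rfl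
  have hJw : (J : ℝ) * w = 1 := by rw [hw]; field_simp
  rw [hJw] at hfin
  have e0 : ebarPath g x t 0 = x := by
    unfold ebarPath
    simp only [sub_zero, one_smul, one_mul, zero_mul, add_zero, hGamma, sub_add_cancel]
    exact mkPt_xprime_xlast x
  have e1 : (ebarPath g x t 1, t + 1 * (1 / 2 - t)) = Ebar g := by
    unfold ebarPath Ebar
    simp only [add_sub_cancel, sub_self, zero_smul, zero_mul, zero_add, one_mul]
    rw [add_comm]
  rw [e0, e1, zero_mul, add_zero] at hfin
  exact hfin

/-- **Stretched-exponential interior growth bound in Hölder domains**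
(estimate (3.2) in the proof of Lemma 3.2). -/
theorem interior_growth_bound_holder (m : ℕ) (hm : 1 ≤ m) (lam Lam K α : ℝ)
    (hlam : 0 < lam) (hlamLam : lam ≤ Lam) (hK : 0 < K)
    (hα : 1 / 2 < α) (hα1 : α < 1) :
    ∃ C₁ : ℝ, 0 < C₁ ∧
      ∀ (A : Spc m → Matrix (Fin (m + 1)) (Fin (m + 1)) ℝ), IsElliptic lam Lam A →
      ∀ g : Spc' m → ℝ → ℝ,
        Continuous (fun q : Spc' m × ℝ => g q.1 q.2) → g 0 0 = 0 →
        HolderSemi α (α / (1 + α)) K g →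
      ∀ u : Spc m × ℝ → ℝ,
        SolvesL A u (Cyl g 1) →
        (∀ p ∈ Cyl g 1, 0 < u p) →
        u (Ebar g) = 1 →
        ∀ p ∈ Cyl g (2 / 3), u p ≤ Real.exp (C₁ * hGamma g p ^ (1 - 1 / α)) := by
  obtain ⟨β, hβe⟩ : ∃ β, β = α / (1 + α) := ⟨_, rfl⟩
  rw [← hβe]
  have hα0 : 0 < α := by linarith
  have hβ : 0 < β := hβe ▸ by positivity
  have hαβ : β ≤ α := by
    rw [hβe, div_le_iff₀ (by positivity)]
    nlinarith
  have hαβ2 : α ≤ 2 * β := by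
    rw [hβe, ← mul_div_assoc, le_div_iff₀ (by positivity)]
    nlinarith
  have hαβ1 : (1 + 1 / α) * β = 1 := by
    rw [hβe]; field_simp; ring
  obtain ⟨C, hC, hHar, -⟩ := exists_harnack (m + 1) hlam hlamLam
  obtain ⟨c₁, h1, h2, h3⟩ := exists_small_rpow (L := 9 + 29 * K) hα0 (b := 1 / 4000)
    (ε := 1 / 2) (by norm_num) (by norm_num)
  obtain ⟨c₂, h4, -, h6⟩ := exists_small_rpow (L := K * 40 ^ β) hβ (b := 1) (ε := 1 / 10)
    (by norm_num) (by norm_num)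
  obtain ⟨c, hce⟩ : ∃ c, c = min c₁ c₂ := ⟨_, rfl⟩
  have hc : 0 < c := hce ▸ lt_min h1 h4
  have hc1 : c ≤ c₁ := hce ▸ min_le_left _ _
  have hc2 : c ≤ c₂ := hce ▸ min_le_right _ _
  have hLc : (9 + 29 * K) * c ^ α ≤ 1 / 2 :=
    (mul_le_mul_of_nonneg_left (Real.rpow_le_rpow hc.le hc1 hα0.le) (by positivity)).trans h3.le
  have hKc : K * (40 * c) ^ β ≤ 1 / 10 := by
    rw [Real.mul_rpow (by norm_num) hc.le, ← mul_assoc]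
    exact (mul_le_mul_of_nonneg_left (Real.rpow_le_rpow hc.le hc2 hβ.le)
      (by positivity)).trans h6.le
  obtain ⟨M, hM⟩ := exists_ebar_bound m (L := 9 + 29 * K) (C := C) hK.le hα0 hα1.le hβ hαβ
    (by positivity) (by linarith)
  have he : 1 - 1 / α < 0 := by
    have := (one_lt_div hα0).2 hα1
    linarith
  have h2e : (2 : ℝ) ^ (1 - 1 / α) < 1 := Real.rpow_lt_one_of_one_lt_of_neg (by norm_num) he
  have hlog : 0 ≤ Real.log C := Real.log_nonneg hC.le
  obtain ⟨B, hB⟩ : ∃ B, B = 2 * Real.log C / c / (1 - 2 ^ (1 - 1 / α)) := ⟨_, rfl⟩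
  have hB0 : 0 ≤ B := hB ▸ div_nonneg (by positivity) (by linarith)
  refine ⟨B + M * Real.log C + 1, by positivity, ?_⟩
  rintro A hA g hgc - hg u hu hpos hE ⟨x, t⟩ ⟨hx, ht1, ht2, hx1, hx2⟩
  have hst : HarnackSteps g (9 + 29 * K) α C u :=
    harnackSteps_of_solvesL hlam hlamLam hA hgc hg hK.le hα0 hα1.le hβ.le (hαβ.trans hα1.le) hαβ2
      hHar hu hpos
  have hG : hGamma g (x, t) = xlast x - g (xprime x) t := rfl
  simp only at hx ht1 ht2 hx1 hx2
  have hh0 : 0 < hGamma g (x, t) := by linarith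
  have hh1 : hGamma g (x, t) < 2 / 3 := by linarith
  obtain ⟨j, hj⟩ := pow_unbounded_of_one_lt (1 / 16 / hGamma g (x, t)) (one_lt_two (α := ℝ))
  rw [div_lt_iff₀ hh0] at hj
  have hch : 0 < 40 * c * hGamma g (x, t) := by positivity
  obtain ⟨y, s, k1, k2, k3, k4, k5, k6⟩ := hst.climb hC.le hg hK.le hα0 hα1 hβ.le hαβ1 hc
    (hc1.trans h2) hLc hKc hpos j x t hx (by linarith) hh0 hh1 (by linarith) hj.le
  have hcs : 40 * c * hGamma g (y, s) ≤ 1 / 100 * (2 / 3) :=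
    mul_le_mul (by linarith) k5.le (by linarith) (by norm_num)
  have hMy := hM g u hg hst y s (by rw [k1]; exact hx.le) (by linarith) (by linarith) k4 k5.le
  rw [hE, mul_one, ← Real.exp_log (show 0 < C by linarith), ← Real.exp_nat_mul] at hMy
  rw [← hB] at k6
  have h1h : 1 ≤ hGamma g (x, t) ^ (1 - 1 / α) :=
    Real.one_le_rpow_of_pos_of_le_one_of_nonpos hh0 (by linarith) he.le
  refine (k6.trans (mul_le_mul_of_nonneg_left hMy (Real.exp_pos _).le)).trans ?_
  rw [← Real.exp_add, Real.exp_le_exp]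
  have hMl : 0 ≤ M * Real.log C := by positivity
  nlinarith
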